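/- Let p and q be prime numbers and let r and s be nonnegative integers with p^r q^s > 1. Every semisimple Hopf algebra H over ℂ of dimension p^r q^s has a nontrivial one-dimensional representation; that is, there exists a ℂ-algebra homomorphism φ : H → ℂ with φ ≠ ε, where ε is the counit of H. -/

import Mathlib

local notation:25 M " ⇾ " N:0 => LinearMap (RingHom.id ℂ) M N
local notation:25 M " ⇝ " N => AlgHom ℂ M N
local notation:100 M:100 " ⊠ " N:101 => TensorProduct ℂ M N
theorem TI {M N : Type*} [AddCommGroup M] [Module ℂ M] [AddCommGroup N] [Module ℂ N]
    {motive : M ⊠ N → Prop} (z : M ⊠ N) (zero : motive 0) (tmul : ∀ x y, motive (TensorProduct.tmul ℂ x y))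
    (add : ∀ x y, motive x → motive y → motive (x + y)) : motive z :=
  TensorProduct.induction_on z zero tmul add
section
open Finset
structure FR (I : Type) [Fintype I] [DecidableEq I] where
  N : I → I → I → ℕ
  d : I → ℕ
  st : I → I
  o : I
  d_pos : ∀ i, 0 < d i
  d_o : d o = 1
  d_mul : ∀ i j, d i * d j = ∑ k, N i j k * d k
  one_mul : ∀ i k, N o i k = if i = k then 1 else 0
  st_st : ∀ i, st (st i) = i
  st_o : st o = o
  d_st : ∀ i, d (st i) = d i
  frob : ∀ i j k, N i j k = N (st i) k j
  frob2 : ∀ i j k, N i j k = N k (st j) i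
namespace FR
variable {I : Type} [Fintype I] [DecidableEq I] (C : FR I)
structure IsFus (B : Finset I) : Prop where
  o_mem : C.o ∈ B
  st_mem : ∀ i ∈ B, C.st i ∈ B
  mul_mem : ∀ i ∈ B, ∀ j ∈ B, ∀ k, C.N i j k ≠ 0 → k ∈ B
def dim (B : Finset I) : ℕ := ∑ i ∈ B, C.d i ^ 2
lemma N_st_o (i : I) : C.N i (C.st i) C.o = 1 := by
  rw [C.frob2, C.st_st, C.one_mul]; simp
lemma N_st_o' (i k : I) : C.N (C.st i) i k = C.N i k i := by
  rw [C.frob, C.st_st]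
lemma sum_N_d (i k : I) : ∑ j, C.N i j k * C.d j = C.d i * C.d k := by
  rw [← C.d_st i, C.d_mul]
  exact Finset.sum_congr rfl fun j _ => by rw [C.frob]
lemma sum_N_d' (j k : I) : ∑ i, C.N i j k * C.d i = C.d j * C.d k := by
  rw [mul_comm, ← C.d_st j, C.d_mul]
  exact Finset.sum_congr rfl fun i _ => by rw [C.frob2]
lemma eig_bound (i : I) (v : I → ℂ) (hv : v ≠ 0) (t : ℂ)
    (h : ∀ j, ∑ k, (C.N i j k : ℂ) * v k = t * v j) : ‖t‖ ≤ C.d i := by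
  obtain ⟨j, -, hj⟩ := Finset.exists_max_image univ (fun j => ‖v j‖ / (C.d j : ℝ)) ⟨C.o, mem_univ _⟩
  have dp : ∀ j, (0:ℝ) < C.d j := fun j => by exact_mod_cast C.d_pos j
  have hj' : ∀ k, ‖v k‖ ≤ ‖v j‖ / C.d j * C.d k := fun k => by
    have := hj k (mem_univ _)
    rwa [div_le_iff₀ (dp k)] at this
  have hpos : 0 < ‖v j‖ := by
    by_contra hc
    have h0 : ‖v j‖ = 0 := le_antisymm (not_lt.mp hc) (norm_nonneg _)
    apply hv
    funext k
    have := hj' k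
    rw [h0] at this
    simpa using this
  have h1 : ‖t‖ * ‖v j‖ ≤ C.d i * ‖v j‖ := by
    rw [← norm_mul, ← h j]
    calc _ ≤ ∑ k, ‖(C.N i j k : ℂ) * v k‖ := norm_sum_le _ _
      _ ≤ ∑ k, (C.N i j k : ℝ) * (‖v j‖ / C.d j * C.d k) := by
        refine Finset.sum_le_sum fun k _ => ?_
        rw [norm_mul, Complex.norm_natCast]
        exact mul_le_mul_of_nonneg_left (hj' k) (by positivity)
      _ = ‖v j‖ / C.d j * ((∑ k, C.N i j k * C.d k : ℕ) : ℝ) := by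
        push_cast
        rw [Finset.mul_sum]
        exact Finset.sum_congr rfl fun k _ => by ring
      _ = _ := by
        rw [← C.d_mul]; push_cast
        have := (dp j).ne'
        field_simp
  exact le_of_mul_le_mul_right h1 hpos
lemma eq_of_re {k : I} {z : ℂ} (h7 : ‖z‖ ≤ C.d k) (h6 : z.re = C.d k) : z = C.d k := by
  have h8 : ‖z‖ = z.re := le_antisymm (h6 ▸ h7) (Complex.re_le_norm _)
  have h9 : z.im = 0 := by
    have h10 := Complex.sq_norm z
    rw [h8, Complex.normSq_apply] at h10
    have : z.im * z.im = 0 := by linarith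
    simpa using this
  apply Complex.ext
  · simpa using h6
  · simpa using h9
structure IsChar (l : I → ℂ) : Prop where
  one : l C.o = 1
  mul : ∀ i j, l i * l j = ∑ k, (C.N i j k : ℂ) * l k
variable {C}
namespace IsChar
variable {l : I → ℂ} (hl : C.IsChar l)
include hl
lemma ne_zero : l ≠ 0 := fun h => by have := hl.one; simp [h] at this
lemma bound (i : I) : ‖l i‖ ≤ C.d i :=
  C.eig_bound i l hl.ne_zero (l i) fun j => (hl.mul i j).symm
lemma star (i : I) : l (C.st i) = (starRingEnd ℂ) (l i) := by
  set n : ℂ := ∑ j, (starRingEnd ℂ) (l j) * l j with hn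
  have hn0 : n ≠ 0 := by
    have : n = ((∑ j, ‖l j‖ ^ 2 : ℝ) : ℂ) := by
      rw [hn]; push_cast
      exact Finset.sum_congr rfl fun j _ => by rw [mul_comm, Complex.mul_conj, Complex.normSq_eq_norm_sq]; simp
    rw [this]
    norm_cast
    have : (0:ℝ) < ∑ j, ‖l j‖ ^ 2 := by
      refine Finset.sum_pos' (fun j _ => by positivity) ⟨C.o, mem_univ _, ?_⟩
      rw [hl.one]; simp
    exact this.ne'
  have h1 : l (C.st i) * n = ∑ j, ∑ k, (starRingEnd ℂ) (l j) * ((C.N i k j : ℂ) * l k) := by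
    rw [hn, Finset.mul_sum]
    refine Finset.sum_congr rfl fun j _ => ?_
    rw [mul_left_comm, hl.mul, Finset.mul_sum]
    refine Finset.sum_congr rfl fun k _ => ?_
    rw [C.frob i]
  have h2 : (starRingEnd ℂ) (l i) * n = ∑ k, ∑ j, (starRingEnd ℂ) (l j) * ((C.N i k j : ℂ) * l k) := by
    rw [hn, Finset.mul_sum]
    refine Finset.sum_congr rfl fun k _ => ?_
    rw [← mul_assoc, ← map_mul, hl.mul, map_sum, Finset.sum_mul]
    refine Finset.sum_congr rfl fun j _ => ?_
    rw [map_mul, Complex.conj_natCast]; ring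
  rw [Finset.sum_comm, ← h1] at h2
  exact (mul_right_cancel₀ hn0 h2).symm
lemma eq_case (i j : I) (h : l i * l j = C.d i * C.d j) (k : I) (hk : C.N i j k ≠ 0) :
    l k = C.d k := by
  have hre : ∀ k, (l k).re ≤ C.d k := fun k => (Complex.re_le_norm _).trans (hl.bound k)
  rw [hl.mul] at h
  have h2 : ∑ k, (C.N i j k : ℝ) * (l k).re = ∑ k, (C.N i j k : ℝ) * C.d k := by
    have h3 := congrArg Complex.re h
    have h4 : ((C.d i : ℂ) * C.d j).re = ((C.d i * C.d j : ℕ) : ℝ) := by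
      rw [← Nat.cast_mul, Complex.natCast_re]
    rw [h4, C.d_mul, Complex.re_sum] at h3
    push_cast at h3
    rw [← h3]
    refine Finset.sum_congr rfl fun k _ => ?_
    simp
  have h5 := (Finset.sum_eq_sum_iff_of_le (fun k _ => 
    mul_le_mul_of_nonneg_left (hre k) (by positivity : (0:ℝ) ≤ C.N i j k))).1 h2 k (mem_univ _)
  have h6 : (l k).re = C.d k := mul_left_cancel₀ (by exact_mod_cast hk) h5
  exact C.eq_of_re (hl.bound k) h6
lemma isFus {B : Finset I} (hB : C.IsFus B) [DecidablePred fun i => l i = C.d i] :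
    C.IsFus (B.filter fun i => l i = C.d i) := by
  refine ⟨?_, ?_, ?_⟩
  · simp [hB.o_mem, hl.one, C.d_o]
  · intro i hi
    simp only [mem_filter] at hi ⊢
    refine ⟨hB.st_mem _ hi.1, ?_⟩
    rw [hl.star, hi.2, C.d_st, Complex.conj_natCast]
  · intro i hi j hj k hk
    simp only [mem_filter] at hi hj ⊢
    exact ⟨hB.mul_mem _ hi.1 _ hj.1 _ hk, hl.eq_case i j (by rw [hi.2, hj.2]) k hk⟩
lemma sum_zero {B : Finset I} (hB : C.IsFus B) {x : I} (hx : x ∈ B) (h : l x ≠ C.d x) :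
    ∑ i ∈ B, (C.d i : ℂ) * l i = 0 := by
  have h1 : l x * ∑ i ∈ B, (C.d i : ℂ) * l i = C.d x * ∑ i ∈ B, (C.d i : ℂ) * l i := by
    calc _ = ∑ i ∈ B, ∑ w ∈ B, (C.d i : ℂ) * ((C.N x i w : ℂ) * l w) := by
          rw [Finset.mul_sum]
          refine Finset.sum_congr rfl fun i hi => ?_
          rw [mul_left_comm, hl.mul, Finset.mul_sum]
          symm
          refine Finset.sum_subset (subset_univ _) fun w _ hw => ?_
          have : C.N x i w = 0 := by
            by_contra hc; exact hw (hB.mul_mem _ hx _ hi _ hc)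
          simp [this]
      _ = ∑ w ∈ B, ∑ i ∈ B, (C.d i : ℂ) * ((C.N x i w : ℂ) * l w) := Finset.sum_comm
      _ = _ := by
          rw [Finset.mul_sum]
          refine Finset.sum_congr rfl fun w hw => ?_
          have : ∑ i ∈ B, (C.d i : ℂ) * ((C.N x i w : ℂ) * l w) =
              ∑ i, (C.d i : ℂ) * ((C.N x i w : ℂ) * l w) := by
            refine Finset.sum_subset (subset_univ _) fun i _ hi => ?_
            have : C.N x i w = 0 := by
              by_contra hc
              rw [C.frob] at hc
              exact hi (hB.mul_mem _ (hB.st_mem _ hx) _ hw _ hc)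
            simp [this]
          rw [this]
          have := C.sum_N_d x w
          have h2 : ((∑ j, C.N x j w * C.d j : ℕ) : ℂ) = C.d x * C.d w := by rw [this]; push_cast; rfl
          rw [← mul_assoc, ← h2]; push_cast
          rw [Finset.sum_mul]
          exact Finset.sum_congr rfl fun i _ => by ring
  have h2 : (l x - C.d x) * ∑ i ∈ B, (C.d i : ℂ) * l i = 0 := by rw [sub_mul, h1, sub_self]
  rcases mul_eq_zero.1 h2 with h3 | h3
  · exact absurd (sub_eq_zero.1 h3) h
  · exact h3
omit hl in
lemma sum_dim {B : Finset I} (h : ∀ x ∈ B, l x = C.d x) :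
    ∑ i ∈ B, (C.d i : ℂ) * l i = C.dim B := by
  rw [FR.dim]; push_cast
  exact Finset.sum_congr rfl fun i hi => by rw [h i hi, sq]
end IsChar
def mat (C : FR I) (i : I) : Matrix I I ℤ := fun j k => (C.N i j k : ℤ)
lemma root_of_eig (i : I) (v : I → ℂ) (hv : v ≠ 0) (t : ℂ)
    (h : ∀ j, ∑ k, (C.N i j k : ℂ) * v k = t * v j) :
    Polynomial.aeval t (C.mat i).charpoly = 0 := by
  rw [Polynomial.aeval_def, ← Polynomial.eval_map, ← Matrix.charpoly_map, Matrix.eval_charpoly]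
  apply Matrix.exists_mulVec_eq_zero_iff.1
  refine ⟨v, hv, ?_⟩
  funext j
  rw [Matrix.sub_mulVec]
  simp only [Matrix.scalar_apply, Pi.sub_apply, Matrix.mulVec_diagonal, Pi.zero_apply]
  rw [← h j]
  simp [Matrix.mulVec, dotProduct, mat]
lemma eig_of_root (i : I) (t : ℂ) (h : Polynomial.aeval t (C.mat i).charpoly = 0) :
    ∃ v : I → ℂ, v ≠ 0 ∧ ∀ j, ∑ k, (C.N i j k : ℂ) * v k = t * v j := by
  rw [Polynomial.aeval_def, ← Polynomial.eval_map, ← Matrix.charpoly_map, Matrix.eval_charpoly] at h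
  obtain ⟨v, hv, h⟩ := Matrix.exists_mulVec_eq_zero_iff.2 h
  refine ⟨v, hv, fun j => ?_⟩
  have := congrFun h j
  rw [Matrix.sub_mulVec] at this
  simp only [Matrix.scalar_apply, Pi.sub_apply, Matrix.mulVec_diagonal, Pi.zero_apply, sub_eq_zero] at this
  rw [this]
  simp [Matrix.mulVec, dotProduct, mat]
lemma IsChar.root {l : I → ℂ} (hl : C.IsChar l) (i : I) :
    Polynomial.aeval (l i) (C.mat i).charpoly = 0 :=
  root_of_eig i l hl.ne_zero _ fun j => (hl.mul i j).symm
lemma IsChar.isIntegral {l : I → ℂ} (hl : C.IsChar l) (i : I) : IsIntegral ℤ (l i) :=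
  ⟨_, Matrix.charpoly_monic _, by rw [← Polynomial.aeval_def]; exact hl.root i⟩
lemma IsChar.norm_eq {l : I → ℂ} (hl : C.IsChar l) (i : I) (hint : IsIntegral ℤ (l i / C.d i))
    (hne : l i ≠ 0) : ‖l i‖ = C.d i := by
  set z := l i / (C.d i : ℂ) with hz
  have hd0 : (C.d i : ℂ) ≠ 0 := by exact_mod_cast (C.d_pos i).ne'
  have hlz : l i = C.d i * z := by rw [hz]; field_simp
  have hzQ : IsIntegral ℚ z := hint.tower_top
  let K := IntermediateField.adjoin ℚ {z}
  have : FiniteDimensional ℚ K := IntermediateField.adjoin.finiteDimensional hzQ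
  have : NumberField K := ⟨⟩
  let x : K := IntermediateField.AdjoinSimple.gen ℚ z
  have hx : (algebraMap K ℂ) x = z := IntermediateField.AdjoinSimple.algebraMap_gen ℚ z
  have hinj : Function.Injective (algebraMap K ℂ) := (algebraMap K ℂ).injective
  have hxi : IsIntegral ℤ x := by
    have := (isIntegral_algHom_iff ((algebraMap K ℂ).toIntAlgHom) hinj (x := x)).1
    exact this (by simpa [hx] using hint)
  have hroot : Polynomial.aeval ((C.d i : K) * x) (C.mat i).charpoly = 0 := by
    apply hinj
    have := Polynomial.aeval_algHom_apply ((algebraMap K ℂ).toIntAlgHom) ((C.d i : K) * x) (C.mat i).charpoly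
    simp only [RingHom.toIntAlgHom_apply, map_mul, map_natCast, hx] at this
    rw [← this, map_zero, ← hlz]
    exact hl.root i
  have hz0 : z ≠ 0 := fun h => hne (by rw [hlz, h, mul_zero])
  obtain ⟨n, hn, h1⟩ := NumberField.Embeddings.pow_eq_one_of_norm_le_one (K := K) (A := ℂ) (x := x)
    (fun h => hz0 (by rw [← hx, h, map_zero])) hxi (fun φ => by
      have h2 : Polynomial.aeval ((C.d i : ℂ) * φ x) (C.mat i).charpoly = 0 := by
        have := Polynomial.aeval_algHom_apply (φ.toIntAlgHom) ((C.d i : K) * x) (C.mat i).charpoly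
        rw [hroot] at this
        simpa using this
      obtain ⟨v, hv, h3⟩ := eig_of_root i _ h2
      have h4 := C.eig_bound i v hv _ h3
      rw [norm_mul, Complex.norm_natCast] at h4
      have : (0:ℝ) < C.d i := by exact_mod_cast C.d_pos i
      nlinarith)
  have h5 : z ^ n = 1 := by rw [← hx, ← map_pow, h1, map_one]
  have h6 : ‖z‖ = 1 := Complex.norm_eq_one_of_pow_eq_one h5 hn.ne'
  rw [hlz, norm_mul, h6]; simp
end FR
end
section
open Finset
structure ZDat {I J : Type} [Fintype I] [DecidableEq I] [Fintype J] [DecidableEq J]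
    (C : FR I) (Z : FR J) where
  S : J → J → ℂ
  S_symm : ∀ X Y, S X Y = S Y X
  S_mul : ∀ X X' Y, S X Y * S X' Y = Z.d Y * ∑ W, (Z.N X X' W : ℂ) * S W Y
  S_o : ∀ Y, S Z.o Y = Z.d Y
  F : J → I → ℕ
  F_o : ∀ i, F Z.o i = if i = C.o then 1 else 0
  F_mul : ∀ X X' k, ∑ W, Z.N X X' W * F W k = ∑ i, ∑ j, F X i * F X' j * C.N i j k
  F_d : ∀ Y, ∑ i, F Y i * C.d i = Z.d Y
  F_st : ∀ Y i, F (Z.st Y) i = F Y (C.st i)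
  S1 : ∀ Y, ∑ X, (F X C.o : ℂ) * S X Y = C.dim univ * F Y C.o
  S2 : ∀ k, ∑ Y, F Y C.o * F Y k = ∑ V, C.N (C.st V) V k
  C1 : ∀ B, C.IsFus B → B = {C.o} ∨ B = univ
  C2 : ∀ i, C.d i = 1 → i = C.o
  one_lt : 1 < C.dim univ
namespace ZDat
open scoped Classical
variable {I J : Type} [Fintype I] [DecidableEq I] [Fintype J] [DecidableEq J]
  {C : FR I} {Z : FR J} (D : ZDat C Z)
lemma dC0 (i : I) : (C.d i : ℂ) ≠ 0 := by exact_mod_cast (C.d_pos i).ne'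
noncomputable def lam (Y X : J) : ℂ := D.S X Y / Z.d Y
lemma S_lam (X Y : J) : D.S X Y = D.lam Y X * Z.d Y := by
  rw [lam, div_mul_cancel₀ _ (dC0 (C := Z) Y)]
lemma lam_char (Y : J) : Z.IsChar (D.lam Y) := by
  have h := dC0 (C := Z) Y
  refine ⟨by rw [lam, D.S_o, div_self h], fun i j => ?_⟩
  simp only [lam]
  rw [div_mul_div_comm, D.S_mul, mul_div_mul_left _ _ h, Finset.sum_div]
  exact Finset.sum_congr rfl fun k _ => by rw [mul_div_assoc]
lemma lam_eq_iff (X Y : J) : D.lam Y X = Z.d X ↔ D.S X Y = Z.d X * Z.d Y := by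
  rw [lam, div_eq_iff (dC0 (C := Z) Y)]
lemma lam_symm (X Y : J) : D.lam Y X = Z.d X ↔ D.lam X Y = Z.d Y := by
  rw [lam_eq_iff, lam_eq_iff, D.S_symm, mul_comm]
def n (Y : J) : ℕ := D.F Y C.o
def a (B : Finset J) : ℕ := ∑ Y ∈ B, Z.d Y * D.n Y
noncomputable def im (B : Finset J) : Finset I := univ.filter fun i => ∃ Y ∈ B, D.F Y i ≠ 0
noncomputable def cen (B : Finset J) : Finset J := univ.filter fun Y => ∀ X ∈ B, D.lam Y X = Z.d X
lemma mem_cen {B : Finset J} {Y : J} : Y ∈ D.cen B ↔ ∀ X ∈ B, D.lam Y X = Z.d X := by simp [cen]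
lemma mem_im {B : Finset J} {i : I} : i ∈ D.im B ↔ ∃ Y ∈ B, D.F Y i ≠ 0 := by simp [im]
lemma n_o : D.n Z.o = 1 := by simp [n, D.F_o]
lemma cen_fus (B : Finset J) : Z.IsFus (D.cen B) := by
  have key : ∀ X, ∀ Y, D.lam Y X = Z.d X ↔ Y ∈ (univ.filter fun Y => D.lam X Y = Z.d Y) := by
    intro X Y; simp [D.lam_symm X Y]
  have hu : Z.IsFus (univ : Finset J) := ⟨mem_univ _, fun _ _ => mem_univ _, fun _ _ _ _ _ _ => mem_univ _⟩
  have hf : ∀ X, Z.IsFus (univ.filter fun Y => D.lam X Y = Z.d Y) := fun X =>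
    (D.lam_char X).isFus hu
  refine ⟨?_, ?_, ?_⟩
  · rw [mem_cen]; intro X _; rw [key]; exact (hf X).o_mem
  · intro i hi; rw [mem_cen] at hi ⊢
    intro X hX; rw [key]; exact (hf X).st_mem _ ((key X i).1 (hi X hX))
  · intro i hi j hj k hk; rw [mem_cen] at hi hj ⊢
    intro X hX; rw [key]
    exact (hf X).mul_mem _ ((key X i).1 (hi X hX)) _ ((key X j).1 (hj X hX)) _ hk
lemma im_fus {B : Finset J} (hB : Z.IsFus B) : C.IsFus (D.im B) := by
  refine ⟨?_, ?_, ?_⟩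
  · rw [mem_im]; exact ⟨Z.o, hB.o_mem, by simp [D.F_o]⟩
  · intro i hi; rw [mem_im] at hi ⊢
    obtain ⟨Y, hY, h⟩ := hi
    exact ⟨Z.st Y, hB.st_mem _ hY, by rwa [D.F_st, C.st_st]⟩
  · intro i hi j hj k hk; rw [mem_im] at hi hj ⊢
    obtain ⟨X, hX, hi⟩ := hi
    obtain ⟨Y, hY, hj⟩ := hj
    have h1 : ∑ W, Z.N X Y W * D.F W k ≠ 0 := by
      rw [D.F_mul]
      intro h0
      rw [Finset.sum_eq_zero_iff] at h0
      have h1 := h0 i (mem_univ _)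
      rw [Finset.sum_eq_zero_iff] at h1
      have h2 := h1 j (mem_univ _)
      exact (mul_ne_zero (mul_ne_zero hi hj) hk) h2
    obtain ⟨W, -, hW⟩ := Finset.exists_ne_zero_of_sum_ne_zero h1
    exact ⟨W, hB.mul_mem _ hX _ hY _ (left_ne_zero_of_mul hW), right_ne_zero_of_mul hW⟩
def r (B : Finset J) (i : I) : ℕ := ∑ Y ∈ B, Z.d Y * D.F Y i
lemma r_o (B : Finset J) : D.r B C.o = D.a B := rfl
lemma sum_r_d (B : Finset J) : ∑ i, D.r B i * C.d i = Z.dim B := by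
  simp only [r, FR.dim, Finset.sum_mul]
  rw [Finset.sum_comm]
  refine Finset.sum_congr rfl fun Y _ => ?_
  rw [sq]
  nth_rewrite 3 [← D.F_d]
  rw [Finset.mul_sum]
  exact Finset.sum_congr rfl fun i _ => by ring
lemma r_mul {B : Finset J} (hB : Z.IsFus B) (k : I) :
    ∑ i, ∑ j, D.r B i * C.N i j k * D.r B j = Z.dim B * D.r B k := by
  calc _ = ∑ X ∈ B, ∑ Y ∈ B, Z.d X * Z.d Y * ∑ i, ∑ j, D.F X i * D.F Y j * C.N i j k := by
        simp only [r, Finset.sum_mul, Finset.mul_sum]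
        have e1 : ∀ i, ∑ j, ∑ Y ∈ B, ∑ X ∈ B, Z.d X * D.F X i * C.N i j k * (Z.d Y * D.F Y j)
          = ∑ X ∈ B, ∑ Y ∈ B, ∑ j, Z.d X * Z.d Y * (D.F X i * D.F Y j * C.N i j k) := by
          intro i
          rw [Finset.sum_comm]
          rw [Finset.sum_comm (s := B) (t := B)]
          refine Finset.sum_congr rfl fun Y _ => ?_
          rw [Finset.sum_comm]
          refine Finset.sum_congr rfl fun X _ => ?_
          refine Finset.sum_congr rfl fun j _ => ?_
          ring
        rw [Finset.sum_congr rfl fun i _ => e1 i]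
        rw [Finset.sum_comm]
        refine Finset.sum_congr rfl fun X _ => ?_
        rw [Finset.sum_comm]
    _ = ∑ X ∈ B, ∑ Y ∈ B, ∑ W ∈ B, Z.d X * Z.d Y * (Z.N X Y W * D.F W k) := by
        refine Finset.sum_congr rfl fun X hX => Finset.sum_congr rfl fun Y hY => ?_
        rw [← D.F_mul, Finset.mul_sum]
        symm
        refine Finset.sum_subset (subset_univ _) fun W _ hW => ?_
        have : Z.N X Y W = 0 := by by_contra hc; exact hW (hB.mul_mem _ hX _ hY _ hc)
        simp [this]
    _ = ∑ X ∈ B, ∑ W ∈ B, Z.d X * (Z.d X * Z.d W) * D.F W k := by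
        refine Finset.sum_congr rfl fun X hX => ?_
        rw [Finset.sum_comm]
        refine Finset.sum_congr rfl fun W hW => ?_
        have : ∑ Y ∈ B, Z.d X * Z.d Y * (Z.N X Y W * D.F W k) =
            ∑ Y, Z.d X * Z.d Y * (Z.N X Y W * D.F W k) := by
          refine Finset.sum_subset (subset_univ _) fun Y _ hY => ?_
          have : Z.N X Y W = 0 := by
            by_contra hc
            rw [Z.frob] at hc
            exact hY (hB.mul_mem _ (hB.st_mem _ hX) _ hW _ hc)
          simp [this]
        rw [this, ← Z.sum_N_d, Finset.mul_sum, Finset.sum_mul]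
        exact Finset.sum_congr rfl fun i _ => by ring
    _ = _ := by
        rw [r, FR.dim, Finset.sum_mul]
        refine Finset.sum_congr rfl fun X hX => ?_
        rw [Finset.mul_sum]
        exact Finset.sum_congr rfl fun i _ => by ring
lemma r_prop {B : Finset J} (hB : Z.IsFus B) (him : D.im B = univ) (i : I) :
    D.r B i = D.a B * C.d i := by
  have rp : ∀ i, 0 < D.r B i := by
    intro i
    have : i ∈ D.im B := him ▸ mem_univ i
    obtain ⟨Y, hY, h⟩ := D.mem_im.1 this
    exact Finset.sum_pos' (fun _ _ => Nat.zero_le _) ⟨Y, hY, Nat.pos_of_ne_zero (mul_ne_zero (Z.d_pos Y).ne' h)⟩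
  have dp : ∀ j, (0:ℝ) < C.d j := fun j => by exact_mod_cast C.d_pos j
  obtain ⟨k, -, hk⟩ := Finset.exists_max_image univ (fun j => (D.r B j : ℝ) / (C.d j : ℝ)) ⟨C.o, mem_univ _⟩
  have hk' : ∀ j, D.r B j * C.d k ≤ D.r B k * C.d j := by
    intro j
    have := hk j (mem_univ _)
    rw [div_le_div_iff₀ (dp j) (dp k)] at this
    exact_mod_cast this
  have h1 := D.r_mul hB k
  have h2 : ∑ i, ∑ j, D.r B i * C.N i j k * (D.r B j * C.d k) =
      ∑ i, ∑ j, D.r B i * C.N i j k * (D.r B k * C.d j) := by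
    calc _ = (∑ i, ∑ j, D.r B i * C.N i j k * D.r B j) * C.d k := by
          rw [Finset.sum_mul]
          refine Finset.sum_congr rfl fun i _ => ?_
          rw [Finset.sum_mul]
          refine Finset.sum_congr rfl fun j _ => by ring
      _ = (∑ i, D.r B i * (C.d i * C.d k)) * D.r B k := by
          rw [h1, ← D.sum_r_d, Finset.sum_mul, Finset.sum_mul, Finset.sum_mul]
          exact Finset.sum_congr rfl fun j _ => by ring
      _ = _ := by
          rw [Finset.sum_mul]
          refine Finset.sum_congr rfl fun i _ => ?_
          rw [← C.sum_N_d, Finset.mul_sum, Finset.sum_mul]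
          refine Finset.sum_congr rfl fun j _ => by ring
  have hle : ∀ i j, D.r B i * C.N i j k * (D.r B j * C.d k) ≤ D.r B i * C.N i j k * (D.r B k * C.d j) :=
    fun i j => Nat.mul_le_mul_left _ (hk' j)
  have h3 := (Finset.sum_eq_sum_iff_of_le (fun i _ => Finset.sum_le_sum fun j _ => hle i j)).1 h2
  have h4 : ∀ j, D.r B j * C.d k = D.r B k * C.d j := by
    intro j
    have h5 : ∑ i, C.N i j k * C.d i ≠ 0 := by
      rw [C.sum_N_d']; exact mul_ne_zero (C.d_pos _).ne' (C.d_pos _).ne'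
    obtain ⟨i, -, hi⟩ := Finset.exists_ne_zero_of_sum_ne_zero h5
    have h6 := (Finset.sum_eq_sum_iff_of_le (fun j _ => hle i j)).1 (h3 i (mem_univ _)) j (mem_univ _)
    exact Nat.eq_of_mul_eq_mul_left
      (Nat.pos_of_ne_zero (mul_ne_zero (rp i).ne' (left_ne_zero_of_mul hi))) h6
  have h7 := h4 C.o
  rw [C.d_o, r_o, _root_.mul_one] at h7
  have h8 := h4 i
  rw [← h7] at h8
  exact Nat.eq_of_mul_eq_mul_right (C.d_pos k) (by rw [h8]; ring)
lemma dim_of_im {B : Finset J} (hB : Z.IsFus B) (him : D.im B = univ) :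
    Z.dim B = D.a B * C.dim univ := by
  rw [← D.sum_r_d, FR.dim, Finset.mul_sum]
  exact Finset.sum_congr rfl fun i _ => by rw [D.r_prop hB him]; ring
lemma S_eq (X Y : J) (B : Finset J) (hY : Y ∈ D.cen B) (hX : X ∈ B) : D.S X Y = Z.d X * Z.d Y :=
  (D.lam_eq_iff _ _).1 (D.mem_cen.1 hY X hX)
lemma sum_cen {B : Finset J} (hB : Z.IsFus B) (Y : J) :
    ∑ X ∈ B, (Z.d X : ℂ) * D.S X Y = if Y ∈ D.cen B then (Z.dim B : ℂ) * Z.d Y else 0 := by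
  have e : ∑ X ∈ B, (Z.d X : ℂ) * D.S X Y = (∑ X ∈ B, (Z.d X : ℂ) * D.lam Y X) * Z.d Y := by
    rw [Finset.sum_mul]
    exact Finset.sum_congr rfl fun X _ => by rw [S_lam]; ring
  rw [e]
  split_ifs with h
  · rw [FR.IsChar.sum_dim (D.mem_cen.1 h)]
  · rw [D.mem_cen] at h
    push Not at h
    obtain ⟨X, hX, h⟩ := h
    rw [(D.lam_char Y).sum_zero hB hX h, zero_mul]
lemma a_cen {B : Finset J} (hB : Z.IsFus B) :
    C.dim univ * D.a B = Z.dim B * D.a (D.cen B) := by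
  have h : ∑ Y, (D.n Y : ℂ) * ∑ X ∈ B, (Z.d X : ℂ) * D.S X Y = C.dim univ * D.a B := by
    simp only [Finset.mul_sum]
    rw [Finset.sum_comm, a]; push_cast; rw [Finset.mul_sum]
    refine Finset.sum_congr rfl fun X _ => ?_
    rw [mul_left_comm]
    rw [n, ← D.S1, Finset.mul_sum]
    refine Finset.sum_congr rfl fun Y _ => ?_
    rw [D.S_symm X Y, n]; ring
  simp only [D.sum_cen hB, mul_ite, mul_zero] at h
  rw [← Finset.sum_filter, Finset.filter_mem_eq_inter, Finset.univ_inter] at h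
  have : (C.dim univ : ℂ) * D.a B = Z.dim B * D.a (D.cen B) := by
    rw [← h, a]; push_cast; rw [Finset.mul_sum]
    exact Finset.sum_congr rfl fun i _ => by ring
  exact_mod_cast this
lemma univ_fus : Z.IsFus (univ : Finset J) :=
  ⟨mem_univ _, fun _ _ => mem_univ _, fun _ _ _ _ _ _ => mem_univ _⟩
lemma im_of_supp {B : Finset J} (hB : Z.IsFus B) (h : ∀ Y, D.n Y ≠ 0 → Y ∈ B) : D.im B = univ := by
  rcases D.C1 _ (D.im_fus hB) with h1 | h1
  · exfalso
    have h2 : ∀ V k, k ≠ C.o → C.N (C.st V) V k = 0 := by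
      intro V k hk
      have h3 : ∑ Y, D.F Y C.o * D.F Y k = 0 := by
        refine Finset.sum_eq_zero fun Y _ => ?_
        by_contra hc
        have : k ∈ D.im B := D.mem_im.2 ⟨Y, h Y (left_ne_zero_of_mul hc), right_ne_zero_of_mul hc⟩
        rw [h1, mem_singleton] at this
        exact hk this
      rw [D.S2, Finset.sum_eq_zero_iff] at h3
      exact h3 V (mem_univ _)
    have h4 : ∀ V, V = C.o := by
      intro V
      apply D.C2
      have := C.d_mul (C.st V) V
      rw [Finset.sum_eq_single C.o (fun k _ hk => by rw [h2 V k hk, zero_mul]) (by simp), C.d_o] at this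
      have h5 := C.N_st_o (C.st V)
      rw [C.st_st] at h5
      rw [h5, C.d_st] at this
      exact Nat.eq_one_of_mul_eq_one_left this
    have h5 : (univ : Finset I) = {C.o} := by ext V; simp [h4 V]
    have := D.one_lt
    rw [FR.dim, h5] at this
    simp [C.d_o] at this
  · exact h1
lemma o_S (X : J) : D.S X Z.o = Z.d X := by rw [D.S_symm, D.S_o]
lemma a_univ : D.a univ = C.dim univ := by
  have := D.S1 Z.o
  simp only [o_S] at this
  have h2 : D.F Z.o C.o = 1 := D.n_o
  rw [h2] at this
  have h3 : (D.a univ : ℂ) = C.dim univ := by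
    rw [Nat.cast_one, _root_.mul_one] at this
    rw [← this, a]; push_cast
    exact Finset.sum_congr rfl fun i _ => by rw [n]; ring
  exact_mod_cast h3
include D in
lemma dim_univ : Z.dim univ = C.dim univ * C.dim univ := by
  rw [D.dim_of_im univ_fus (D.im_of_supp univ_fus fun _ _ => mem_univ _), a_univ]
include D in
lemma dim_pos : 0 < C.dim univ := lt_trans Nat.zero_lt_one D.one_lt
lemma eq_o_of_dim {B : Finset J} (hB : Z.IsFus B) (h : Z.dim B ≤ 1) : B = {Z.o} := by
  ext Y
  simp only [mem_singleton]
  constructor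
  · intro hY
    by_contra hne
    have hle : Z.d Z.o ^ 2 + Z.d Y ^ 2 ≤ Z.dim B := by
      rw [← Finset.sum_pair (f := fun i => Z.d i ^ 2) (Ne.symm hne), FR.dim]
      apply Finset.sum_le_sum_of_subset
      intro x hx
      simp only [mem_insert, mem_singleton] at hx
      rcases hx with rfl | rfl
      · exact hB.o_mem
      · exact hY
    have h1 := Z.d_o
    have h2 := Z.d_pos Y
    have : 0 < Z.d Y ^ 2 := by positivity
    rw [h1] at hle
    omega
  · rintro rfl; exact hB.o_mem
lemma cen_univ : D.cen univ = {Z.o} := by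
  have h1 := D.a_cen (univ_fus)
  rw [D.a_univ, D.dim_univ] at h1
  have h2 : D.a (D.cen univ) = 1 := by
    have := D.dim_pos
    have h3 : 0 < C.dim univ * C.dim univ := Nat.mul_pos this this
    exact (Nat.eq_of_mul_eq_mul_left h3 (by rw [← h1, _root_.mul_one]))
  have h3 : ∀ Y ∈ D.cen univ, D.n Y = Z.d Y := by
    intro Y hY
    have h4 := D.S1 Y
    have h5 : (C.dim univ : ℂ) * Z.d Y = C.dim univ * D.n Y := by
      rw [← D.a_univ, a, n]
      rw [← D.a_univ, a] at h4
      rw [← h4]; push_cast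
      rw [Finset.sum_mul]
      exact Finset.sum_congr rfl fun X _ => by rw [D.S_eq X Y univ hY (mem_univ _), n]; ring
    have h6 : C.dim univ * Z.d Y = C.dim univ * D.n Y := by exact_mod_cast h5
    exact (Nat.eq_of_mul_eq_mul_left D.dim_pos h6).symm
  apply eq_o_of_dim (D.cen_fus _)
  rw [← h2, FR.dim, a]
  exact le_of_eq (Finset.sum_congr rfl fun Y hY => by rw [h3 Y hY, sq])
lemma dim_cen {B : Finset J} (hB : Z.IsFus B) :
    Z.dim B * Z.dim (D.cen B) = C.dim univ * C.dim univ := by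
  have h : ∑ Y, (Z.d Y : ℂ) * ∑ X ∈ B, (Z.d X : ℂ) * D.S X Y = C.dim univ * C.dim univ := by
    simp only [Finset.mul_sum]
    rw [Finset.sum_comm]
    have : ∀ X, ∑ Y, (Z.d Y : ℂ) * ((Z.d X : ℂ) * D.S X Y) =
        Z.d X * if X ∈ D.cen univ then (Z.dim univ : ℂ) * Z.d X else 0 := by
      intro X
      rw [← D.sum_cen univ_fus, Finset.mul_sum]
      exact Finset.sum_congr rfl fun Y _ => by rw [D.S_symm X Y]; ring
    rw [Finset.sum_congr rfl fun X _ => this X]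
    rw [Finset.sum_eq_single_of_mem Z.o hB.o_mem]
    · rw [cen_univ]; simp [Z.d_o, D.dim_univ]
    · intro X _ hX
      rw [cen_univ]; simp [hX]
  simp only [D.sum_cen hB, mul_ite, mul_zero] at h
  rw [← Finset.sum_filter, Finset.filter_mem_eq_inter, Finset.univ_inter] at h
  have : (Z.dim B : ℂ) * Z.dim (D.cen B) = C.dim univ * C.dim univ := by
    rw [← h]; rw [FR.dim, FR.dim]; push_cast; rw [Finset.mul_sum]
    exact Finset.sum_congr rfl fun i _ => by ring
  exact_mod_cast this
lemma triv_of_im {B : Finset J} (hB : Z.IsFus B) (him : D.im B = {C.o}) : B = {Z.o} := by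
  have hn : ∀ Y ∈ B, D.n Y = Z.d Y := by
    intro Y hY
    rw [← D.F_d, Finset.sum_eq_single C.o, C.d_o, _root_.mul_one, n]
    · intro i _ hi
      have : D.F Y i = 0 := by
        by_contra hc
        have : i ∈ D.im B := D.mem_im.2 ⟨Y, hY, hc⟩
        rw [him, mem_singleton] at this
        exact hi this
      rw [this, zero_mul]
    · simp
  have hs : ∀ X, D.n X ≠ 0 → X ∈ D.cen B := by
    intro X hX
    rw [D.mem_cen]
    intro Y hY
    rw [D.lam_symm]
    have h1 := D.S1 Y
    have h2 : ∑ X, (D.n X : ℝ) * (D.lam Y X).re = ∑ X, (D.n X : ℝ) * Z.d X := by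
      have h3 : ∑ X, (D.n X : ℂ) * D.lam Y X = ∑ X, (D.n X : ℂ) * Z.d X := by
        apply mul_right_cancel₀ (dC0 (C := Z) Y)
        calc _ = ∑ X, (D.F X C.o : ℂ) * D.S X Y := by
              rw [Finset.sum_mul]
              exact Finset.sum_congr rfl fun X _ => by rw [S_lam, n]; ring
          _ = C.dim univ * D.n Y := h1
          _ = _ := by
              rw [hn Y hY, ← D.a_univ, a]; push_cast
              congr 1
              exact Finset.sum_congr rfl fun X _ => by ring
      have h4 := congrArg Complex.re h3
      simpa [Complex.re_sum] using h4
    have hre : ∀ X, (D.lam Y X).re ≤ Z.d X := fun k => (Complex.re_le_norm _).trans ((D.lam_char Y).bound k)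
    have h5 := (Finset.sum_eq_sum_iff_of_le (fun k _ => 
      mul_le_mul_of_nonneg_left (hre k) (by positivity : (0:ℝ) ≤ D.n k))).1 h2 X (mem_univ _)
    have h6 : (D.lam Y X).re = Z.d X := mul_left_cancel₀ (by exact_mod_cast hX) h5
    exact Z.eq_of_re ((D.lam_char Y).bound X) h6
  have h1 := D.im_of_supp (D.cen_fus B) hs
  have h2 := D.dim_of_im (D.cen_fus B) h1
  have h3 : D.a (D.cen B) = C.dim univ := by
    rw [← D.a_univ, a, a]
    apply Finset.sum_subset (subset_univ _)
    intro Y _ hY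
    have : D.n Y = 0 := by by_contra hc; exact hY (hs Y hc)
    rw [this, mul_zero]
  have h4 := D.dim_cen hB
  rw [h2, h3] at h4
  have := D.dim_pos
  have h5 : 0 < C.dim univ * C.dim univ := Nat.mul_pos this this
  have h6 : Z.dim B = 1 := Nat.eq_of_mul_eq_mul_right h5 (by rw [h4, _root_.one_mul])
  exact eq_o_of_dim hB h6.le
include D in
lemma d_one (Y : J) (hY : Z.d Y = 1) : Y = Z.o := by
  set B0 : Finset J := univ.filter fun Y => ∀ i, D.F Y i ≠ 0 → i = C.o with hB0
  have hm : ∀ Y, Y ∈ B0 ↔ ∀ i, D.F Y i ≠ 0 → i = C.o := by intro Y; simp [hB0]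
  have hf : Z.IsFus B0 := by
    refine ⟨?_, ?_, ?_⟩
    · rw [hm]; intro i; simp [D.F_o]
    · intro Y hY; rw [hm] at hY ⊢
      intro i hi
      rw [D.F_st] at hi
      have := hY _ hi
      rw [← C.st_st i, this, C.st_o]
    · intro X hX Y hY W hW
      rw [hm] at hX hY ⊢
      intro k hk
      have h1 : ∑ W, Z.N X Y W * D.F W k ≠ 0 := by
        rw [Ne, Finset.sum_eq_zero_iff]
        intro h; exact mul_ne_zero hW hk (h W (mem_univ _))
      rw [D.F_mul] at h1
      obtain ⟨i, -, h2⟩ := Finset.exists_ne_zero_of_sum_ne_zero h1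
      obtain ⟨j, -, h3⟩ := Finset.exists_ne_zero_of_sum_ne_zero h2
      have h4 := hX i (left_ne_zero_of_mul (left_ne_zero_of_mul h3))
      have h5 := hY j (right_ne_zero_of_mul (left_ne_zero_of_mul h3))
      have h6 := right_ne_zero_of_mul h3
      rw [h4, h5, C.one_mul] at h6
      by_contra hc
      rw [if_neg (Ne.symm hc)] at h6
      exact h6 rfl
  have him : D.im B0 = {C.o} := by
    ext i
    rw [mem_singleton, mem_im]
    constructor
    · rintro ⟨Y, hY, h⟩; exact (hm Y).1 hY i h
    · rintro rfl; exact ⟨Z.o, hf.o_mem, by simp [D.F_o]⟩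
  have h0 := D.triv_of_im hf him
  have : Y ∈ B0 := by
    rw [hm]
    intro i hi
    apply D.C2
    have h1 := D.F_d Y
    rw [hY] at h1
    have h2 : D.F Y i * C.d i ≤ 1 := by
      rw [← h1]; exact Finset.single_le_sum (f := fun i => D.F Y i * C.d i) (fun _ _ => Nat.zero_le _) (mem_univ i)
    have h3 := C.d_pos i
    have h4 := Nat.pos_of_ne_zero hi
    nlinarith
  rwa [h0, mem_singleton] at this
lemma rat_int {a b : ℕ} (hb : b ≠ 0) (h : IsIntegral ℤ ((a : ℂ) / b)) : b ∣ a := by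
  have h1 : IsIntegral ℤ ((a : ℚ) / b) := by
    have := (isIntegral_algHom_iff ((algebraMap ℚ ℂ).toIntAlgHom) (algebraMap ℚ ℂ).injective (x := (a : ℚ) / b)).1
    exact this (by simpa using h)
  obtain ⟨z, hz⟩ := IsIntegrallyClosed.isIntegral_iff.1 h1
  have hb' : (b : ℚ) ≠ 0 := by exact_mod_cast hb
  rw [eq_div_iff hb'] at hz
  have h2 : z * b = a := by
    have : ((z * b : ℤ) : ℚ) = ((a : ℤ) : ℚ) := by push_cast; simpa using hz
    exact_mod_cast this
  exact Int.natCast_dvd_natCast.1 ⟨z, by rw [← h2, mul_comm]⟩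
include D in
lemma d_dvd (Y : J) : Z.d Y ∣ C.dim univ := by
  have h : ∑ X, D.S X Y * D.S X (Z.st Y) = Z.dim univ := by
    calc _ = ∑ X, ∑ W, (Z.N Y (Z.st Y) W : ℂ) * ((Z.d X : ℂ) * D.S X W) := by
          refine Finset.sum_congr rfl fun X _ => ?_
          rw [D.S_symm X Y, D.S_symm X, D.S_mul, Finset.mul_sum]
          exact Finset.sum_congr rfl fun W _ => by rw [D.S_symm W X]; ring
      _ = ∑ W, (Z.N Y (Z.st Y) W : ℂ) * if W ∈ D.cen univ then (Z.dim univ : ℂ) * Z.d W else 0 := by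
          rw [Finset.sum_comm]
          refine Finset.sum_congr rfl fun W _ => ?_
          rw [← D.sum_cen univ_fus, Finset.mul_sum]
      _ = _ := by
          rw [Finset.sum_eq_single Z.o]
          · rw [cen_univ]; simp [Z.N_st_o, Z.d_o]
          · intro W _ hW; rw [cen_univ]; simp [hW]
          · simp
  have h2 : IsIntegral ℤ ((C.dim univ * C.dim univ : ℕ) / (Z.d Y * Z.d Y : ℕ) : ℂ) := by
    rw [← D.dim_univ, ← h, Finset.sum_div]
    refine IsIntegral.sum _ fun X _ => ?_
    have : D.S X Y * D.S X (Z.st Y) / ((Z.d Y * Z.d Y : ℕ) : ℂ) = D.lam Y X * D.lam (Z.st Y) X := by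
      rw [lam, lam, Z.d_st]; push_cast; rw [div_mul_div_comm]
    rw [this]
    exact ((D.lam_char _).isIntegral _).mul ((D.lam_char _).isIntegral _)
  have h3 := rat_int (mul_ne_zero (Z.d_pos Y).ne' (Z.d_pos Y).ne') h2
  rw [← sq, ← sq] at h3
  exact (Nat.pow_dvd_pow_iff two_ne_zero).1 h3
lemma norm_of_coprime (X Y : J) (hc : Nat.Coprime (Z.d X) (Z.d Y)) (h : D.lam Y X ≠ 0) :
    ‖D.lam Y X‖ = Z.d X := by
  apply (D.lam_char Y).norm_eq _ _ h
  have hx := dC0 (C := Z) X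
  have hy := dC0 (C := Z) Y
  have hb : (Z.d X : ℂ) * (Nat.gcdA (Z.d X) (Z.d Y)) + Z.d Y * (Nat.gcdB (Z.d X) (Z.d Y)) = 1 := by
    have := Nat.gcd_eq_gcd_ab (Z.d X) (Z.d Y)
    rw [hc] at this
    have h2 := congrArg (Int.cast : ℤ → ℂ) this
    push_cast at h2
    exact h2.symm
  have e : D.lam Y X / Z.d X = (Nat.gcdA (Z.d X) (Z.d Y)) * D.lam Y X + (Nat.gcdB (Z.d X) (Z.d Y)) * D.lam X Y := by
    have h1 : D.S X Y = D.lam Y X * Z.d Y := D.S_lam X Y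
    have h2 : D.S X Y = D.lam X Y * Z.d X := by rw [D.S_symm]; exact D.S_lam Y X
    rw [div_eq_iff hx]
    have h3 : D.lam X Y * Z.d X = D.lam Y X * Z.d Y := by rw [← h1, ← h2]
    calc D.lam Y X = D.lam Y X * 1 := (_root_.mul_one _).symm
      _ = _ := by rw [← hb]; linear_combination (-(Nat.gcdB (Z.d X) (Z.d Y) : ℂ)) * h3
  rw [e]
  exact (((isIntegral_algebraMap (R := ℤ) (A := ℂ) (x := _))).mul ((D.lam_char Y).isIntegral X)).add
   (((isIntegral_algebraMap (R := ℤ) (A := ℂ) (x := _))).mul ((D.lam_char X).isIntegral Y))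
lemma step6 {B : Finset J} (hB : Z.IsFus B)
    (hmin : ∀ T, Z.IsFus T → T ⊆ B → T ≠ {Z.o} → T = B) (Y : J) (l b : ℕ) (hl : l.Prime)
    (hd : Z.d Y = l ^ b) : Y ∈ D.cen B := by
  by_contra hY
  have h0 : ∑ X ∈ B, (Z.d X : ℂ) * D.lam Y X = 0 := by
    rw [D.mem_cen] at hY
    push Not at hY
    obtain ⟨X, hX, h⟩ := hY
    exact (D.lam_char Y).sum_zero hB hX h
  have h1 : ∃ X ∈ B, X ≠ Z.o ∧ ¬ l ∣ Z.d X ∧ D.lam Y X ≠ 0 := by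
    by_contra hc
    push Not at hc
    rw [← Finset.add_sum_erase B _ hB.o_mem, Z.d_o, (D.lam_char Y).one] at h0
    have h2 : IsIntegral ℤ (∑ X ∈ B.erase Z.o, (Z.d X : ℂ) * D.lam Y X / l) := by
      refine IsIntegral.sum _ fun X hX => ?_
      rw [mem_erase] at hX
      by_cases hlX : l ∣ Z.d X
      · obtain ⟨m, hm⟩ := hlX
        have hl0 : (l : ℂ) ≠ 0 := by exact_mod_cast hl.ne_zero
        have : (Z.d X : ℂ) * D.lam Y X / l = ((m : ℤ) : ℂ) * D.lam Y X := by
          rw [hm]; push_cast; field_simp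
        rw [this]
        exact ((isIntegral_algebraMap (R := ℤ) (A := ℂ) (x := _))).mul ((D.lam_char Y).isIntegral X)
      · rw [hc X hX.2 hX.1 hlX]; simpa using isIntegral_zero
    have h3 : ∑ X ∈ B.erase Z.o, (Z.d X : ℂ) * D.lam Y X / l = - (((1:ℕ) : ℂ) / l) := by
      rw [← Finset.sum_div]
      rw [eq_neg_of_add_eq_zero_right h0]
      push_cast; ring
    rw [h3] at h2
    have h4 := rat_int (a := 1) hl.ne_zero (by simpa using h2.neg)
    exact hl.one_lt.ne' (Nat.dvd_one.1 h4)
  obtain ⟨X, hXB, hXo, hlX, hne⟩ := h1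
  have hcop : Nat.Coprime (Z.d X) (Z.d Y) := by
    rw [hd]; exact Nat.Coprime.pow_right _ ((Nat.Prime.coprime_iff_not_dvd hl).2 hlX).symm
  have hnorm := D.norm_of_coprime X Y hcop hne
  have hall : ∀ W, Z.N X (Z.st X) W ≠ 0 → D.lam Y W = Z.d W := by
    apply (D.lam_char Y).eq_case
    rw [(D.lam_char Y).star, Complex.mul_conj, Complex.normSq_eq_norm_sq, hnorm, Z.d_st]
    push_cast; ring
  have hT := (D.lam_char Y).isFus hB
  have hTB := hmin _ hT (filter_subset _ _) (by
    intro hT0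
    have h5 : ∀ W, W ≠ Z.o → Z.N X (Z.st X) W = 0 := by
      intro W hW
      by_contra hc
      have : W ∈ B.filter (fun i => D.lam Y i = Z.d i) := by
        rw [mem_filter]
        exact ⟨hB.mul_mem _ hXB _ (hB.st_mem _ hXB) _ hc, hall W hc⟩
      rw [hT0, mem_singleton] at this
      exact hW this
    have h6 := Z.d_mul X (Z.st X)
    rw [Finset.sum_eq_single Z.o (fun W _ hW => by rw [h5 W hW, zero_mul]) (by simp), Z.N_st_o, Z.d_o] at h6
    exact hXo (D.d_one X (Nat.eq_one_of_mul_eq_one_right h6)))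
  apply hY
  rw [D.mem_cen]
  intro W hW
  rw [← hTB, mem_filter] at hW
  exact hW.2
include D in
theorem contra (p q r s : ℕ) (hp : p.Prime) (hq : q.Prime) (hdim : C.dim univ = p ^ r * q ^ s)
    (hpd : p ∣ C.dim univ) : False := by
  have key : ∀ Y, Y ≠ Z.o → ¬ p ∣ Z.d Y → ∃ b, Z.d Y = q ^ b := by
    intro Y _ hpY
    have h1 := D.d_dvd Y
    rw [hdim] at h1
    have h2 : Nat.Coprime (Z.d Y) (p ^ r) := Nat.Coprime.pow_right _ ((Nat.Prime.coprime_iff_not_dvd hp).2 hpY).symm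
    have h3 := h2.dvd_of_dvd_mul_left h1
    obtain ⟨b, _, hb⟩ := (Nat.dvd_prime_pow hq).1 h3
    exact ⟨b, hb⟩
  have hmod : ∀ B : Finset J, (∀ Y, Y ∉ B → p ∣ Z.d Y) → p ∣ D.a B := by
    intro B hB
    have h1 : D.a univ = D.a B + ∑ Y ∈ univ \ B, Z.d Y * D.n Y := by
      rw [a, a, add_comm, Finset.sum_sdiff (subset_univ B)]
    rw [D.a_univ] at h1
    have h2 : p ∣ ∑ Y ∈ univ \ B, Z.d Y * D.n Y := Finset.dvd_sum fun Y hY => by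
      rw [mem_sdiff] at hY
      exact Dvd.dvd.mul_right (hB Y hY.2) _
    exact (Nat.dvd_add_left h2).1 (h1 ▸ hpd)
  obtain ⟨Y0, hY0, hpY0⟩ : ∃ Y, Y ≠ Z.o ∧ ¬ p ∣ Z.d Y := by
    by_contra hc
    push Not at hc
    have := hmod {Z.o} (fun Y hY => hc Y (by simpa using hY))
    rw [a, sum_singleton, Z.d_o, D.n_o] at this
    exact hp.one_lt.ne' (Nat.dvd_one.1 this)
  let G : Finset J := univ.filter fun W => ∀ T, Z.IsFus T → (∀ Y, Y ≠ Z.o → ¬ p ∣ Z.d Y → Y ∈ T) → W ∈ T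
  have hGm : ∀ W, W ∈ G ↔ ∀ T, Z.IsFus T → (∀ Y, Y ≠ Z.o → ¬ p ∣ Z.d Y → Y ∈ T) → W ∈ T := by
    intro W; simp [G]
  have hG : Z.IsFus G := by
    refine ⟨?_, ?_, ?_⟩
    · rw [hGm]; intro T hT _; exact hT.o_mem
    · intro i hi; rw [hGm] at hi ⊢; intro T hT h; exact hT.st_mem _ (hi T hT h)
    · intro i hi j hj k hk; rw [hGm] at hi hj ⊢
      intro T hT h; exact hT.mul_mem _ (hi T hT h) _ (hj T hT h) _ hk
  have hGP : ∀ Y, Y ≠ Z.o → ¬ p ∣ Z.d Y → Y ∈ G := by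
    intro Y h1 h2; rw [hGm]; intro T _ h; exact h Y h1 h2
  have hGne : G ≠ {Z.o} := by
    intro h
    have := hGP Y0 hY0 hpY0
    rw [h, mem_singleton] at this
    exact hY0 this
  obtain ⟨B, hBmem, hBmin⟩ := Finset.exists_min_image
    (univ.filter fun T : Finset J => Z.IsFus T ∧ T ⊆ G ∧ T ≠ {Z.o}) Finset.card
    ⟨G, by simp [hG, hGne]⟩
  simp only [mem_filter, mem_univ, true_and] at hBmem hBmin
  obtain ⟨hB, hBG, hBne⟩ := hBmem
  have hmin : ∀ T, Z.IsFus T → T ⊆ B → T ≠ {Z.o} → T = B := by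
    intro T hT hTB hT0
    exact Finset.eq_of_subset_of_card_le hTB (hBmin T ⟨hT, hTB.trans hBG, hT0⟩)
  have hP : ∀ Y, Y ≠ Z.o → ¬ p ∣ Z.d Y → Y ∈ D.cen B := by
    intro Y h1 h2
    obtain ⟨b, hb⟩ := key Y h1 h2
    exact D.step6 hB hmin Y q b hq hb
  have hGc : G ⊆ D.cen B := fun W hW => (hGm W).1 hW _ (D.cen_fus B) hP
  have hBc : B ⊆ D.cen B := hBG.trans hGc
  have him : D.im B = univ := by
    rcases D.C1 _ (D.im_fus hB) with h | h
    · exact absurd (D.triv_of_im hB h) hBne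
    · exact h
  have e1 := D.dim_of_im hB him
  have e2 := D.dim_cen hB
  have e3 := D.a_cen hB
  have hle : Z.dim B ≤ Z.dim (D.cen B) := Finset.sum_le_sum_of_subset hBc
  have hpos := D.dim_pos
  have ha : D.a (D.cen B) = 1 := by
    rw [e1] at e3
    have : C.dim univ * D.a B * 1 = C.dim univ * D.a B * D.a (D.cen B) := by
      linarith [e3]
    have hapos : 0 < D.a B := by
      apply Nat.pos_of_ne_zero
      intro h
      have : Z.d Z.o * D.n Z.o ≤ D.a B :=
        Finset.single_le_sum (f := fun Y => Z.d Y * D.n Y) (fun _ _ => Nat.zero_le _) hB.o_mem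
      rw [Z.d_o, D.n_o, h] at this
      omega
    exact (Nat.eq_of_mul_eq_mul_left (Nat.mul_pos hpos hapos) this).symm
  have := hmod (D.cen B) (fun Y hY => by
    by_contra hc
    by_cases hYo : Y = Z.o
    · exact hY (hYo ▸ (D.cen_fus B).o_mem)
    · exact hY (hP Y hYo hc))
  rw [ha] at this
  exact hp.one_lt.ne' (Nat.dvd_one.1 this)
include D in
theorem contra' (p q r s : ℕ) (hp : p.Prime) (hq : q.Prime) (hdim : C.dim univ = p ^ r * q ^ s) : False := by
  have h1 := D.one_lt
  by_cases hr : r = 0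
  · have hs : s ≠ 0 := by
      rintro rfl
      rw [hdim, hr] at h1; simp at h1
    exact D.contra q p s r hq hp (by rw [hdim, mul_comm]) (by rw [hdim]; exact Dvd.dvd.mul_left (dvd_pow_self q hs) _)
  · exact D.contra p q r s hp hq hdim (by rw [hdim]; exact Dvd.dvd.mul_right (dvd_pow_self p hr) _)
end ZDat
end
section
open Coalgebra TensorProduct WithConv HopfAlgebra
namespace HopfLR
section basics
variable {H : Type*} [Ring H] [HopfAlgebra ℂ H]
variable {A : Type*} [Ring A] [Algebra ℂ A]
variable {A' : Type*} [Ring A'] [Algebra ℂ A']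
lemma tc_apply (f : H ⇾ A) (h : H) : (toConv f) h = f h := rfl
noncomputable def cst (a : A) : H ⇾ A := (counit (R := ℂ) (A := H)).smulRight a
lemma cst_apply (a : A) (h : H) : cst a h = counit (R := ℂ) h • a := rfl
lemma cst_mul (a : A) (F : H ⇾ A) (h : H) : (toConv (cst a) * toConv F : WithConv (H ⇾ A)) h = a * F h := by
  rw [(ℛ ℂ h).convMul_apply]
  simp only [cst_apply, tc_apply, smul_mul_assoc, ← mul_smul_comm, ← map_smul, ← Finset.mul_sum, ← map_sum]
  rw [sum_counit_smul]
lemma mul_cst (a : A) (F : H ⇾ A) (h : H) : (toConv F * toConv (cst a) : WithConv (H ⇾ A)) h = F h * a := by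
  rw [(ℛ ℂ h).convMul_apply]
  simp only [cst_apply, tc_apply, mul_smul_comm, ← smul_mul_assoc, ← map_smul, ← Finset.sum_mul, ← map_sum]
  have := sum_tmul_counit_eq (R := ℂ) (ℛ ℂ h)
  have h2 := congrArg (TensorProduct.rid ℂ H) this
  simp only [map_sum, TensorProduct.rid_tmul, one_smul] at h2
  rw [h2]
lemma comp_mul (φ : A ⇝ A') (f g : H ⇾ A) :
    toConv (φ.toLinearMap ∘ₗ (toConv f * toConv g).ofConv) =
      toConv (φ.toLinearMap ∘ₗ f) * toConv (φ.toLinearMap ∘ₗ g) := by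
  have := LinearMap.algHom_comp_convMul_distrib φ (toConv f) (toConv g)
  exact congrArg toConv this
lemma comp_one (φ : A ⇝ A') :
    toConv (φ.toLinearMap ∘ₗ (1 : WithConv (H ⇾ A)).ofConv) = 1 := by
  ext h; simp
abbrev i1 : H ⇝ H ⊠ H := Algebra.TensorProduct.includeLeft
abbrev i2 : H ⇝ H ⊠ H := Algebra.TensorProduct.includeRight
abbrev S : H ⇾ H := antipode ℂ
abbrev Δ : H ⇾ H ⊠ H := comul
lemma comul_conv : toConv (Δ (H := H)) = toConv i1.toLinearMap * toConv i2.toLinearMap := by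
  ext h
  rw [(ℛ ℂ h).convMul_apply]
  simp [(ℛ ℂ h).eq]
lemma alg_S (φ : H ⇝ A) : toConv φ.toLinearMap * toConv (φ.toLinearMap ∘ₗ S) = 1 := by
  have := comp_mul φ (LinearMap.id : H ⇾ H) S
  rw [LinearMap.id_mul_antipode, comp_one, LinearMap.comp_id] at this
  exact this.symm
lemma S_alg (φ : H ⇝ A) : toConv (φ.toLinearMap ∘ₗ S) * toConv φ.toLinearMap = 1 := by
  have := comp_mul φ S (LinearMap.id : H ⇾ H)
  rw [LinearMap.antipode_mul_id, comp_one, LinearMap.comp_id] at this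
  exact this.symm
lemma comul_S_conv : toConv (Δ (H := H) ∘ₗ S) =
    toConv (i2.toLinearMap ∘ₗ S) * toConv (i1.toLinearMap ∘ₗ S) := by
  refine (left_inv_eq_right_inv (a := toConv (Δ (H := H))) ?_ ?_).symm
  · rw [comul_conv, mul_assoc, ← mul_assoc (toConv (i1.toLinearMap ∘ₗ S)), S_alg, one_mul, S_alg]
  · exact LinearMap.comul_right_inv
lemma comul_S : Δ (H := H) ∘ₗ S = TensorProduct.map S S ∘ₗ (TensorProduct.comm ℂ H H).toLinearMap ∘ₗ Δ := by
  apply toConv_injective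
  rw [comul_S_conv]
  ext h
  rw [(ℛ ℂ h).convMul_apply]
  simp only [tc_apply, LinearMap.comp_apply]
  rw [← (ℛ ℂ h).eq]
  simp
lemma comul_S2 : Δ (H := H) ∘ₗ S ∘ₗ S = TensorProduct.map (S ∘ₗ S) (S ∘ₗ S) ∘ₗ Δ := by
  rw [← LinearMap.comp_assoc, comul_S, LinearMap.comp_assoc, LinearMap.comp_assoc, comul_S]
  ext h
  simp only [LinearMap.comp_apply]
  induction (Δ h) using TI with
  | zero => simp
  | tmul a b => simp
  | add a b ha hb => simp only [map_add, ha, hb]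
lemma S_mul (a b : H) : S (a * b) = S b * S a := antipode_mul_antidistrib a b
@[simp] lemma S_one : S (1 : H) = 1 := antipode_one
@[simp] lemma eps_S (h : H) : counit (R := ℂ) (S h) = counit (R := ℂ) h := counit_antipode h
lemma S2_mul (a b : H) : S (S (a * b)) = S (S a) * S (S b) := by rw [S_mul, S_mul]
noncomputable def eta (f : H ⇾ ℂ) : H ⇾ A := Algebra.linearMap ℂ A ∘ₗ f
lemma eta_apply (f : H ⇾ ℂ) (h : H) : (eta f : H ⇾ A) h = f h • 1 := by
  simp [eta, Algebra.algebraMap_eq_smul_one]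
lemma eta_mul (f g : H ⇾ ℂ) : toConv (eta f : H ⇾ A) * toConv (eta g) =
    toConv (eta (toConv f * toConv g).ofConv) :=
  (comp_mul (Algebra.ofId ℂ A) f g).symm
noncomputable def cR (f : H ⇾ ℂ) : H ⊠ H ⇾ H :=
  (TensorProduct.rid ℂ H).toLinearMap ∘ₗ LinearMap.lTensor H f
noncomputable def cL (f : H ⇾ ℂ) : H ⊠ H ⇾ H :=
  (TensorProduct.lid ℂ H).toLinearMap ∘ₗ LinearMap.rTensor H f
@[simp] lemma cR_tmul (f : H ⇾ ℂ) (a b : H) : cR f (a ⊗ₜ b) = f b • a := by simp [cR]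
@[simp] lemma cL_tmul (f : H ⇾ ℂ) (a b : H) : cL f (a ⊗ₜ b) = f a • b := by simp [cL]
lemma cR_mul1 (f : H ⇾ ℂ) (T : H ⊠ H) (k : H) : cR f (T * (k ⊗ₜ 1)) = cR f T * k := by
  induction T using TI with
  | zero => simp
  | tmul a b => simp
  | add a b ha hb => simp only [map_add, ha, hb, add_mul]
lemma cR_1mul (f : H ⇾ ℂ) (T : H ⊠ H) (k : H) : cR f ((k ⊗ₜ 1) * T) = k * cR f T := by
  induction T using TI with
  | zero => simp
  | tmul a b => simp
  | add a b ha hb => simp only [map_add, ha, hb, mul_add]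
lemma cL_mul2 (f : H ⇾ ℂ) (T : H ⊠ H) (k : H) : cL f (T * (1 ⊗ₜ k)) = cL f T * k := by
  induction T using TI with
  | zero => simp
  | tmul a b => simp
  | add a b ha hb => simp only [map_add, ha, hb, add_mul]
lemma cL_2mul (f : H ⇾ ℂ) (T : H ⊠ H) (k : H) : cL f ((1 ⊗ₜ k) * T) = k * cL f T := by
  induction T using TI with
  | zero => simp
  | tmul a b => simp
  | add a b ha hb => simp only [map_add, ha, hb, mul_add]
lemma cR_conv (f : H ⇾ ℂ) : toConv (cR f ∘ₗ Δ) = toConv (LinearMap.id : H ⇾ H) * toConv (eta f) := by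
  ext h
  rw [(ℛ ℂ h).convMul_apply]
  simp only [tc_apply, LinearMap.comp_apply]
  rw [← (ℛ ℂ h).eq]
  simp [eta_apply]
lemma cL_conv (f : H ⇾ ℂ) : toConv (cL f ∘ₗ Δ) = toConv (eta f) * toConv (LinearMap.id : H ⇾ H) := by
  ext h
  rw [(ℛ ℂ h).convMul_apply]
  simp only [tc_apply, LinearMap.comp_apply]
  rw [← (ℛ ℂ h).eq]
  simp [eta_apply]
lemma conv_cR (f g : H ⇾ ℂ) (h : H) : (toConv f * toConv g) h = f (cR g (Δ h)) := by
  rw [(ℛ ℂ h).convMul_apply, ← (ℛ ℂ h).eq]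
  simp [mul_comm]
lemma conv_cL (f g : H ⇾ ℂ) (h : H) : (toConv f * toConv g) h = g (cL f (Δ h)) := by
  rw [(ℛ ℂ h).convMul_apply, ← (ℛ ℂ h).eq]
  simp
lemma ext_rank1 {V : Type*} [AddCommGroup V] [Module ℂ V] [FiniteDimensional ℂ V]
    {W : Type*} [AddCommGroup W] [Module ℂ W]
    (G₁ G₂ : (V ⇾ V) ⇾ W)
    (h : ∀ (φ : V ⇾ ℂ) (u : V), G₁ (φ.smulRight u) = G₂ (φ.smulRight u)) : G₁ = G₂ := by
  ext P
  let b := Module.finBasis ℂ V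
  have : P = ∑ a, (b.coord a).smulRight (P (b a)) := by
    apply b.ext
    intro j
    simp only [LinearMap.sum_apply, LinearMap.smulRight_apply, Module.Basis.coord_apply, Module.Basis.repr_self]
    rw [Finset.sum_eq_single j] <;> simp +contextual [Finsupp.single_apply, eq_comm]
  rw [this, map_sum, map_sum]
  exact Finset.sum_congr rfl fun a _ => h _ _
lemma dual_ext {V : Type*} [AddCommGroup V] [Module ℂ V] {x y : V}
    (h : ∀ f : V ⇾ ℂ, f x = f y) : x = y := by
  rw [← sub_eq_zero, ← Module.forall_dual_apply_eq_zero_iff ℂ]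
  intro f
  rw [map_sub, sub_eq_zero]
  exact h f
open MulOpposite
noncomputable def TP (P : H ⇾ H) : H ⇾ H ⊠ H :=
  (opLinearEquiv ℂ).symm.toLinearMap ∘ₗ
    (toConv ((opLinearEquiv ℂ).toLinearMap ∘ₗ i1.toLinearMap ∘ₗ S) *
     toConv ((opLinearEquiv ℂ).toLinearMap ∘ₗ Δ ∘ₗ P) : WithConv (H ⇾ (H ⊠ H)ᵐᵒᵖ)).ofConv
lemma TP_apply (P : H ⇾ H) (x : H) :
    TP P x = ∑ i ∈ (ℛ ℂ x).index, Δ (P ((ℛ ℂ x).right i)) * (S ((ℛ ℂ x).left i) ⊗ₜ 1) := by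
  simp only [TP, LinearMap.comp_apply, LinearEquiv.coe_coe]
  have := (ℛ ℂ x).convMul_apply (toConv ((opLinearEquiv ℂ).toLinearMap ∘ₗ i1.toLinearMap ∘ₗ S))
     (toConv ((opLinearEquiv ℂ).toLinearMap ∘ₗ Δ ∘ₗ P) : WithConv (H ⇾ (H ⊠ H)ᵐᵒᵖ))
  change (opLinearEquiv ℂ).symm ((_ : WithConv (H ⇾ (H ⊠ H)ᵐᵒᵖ)) x) = _
  rw [this]
  simp
variable [FiniteDimensional ℂ H]
lemma trace_TP (f : H ⇾ ℂ) (P : H ⇾ H) :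
    LinearMap.trace ℂ H (cL f ∘ₗ TP P) = f 1 * LinearMap.trace ℂ H P := by
  let G₁ : (H ⇾ H) ⇾ ℂ := LinearMap.trace ℂ H ∘ₗ IsLinearMap.mk' (fun P => cL f ∘ₗ TP P)
    ⟨fun P Q => by ext x; simp [TP_apply, add_mul, Finset.sum_add_distrib],
     fun c P => by ext x; simp [TP_apply, Finset.smul_sum]⟩
  have : G₁ = f 1 • LinearMap.trace ℂ H := by
    apply ext_rank1
    intro φ u
    have e : cL f ∘ₗ TP (φ.smulRight u) = ∑ i ∈ (ℛ ℂ u).index,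
        ((toConv (f ∘ₗ LinearMap.mulLeft ℂ ((ℛ ℂ u).left i) ∘ₗ S) * toConv φ : WithConv (H ⇾ ℂ)).ofConv).smulRight ((ℛ ℂ u).right i) := by
      ext x
      simp only [LinearMap.comp_apply, TP_apply, LinearMap.sum_apply, LinearMap.smulRight_apply]
      have : ∀ i, (toConv (f ∘ₗ LinearMap.mulLeft ℂ ((ℛ ℂ u).left i) ∘ₗ S) * toConv φ : WithConv (H ⇾ ℂ)).ofConv x =
        ∑ j ∈ (ℛ ℂ x).index, f ((ℛ ℂ u).left i * S ((ℛ ℂ x).left j)) * φ ((ℛ ℂ x).right j) := fun i =>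
          ((ℛ ℂ x).convMul_apply _ _)
      simp only [this, Finset.sum_smul]
      rw [Finset.sum_comm, map_sum]
      refine Finset.sum_congr rfl fun j _ => ?_
      rw [map_smul, ← (ℛ ℂ u).eq, Finset.smul_sum, Finset.sum_mul, map_sum]
      refine Finset.sum_congr rfl fun i _ => ?_
      simp [smul_smul, mul_comm]
    change LinearMap.trace ℂ H (cL f ∘ₗ TP (φ.smulRight u)) = f 1 • _
    rw [e, map_sum]
    simp only [LinearMap.trace_smulRight]
    have h1 : toConv (LinearMap.id : H ⇾ H) * (toConv S * toConv (eta φ)) = toConv (eta φ) := by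
      rw [← mul_assoc, LinearMap.id_mul_antipode, one_mul]
    have h2 := congrArg (fun F : WithConv (H ⇾ H) => f (F u)) h1
    simp only [tc_apply, eta_apply, map_smul] at h2
    rw [(ℛ ℂ u).convMul_apply, map_sum] at h2
    rw [smul_eq_mul, mul_comm, ← smul_eq_mul, ← h2]
    refine Finset.sum_congr rfl fun i _ => ?_
    simp only [tc_apply, LinearMap.id_apply]
    change (toConv (f ∘ₗ LinearMap.mulLeft ℂ ((ℛ ℂ u).left i) ∘ₗ S) * toConv φ : WithConv (H ⇾ ℂ)) _ = _
    rw [(ℛ ℂ ((ℛ ℂ u).right i)).convMul_apply, (ℛ ℂ ((ℛ ℂ u).right i)).convMul_apply, Finset.mul_sum, map_sum]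
    refine Finset.sum_congr rfl fun j _ => ?_
    simp [eta_apply, mul_comm]
  exact congrArg (fun G : (H ⇾ H) ⇾ ℂ => G P) this
end basics
end HopfLR
end
section
open TensorProduct
namespace Wedd
lemma trace_idem {V : Type*} [AddCommGroup V] [Module ℂ V] [FiniteDimensional ℂ V]
    (p : Module.End ℂ V) (hp : p * p = p) :
    LinearMap.trace ℂ V p = (Module.finrank ℂ (LinearMap.range p) : ℂ) :=
  (LinearMap.IsIdempotentElem.isProj_range p hp).trace
structure Wed (K : Type*) [Ring K] [Algebra ℂ K] where
  n : ℕ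
  d : Fin n → ℕ
  pos : ∀ i, 0 < d i
  e : K ≃ₐ[ℂ] Π i, Matrix (Fin (d i)) (Fin (d i)) ℂ
lemma exists_wed (K : Type*) [Ring K] [Algebra ℂ K] [FiniteDimensional ℂ K] [IsSemisimpleRing K] :
    Nonempty (Wed K) := by
  obtain ⟨n, d, h, ⟨e⟩⟩ := IsSemisimpleRing.exists_algEquiv_pi_matrix_of_isAlgClosed ℂ K
  exact ⟨⟨n, d, fun i => Nat.pos_of_ne_zero (h i).out, e⟩⟩
variable {K : Type*} [Ring K] [Algebra ℂ K]
def IsRC (f : K ⇾ ℂ) : Prop :=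
  ∃ (m : ℕ) (ρ : K ⇝ Module.End ℂ (Fin m → ℂ)), ∀ x, f x = LinearMap.trace ℂ _ (ρ x)
lemma IsRC.of {V : Type*} [AddCommGroup V] [Module ℂ V] [FiniteDimensional ℂ V]
    (f : K ⇾ ℂ) (ρ : K ⇝ Module.End ℂ V) (h : ∀ x, f x = LinearMap.trace ℂ _ (ρ x)) :
    IsRC f := by
  let b := (Module.finBasis ℂ V).equivFun
  refine ⟨_, (b.conjAlgEquiv ℂ).toAlgHom.comp ρ, fun x => ?_⟩
  rw [h]
  exact (LinearMap.trace_conj' (ρ x) b).symm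
lemma IsRC.comm {f : K ⇾ ℂ} (h : IsRC f) (x y : K) : f (x * y) = f (y * x) := by
  obtain ⟨m, ρ, h⟩ := h
  rw [h, h, map_mul ρ, map_mul ρ, LinearMap.trace_mul_comm]
lemma IsRC.nat {f : K ⇾ ℂ} (h : IsRC f) {x : K} (hx : x * x = x) : ∃ m : ℕ, f x = m := by
  obtain ⟨m, ρ, h⟩ := h
  rw [h]
  exact ⟨_, trace_idem _ (by rw [← map_mul, hx])⟩
lemma IsRC.comp {K' : Type*} [Ring K'] [Algebra ℂ K'] {f : K ⇾ ℂ} (h : IsRC f) (φ : K' ⇝ K) :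
    IsRC (f ∘ₗ φ.toLinearMap) := by
  obtain ⟨m, ρ, h⟩ := h
  exact ⟨m, ρ.comp φ, fun x => h _⟩
lemma IsRC.ofHom (φ : K ⇝ ℂ) : IsRC φ.toLinearMap := by
  refine IsRC.of (V := ℂ) _ ((Algebra.lmul ℂ ℂ).comp φ) fun x => ?_
  simp only [AlgHom.toLinearMap_apply, AlgHom.comp_apply]
  have : (Algebra.lmul ℂ ℂ) (φ x) = (φ x) • (LinearMap.id : ℂ ⇾ ℂ) := by ext; simp
  rw [this, map_smul, LinearMap.trace_id]; simp
noncomputable def tens {K' : Type*} [Ring K'] [Algebra ℂ K'] (f : K ⇾ ℂ) (g : K' ⇾ ℂ) : K ⊠ K' ⇾ ℂ :=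
  LinearMap.mul' ℂ ℂ ∘ₗ TensorProduct.map f g
@[simp] lemma tens_tmul {K' : Type*} [Ring K'] [Algebra ℂ K'] (f : K ⇾ ℂ) (g : K' ⇾ ℂ) (x : K) (y : K') : tens f g (x ⊗ₜ y) = f x * g y := by
  simp [tens]
lemma IsRC.tens {K' : Type*} [Ring K'] [Algebra ℂ K'] {f : K ⇾ ℂ} {g : K' ⇾ ℂ}
    (hf : IsRC f) (hg : IsRC g) : IsRC (tens f g) := by
  obtain ⟨m, ρ, h⟩ := hf
  obtain ⟨m', ρ', h'⟩ := hg
  refine IsRC.of _ ((Module.endTensorEndAlgHom (R := ℂ) (A := ℂ)).comp (Algebra.TensorProduct.map ρ ρ')) fun x => ?_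
  induction x using TI with
  | zero => simp
  | tmul a b =>
    simp only [tens_tmul, AlgHom.comp_apply, Algebra.TensorProduct.map_tmul, h, h']
    exact (LinearMap.trace_tensorProduct' _ _).symm
  | add a b ha hb => simp only [map_add, ha, hb]
namespace Wed
variable (W : Wed K)
noncomputable def χ (i : Fin W.n) : K ⇾ ℂ :=
  Matrix.traceLinearMap (Fin (W.d i)) ℂ ℂ ∘ₗ LinearMap.proj i ∘ₗ W.e.toLinearMap
lemma χ_apply (i x) : W.χ i x = ((W.e x) i).trace := rfl
lemma χ_rc (i) : IsRC (W.χ i) := by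
  refine ⟨W.d i, (Matrix.toLinAlgEquiv' (R := ℂ)).toAlgHom.comp ((Pi.evalAlgHom ℂ _ i).comp W.e.toAlgHom), fun x => ?_⟩
  rw [χ_apply]
  exact (Matrix.trace_toLin'_eq _).symm
lemma χ_one (i) : W.χ i 1 = W.d i := by simp [χ_apply]
noncomputable def E (i : Fin W.n) (a b : Fin (W.d i)) : K :=
  W.e.symm (Pi.single i (Matrix.single a b 1))
abbrev z (i : Fin W.n) : Fin (W.d i) := ⟨0, W.pos i⟩
noncomputable def p (i : Fin W.n) : K := W.E i (W.z i) (W.z i)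
lemma E_mul (i a b c d) : W.E i a b * W.E i c d = if b = c then W.E i a d else 0 := by
  simp only [E, ← map_mul, ← Pi.single_mul]
  split_ifs with h
  · subst h; simp
  · simp [h]
lemma E_mul_ne {i j} (h : i ≠ j) (a b c d) : W.E i a b * W.E j c d = 0 := by
  simp only [E, ← map_mul]
  rw [← Pi.single_mul_left]
  simp [h]
lemma p_idem (i) : W.p i * W.p i = W.p i := by simp [p, E_mul]
lemma χ_E (i j a b) : W.χ j (W.E i a b) = if j = i then if a = b then 1 else 0 else 0 := by
  rw [χ_apply, E, AlgEquiv.apply_symm_apply]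
  split_ifs with h h'
  · subst h; subst h'; simp
  · subst h; simp [Matrix.trace_single_eq_of_ne, h']
  · simp [h]
lemma χ_p (i j) : W.χ j (W.p i) = if j = i then 1 else 0 := by simp [p, χ_E]
lemma eq_sum (x : K) : x = ∑ i, ∑ a, ∑ b, W.e x i a b • W.E i a b := by
  apply W.e.injective
  simp only [map_sum, map_smul, E, AlgEquiv.apply_symm_apply]
  ext i a b
  simp only [Finset.sum_apply, Matrix.sum_apply, Pi.smul_apply, Matrix.smul_apply]
  rw [Finset.sum_eq_single i]
  · simp only [Pi.single_eq_same]
    rw [Finset.sum_eq_single a, Finset.sum_eq_single b]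
    · simp
    · intro c _ hc; simp [hc]
    · simp
    · intro c _ hc; simp [Matrix.single_apply, hc]
    · simp
  · intro j _ hj; simp [hj.symm]
  · simp
lemma class_eq {f : K ⇾ ℂ} (hf : ∀ x y, f (x * y) = f (y * x)) (x : K) :
    f x = ∑ i, f (W.p i) * W.χ i x := by
  have h1 : ∀ i a b, f (W.E i a b) = if a = b then f (W.p i) else 0 := by
    intro i a b
    have h2 : W.E i a b = W.E i a (W.z i) * W.E i (W.z i) b := by simp [E_mul]
    rw [h2, hf, E_mul]
    split_ifs with h3 h4 h4
    · rfl
    · exact absurd h3.symm h4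
    · exact absurd h4.symm h3
    · simp
  conv_lhs => rw [W.eq_sum x]
  simp only [map_sum, map_smul, h1, χ_apply, Matrix.trace, Finset.mul_sum]
  refine Finset.sum_congr rfl fun i _ => Finset.sum_congr rfl fun a _ => ?_
  simp [mul_comm]
noncomputable def mult (f : K ⇾ ℂ) (i : Fin W.n) : ℕ :=
  open Classical in if h : ∃ m : ℕ, f (W.p i) = m then h.choose else 0
lemma mult_spec {f : K ⇾ ℂ} (hf : IsRC f) (i) : f (W.p i) = W.mult f i := by
  have := hf.nat (W.p_idem i)
  rw [mult, dif_pos this]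
  exact this.choose_spec
lemma rc_eq {f : K ⇾ ℂ} (hf : IsRC f) : f = ∑ i, (W.mult f i : ℂ) • W.χ i := by
  ext x
  rw [W.class_eq hf.comm x]
  simp [W.mult_spec hf]
lemma coef_eq (c : Fin W.n → ℂ) (i) : (∑ j, c j • W.χ j) (W.p i) = c i := by
  simp [χ_p]
lemma alg_hom (φ : K ⇝ ℂ) : ∃ o, W.d o = 1 ∧ φ.toLinearMap = W.χ o := by
  have hf := IsRC.ofHom φ
  have h1 := congrArg (fun f => f 1) (W.rc_eq hf)
  simp only [AlgHom.toLinearMap_apply, map_one, LinearMap.sum_apply, LinearMap.smul_apply, χ_one, smul_eq_mul] at h1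
  have h2 : ∑ i, W.mult φ.toLinearMap i * W.d i = 1 := by exact_mod_cast h1.symm
  have : ∃ o, W.mult φ.toLinearMap o * W.d o ≠ 0 := by
    by_contra! h
    simp [h] at h2
  obtain ⟨o, ho⟩ := this
  have h3 := Finset.add_sum_erase Finset.univ (fun i => W.mult φ.toLinearMap i * W.d i) (Finset.mem_univ o)
  have h4 : W.mult φ.toLinearMap o * W.d o = 1 := by omega
  have h5 : ∑ i ∈ Finset.univ.erase o, W.mult φ.toLinearMap i * W.d i = 0 := by omega
  rw [Finset.sum_eq_zero_iff] at h5
  refine ⟨o, (mul_eq_one.1 h4).2, ?_⟩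
  rw [W.rc_eq hf, Finset.sum_eq_single o]
  · simp [(mul_eq_one.1 h4).1]
  · intro j _ hj
    have := h5 j (by simp [hj])
    have hp := W.pos j
    have : W.mult φ.toLinearMap j = 0 := by
      rcases Nat.mul_eq_zero.1 this with h | h
      · exact h
      · omega
    simp [this]
  · simp
lemma trace_LR [FiniteDimensional ℂ K] (a b : K) :
    LinearMap.trace ℂ K (LinearMap.mulLeft ℂ a ∘ₗ LinearMap.mulRight ℂ b) =
      ∑ i, W.χ i a * W.χ i b := by
  let F (b : K) : K ⇾ ℂ := IsLinearMap.mk' (fun a => LinearMap.trace ℂ K (LinearMap.mulLeft ℂ a ∘ₗ LinearMap.mulRight ℂ b))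
    ⟨fun x y => by rw [← map_add]; congr 1; ext; simp [add_mul],
     fun c x => by rw [← map_smul]; congr 1; ext; simp⟩
  let G (a : K) : K ⇾ ℂ := IsLinearMap.mk' (fun b => LinearMap.trace ℂ K (LinearMap.mulLeft ℂ a ∘ₗ LinearMap.mulRight ℂ b))
    ⟨fun x y => by rw [← map_add]; congr 1; ext; simp [mul_add],
     fun c x => by rw [← map_smul]; congr 1; ext; simp⟩
  have hF : ∀ b x y, F b (x * y) = F b (y * x) := by
    intro b x y
    change LinearMap.trace ℂ K _ = LinearMap.trace ℂ K _
    trans LinearMap.trace ℂ K (LinearMap.mulLeft ℂ x ∘ₗ (LinearMap.mulLeft ℂ y ∘ₗ LinearMap.mulRight ℂ b))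
    · congr 1; ext; simp [mul_assoc]
    · rw [LinearMap.trace_comp_comm']
      congr 1; ext; simp [mul_assoc]
  have hG : ∀ b x y, G b (x * y) = G b (y * x) := by
    intro b x y
    change LinearMap.trace ℂ K _ = LinearMap.trace ℂ K _
    trans LinearMap.trace ℂ K (LinearMap.mulRight ℂ y ∘ₗ (LinearMap.mulLeft ℂ b ∘ₗ LinearMap.mulRight ℂ x))
    · congr 1; ext; simp [mul_assoc]
    · rw [LinearMap.trace_comp_comm']
      congr 1; ext; simp [mul_assoc]
  have hpp : ∀ i j, G (W.p i) (W.p j) = if j = i then 1 else 0 := by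
    intro i j
    change LinearMap.trace ℂ K _ = _
    split_ifs with h
    · subst h
      have : (LinearMap.mulLeft ℂ (W.p j) ∘ₗ LinearMap.mulRight ℂ (W.p j)) =
        (W.χ j ∘ₗ LinearMap.mulLeft ℂ (W.p j) ∘ₗ LinearMap.mulRight ℂ (W.p j)).smulRight (W.p j) := by
        ext x
        simp only [LinearMap.comp_apply, LinearMap.mulLeft_apply, LinearMap.mulRight_apply, LinearMap.smulRight_apply]
        have : ∃ c : ℂ, W.p j * (x * W.p j) = c • W.p j := by
          refine ⟨W.e x j (W.z j) (W.z j), ?_⟩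
          conv_lhs => rw [W.eq_sum x]
          simp only [Finset.sum_mul, Finset.mul_sum, smul_mul_assoc, mul_smul_comm]
          rw [Finset.sum_eq_single j]
          · simp only [p, E_mul]
            simp [E_mul]
          · intro k _ hk
            simp [p, W.E_mul_ne hk]
          · simp
        obtain ⟨c, hc⟩ := this
        rw [hc, map_smul, χ_p]; simp
      rw [this, LinearMap.trace_smulRight]
      simp [p_idem, χ_p]
    · have : (LinearMap.mulLeft ℂ (W.p i) ∘ₗ LinearMap.mulRight ℂ (W.p j)) = 0 := by
        ext x
        simp only [LinearMap.comp_apply, LinearMap.mulLeft_apply, LinearMap.mulRight_apply, LinearMap.zero_apply]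
        rw [W.eq_sum x]
        simp only [Finset.sum_mul, Finset.mul_sum, smul_mul_assoc, mul_smul_comm]
        refine Finset.sum_eq_zero fun k _ => Finset.sum_eq_zero fun a _ => Finset.sum_eq_zero fun b _ => ?_
        by_cases hk : k = j
        · subst hk
          rw [← mul_assoc, p, p, W.E_mul_ne (Ne.symm h)]; simp
        · rw [p, p, W.E_mul_ne hk]; simp
      rw [this, map_zero]
  change F b a = _
  rw [W.class_eq (hF b)]
  refine Finset.sum_congr rfl fun i _ => ?_
  change G (W.p i) b * _ = _
  rw [W.class_eq (hG _)]
  simp [hpp, mul_comm]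
lemma finrank_eq [FiniteDimensional ℂ K] : Module.finrank ℂ K = ∑ i, W.d i ^ 2 := by
  have := W.trace_LR 1 1
  have h : LinearMap.mulLeft ℂ (1 : K) ∘ₗ LinearMap.mulRight ℂ (1 : K) = LinearMap.id := by ext; simp
  rw [h, LinearMap.trace_id] at this
  simp only [χ_one, ← pow_two] at this
  exact_mod_cast this
lemma trace_reg [FiniteDimensional ℂ K] (a : K) :
    LinearMap.trace ℂ K (LinearMap.mulLeft ℂ a) = ∑ i, W.d i * W.χ i a := by
  have := W.trace_LR a 1
  simp only [LinearMap.mulRight_one, χ_one, LinearMap.comp_id] at this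
  rw [this]; simp [mul_comm]
noncomputable def ce (i : Fin W.n) : K := W.e.symm (Pi.single i 1)
lemma ce_comm (i) (x : K) : W.ce i * x = x * W.ce i := by
  apply W.e.injective
  simp only [map_mul, ce, AlgEquiv.apply_symm_apply]
  rw [← Pi.single_mul_left, ← Pi.single_mul_right]; simp
lemma integral (W : Wed K) (φ : K ⇝ ℂ) : ∃ Λ : K, (∀ x, x * Λ = φ x • Λ) ∧ (∀ x, Λ * x = φ x • Λ) ∧ φ Λ = 1 := by
  obtain ⟨o, h1, h2⟩ := W.alg_hom φ
  have hφ : ∀ x, φ x = ((W.e x) o).trace := fun x => congrArg (fun f => f x) h2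
  have key : ∀ x, x * W.ce o = φ x • W.ce o := by
    intro x
    apply W.e.injective
    simp only [map_mul, map_smul, ce, AlgEquiv.apply_symm_apply]
    rw [← Pi.single_mul_right, ← Pi.single_smul, hφ]
    congr 1
    ext a b
    have : Subsingleton (Fin (W.d o)) := by rw [h1]; infer_instance
    have := Subsingleton.elim a b
    subst this
    rw [Matrix.trace, Finset.sum_eq_single a]
    · simp
    · intro b _ hb; exact absurd (Subsingleton.elim _ _) hb
    · simp
  refine ⟨W.ce o, key, fun x => by rw [ce_comm, key], ?_⟩
  rw [hφ, ce, AlgEquiv.apply_symm_apply]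
  simp [h1]
end Wed
end Wedd
end
section
open Coalgebra TensorProduct WithConv HopfAlgebra
namespace HopfLR
section integrals
variable {H : Type*} [Ring H] [HopfAlgebra ℂ H]
structure Integ (H : Type*) [Ring H] [HopfAlgebra ℂ H] where
  Λ : H
  left : ∀ x, x * Λ = counit (R := ℂ) x • Λ
  right : ∀ x, Λ * x = counit (R := ℂ) x • Λ
  eps : counit (R := ℂ) Λ = 1
open MulOpposite
lemma S_conv_id (x : H) : ∑ i ∈ (ℛ ℂ x).index, S ((ℛ ℂ x).left i) * (ℛ ℂ x).right i = counit (R := ℂ) x • 1 := by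
  have := sum_antipode_mul_eq_smul (R := ℂ) (ℛ ℂ x)
  simpa using this
lemma id_conv_S (x : H) : ∑ i ∈ (ℛ ℂ x).index, (ℛ ℂ x).left i * S ((ℛ ℂ x).right i) = counit (R := ℂ) x • 1 := by
  have := sum_mul_antipode_eq_smul (R := ℂ) (ℛ ℂ x)
  simpa using this
lemma TP_S2 (h x : H) : TP (LinearMap.mulLeft ℂ h ∘ₗ S ∘ₗ S) x = Δ h * (1 ⊗ₜ S (S x)) := by
  let oi : (H ⊠ H) ⇾ (H ⊠ H)ᵐᵒᵖ := (opLinearEquiv ℂ).toLinearMap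
  have e1 : toConv (oi ∘ₗ Δ ∘ₗ S ∘ₗ S) = toConv (oi ∘ₗ i1.toLinearMap ∘ₗ S ∘ₗ S) * toConv (oi ∘ₗ i2.toLinearMap ∘ₗ S ∘ₗ S) := by
    rw [comul_S2]
    ext y
    rw [(ℛ ℂ y).convMul_apply]
    change oi (TensorProduct.map (S ∘ₗ S) (S ∘ₗ S) (comul y)) = _
    conv_lhs => rw [← (ℛ ℂ y).eq]
    simp only [map_sum, TensorProduct.map_tmul]
    refine Finset.sum_congr rfl fun i _ => ?_
    simp [oi, ← op_mul]
  have e2 : toConv (oi ∘ₗ i1.toLinearMap ∘ₗ S) * toConv (oi ∘ₗ i1.toLinearMap ∘ₗ S ∘ₗ S) = 1 := by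
    ext y
    rw [(ℛ ℂ y).convMul_apply]
    have := congrArg (fun z : H => oi (i1 (S z))) (id_conv_S y)
    simp only [map_sum, map_smul] at this
    simp only [LinearMap.convOne_apply, Algebra.algebraMap_eq_smul_one]
    convert this using 1
    · refine Finset.sum_congr rfl fun i _ => ?_
      simp [oi, ← op_mul, S_mul]
    · simp [oi]; rfl
  have e3 : toConv (oi ∘ₗ i1.toLinearMap ∘ₗ S) * toConv (oi ∘ₗ Δ ∘ₗ S ∘ₗ S) = toConv (oi ∘ₗ i2.toLinearMap ∘ₗ S ∘ₗ S) := by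
    rw [e1, ← mul_assoc, e2, one_mul]
  have e4 := congrArg (fun F : WithConv (H ⇾ (H ⊠ H)ᵐᵒᵖ) => unop (F x)) e3
  simp only [] at e4
  rw [(ℛ ℂ x).convMul_apply] at e4
  rw [TP_apply]
  have e5 := congrArg (fun z => Δ h * z) e4
  simp only [Finset.unop_sum, Finset.mul_sum] at e5
  refine Eq.trans ?_ (e5.trans ?_)
  · refine Finset.sum_congr rfl fun i _ => ?_
    simp [oi, mul_assoc]
  · simp [oi]
variable [FiniteDimensional ℂ H]
noncomputable def lam : H ⇾ ℂ :=
  LinearMap.trace ℂ H ∘ₗ LinearMap.lcomp ℂ H (S ∘ₗ S) ∘ₗ (Algebra.lmul ℂ H).toLinearMap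
lemma lam_apply (h : H) : lam h = LinearMap.trace ℂ H (LinearMap.mulLeft ℂ h ∘ₗ S ∘ₗ S) := rfl
lemma lam_int (h : H) : cR lam (Δ h) = lam h • 1 := by
  apply dual_ext
  intro f
  have h1 := trace_TP f (LinearMap.mulLeft ℂ h ∘ₗ S ∘ₗ S)
  rw [← lam_apply] at h1
  rw [map_smul, smul_eq_mul, mul_comm, ← h1]
  have e : cL f ∘ₗ TP (LinearMap.mulLeft ℂ h ∘ₗ S ∘ₗ S) = LinearMap.mulLeft ℂ (cL f (Δ h)) ∘ₗ S ∘ₗ S := by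
    ext x
    rw [LinearMap.comp_apply, TP_S2, cL_mul2]
    rfl
  rw [e, ← lam_apply, ← conv_cR, ← conv_cL]
lemma lam_int' : toConv (LinearMap.id : H ⇾ H) * toConv (eta lam) = toConv (eta lam) := by
  rw [← cR_conv]
  ext h
  change cR lam (Δ h) = _
  rw [lam_int]
  exact (eta_apply _ _).symm
lemma lam_comm (h k : H) : lam (h * k) = lam (k * S (S h)) := by
  rw [lam_apply, lam_apply]
  trans LinearMap.trace ℂ H (LinearMap.mulLeft ℂ h ∘ₗ (LinearMap.mulLeft ℂ k ∘ₗ S ∘ₗ S))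
  · congr 1; ext; simp [mul_assoc]
  · rw [LinearMap.trace_comp_comm']
    congr 1; ext; simp [mul_assoc, S_mul]
lemma lam_one : lam (1 : H) = LinearMap.trace ℂ H (S ∘ₗ S) := by
  rw [lam_apply]; congr 1; ext; simp
namespace Integ
variable (I : Integ H)
lemma lam_Λ : lam I.Λ = 1 := by
  have : LinearMap.mulLeft ℂ I.Λ ∘ₗ S ∘ₗ S = (counit (R := ℂ) (A := H)).smulRight I.Λ := by
    ext x; simp [I.right]
  rw [lam_apply, this, LinearMap.trace_smulRight, I.eps]
lemma int1 (h : H) : Δ I.Λ * (h ⊗ₜ 1) = Δ I.Λ * (1 ⊗ₜ S h) := by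
  have e1 : toConv (cst (Δ I.Λ)) * toConv (Δ (H := H)) = toConv (cst (Δ I.Λ)) := by
    ext h
    rw [cst_mul]
    have := congrArg Δ (I.right h)
    rw [Bialgebra.comul_mul] at this
    rw [this]; simp [cst_apply]
  have e2 : toConv (cst (Δ I.Λ)) * toConv i1.toLinearMap = toConv (cst (Δ I.Λ)) * toConv (i2.toLinearMap ∘ₗ S) := by
    conv_rhs => rw [← e1, comul_conv]
    rw [mul_assoc, mul_assoc, alg_S, mul_one]
  have e3 := congrArg (fun F : WithConv (H ⇾ H ⊠ H) => F h) e2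
  simp only [cst_mul] at e3
  exact e3
lemma int2 (h : H) : (1 ⊗ₜ h) * Δ I.Λ = (S h ⊗ₜ 1) * Δ I.Λ := by
  have e1 : toConv (Δ (H := H)) * toConv (cst (Δ I.Λ)) = toConv (cst (Δ I.Λ)) := by
    ext h
    rw [mul_cst]
    have := congrArg Δ (I.left h)
    rw [Bialgebra.comul_mul] at this
    rw [this]; simp [cst_apply]
  have e2 : toConv i2.toLinearMap * toConv (cst (Δ I.Λ)) = toConv (i1.toLinearMap ∘ₗ S) * toConv (cst (Δ I.Λ)) := by
    conv_rhs => rw [← e1, comul_conv]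
    rw [← mul_assoc, ← mul_assoc, S_alg, one_mul]
  have e3 := congrArg (fun F : WithConv (H ⇾ H ⊠ H) => F h) e2
  simp only [mul_cst] at e3
  exact e3
lemma recon (h : H) : h = cR lam (Δ I.Λ * (1 ⊗ₜ S h)) := by
  rw [← I.int1, cR_mul1, lam_int, I.lam_Λ]; simp
lemma cR_mul2 (f : H ⇾ ℂ) (T : H ⊠ H) (k : H) :
    cR f (T * (1 ⊗ₜ k)) = cR (f ∘ₗ LinearMap.mulRight ℂ k) T := by
  induction T using TI with
  | zero => simp
  | tmul a b => simp
  | add a b ha hb => simp only [map_add, ha, hb, add_mul]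
lemma cL_1mul (f : H ⇾ ℂ) (T : H ⊠ H) (k : H) :
    cL f ((k ⊗ₜ 1) * T) = cL (f ∘ₗ LinearMap.mulLeft ℂ k) T := by
  induction T using TI with
  | zero => simp
  | tmul a b => simp
  | add a b ha hb => simp only [map_add, ha, hb, mul_add]
lemma cR_zero (T : H ⊠ H) : cR 0 T = 0 := by
  simp [cR]
include I in
lemma S_inj : Function.Injective (S (H := H)) := by
  intro x y h
  rw [I.recon x, h, ← I.recon y]
include I in
lemma S_surj : Function.Surjective (S (H := H)) :=
  LinearMap.injective_iff_surjective.1 I.S_inj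
include I in
lemma nondeg {h : H} (hh : ∀ x, lam (x * h) = 0) : h = 0 := by
  obtain ⟨k, rfl⟩ := I.S_surj h
  have : k = 0 := by
    rw [I.recon k, cR_mul2]
    have : lam ∘ₗ LinearMap.mulRight ℂ (S k) = 0 := by ext x; exact hh x
    rw [this, cR_zero]
  simp [this]
noncomputable def fourier : (H ⇾ ℂ) ⇾ H :=
  IsLinearMap.mk' (fun f => cR f (Δ I.Λ)) ⟨fun f g => by simp [cR, LinearMap.lTensor_add],
    fun c f => by simp [cR, LinearMap.lTensor_smul]⟩
lemma fourier_apply (f) : I.fourier f = cR f (Δ I.Λ) := rfl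
lemma fourier_inj : Function.Injective I.fourier := by
  have : Function.Surjective I.fourier := fun h => by
    refine ⟨lam ∘ₗ LinearMap.mulRight ℂ (S h), ?_⟩
    rw [fourier_apply, ← cR_mul2, ← I.recon]
  refine (LinearMap.injective_iff_surjective_of_finrank_eq_finrank ?_).2 this
  exact Subspace.dual_finrank_eq
lemma left_unique {f : H ⇾ ℂ} (hf : ∀ h, cR f (Δ h) = f h • 1) : f = f I.Λ • lam := by
  apply I.fourier_inj
  rw [map_smul, fourier_apply, fourier_apply, hf, lam_int, I.lam_Λ, one_smul]
lemma S_Λ : S I.Λ = I.Λ := by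
  obtain ⟨k, hk⟩ := I.S_surj I.Λ
  have h1 : S k * S I.Λ = counit (R := ℂ) k • S I.Λ := by
    rw [← S_mul, I.right, map_smul]
  have h2 : counit (R := ℂ) k = 1 := by rw [← eps_S k, hk, I.eps]
  rw [hk, h2, I.right, eps_S, I.eps] at h1
  simpa using h1.symm
noncomputable def rho : H ⇾ ℂ := lam ∘ₗ S
lemma rho_apply (h : H) : rho h = lam (S h) := rfl
include I in
lemma rho_int (h : H) : cL rho (Δ h) = rho h • 1 := by
  apply I.S_inj
  rw [map_smul, S_one, rho_apply, ← lam_int]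
  have := congrArg (fun F : H ⇾ H ⊠ H => F h) (comul_S (H := H))
  simp only [LinearMap.comp_apply] at this
  rw [this]
  induction (Δ h) using TI with
  | zero => simp
  | tmul a b => simp [rho_apply]
  | add a b ha hb => simp only [map_add, ha, hb]
lemma rho_Λ : rho I.Λ = 1 := by rw [rho_apply, I.S_Λ, I.lam_Λ]
lemma rho_comm (h k : H) : rho (h * k) = rho (S (S k) * h) := by
  rw [rho_apply, S_mul, lam_comm, rho_apply, S_mul]
lemma recon' (h : H) : h = cL rho ((S h ⊗ₜ 1) * Δ I.Λ) := by
  rw [← I.int2, cL_2mul, I.rho_int, I.rho_Λ]; simp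
lemma trace_eq (P : H ⇾ H) : LinearMap.trace ℂ H P =
    ∑ i ∈ (ℛ ℂ I.Λ).index, rho (S (P ((ℛ ℂ I.Λ).right i)) * (ℛ ℂ I.Λ).left i) := by
  have : P = ∑ i ∈ (ℛ ℂ I.Λ).index, (rho ∘ₗ LinearMap.mulRight ℂ ((ℛ ℂ I.Λ).left i) ∘ₗ S).smulRight (P ((ℛ ℂ I.Λ).right i)) := by
    ext h
    conv_lhs => rw [I.recon' h, ← (ℛ ℂ I.Λ).eq]
    simp [Finset.mul_sum]
  conv_lhs => rw [this]
  simp [LinearMap.trace_smulRight]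
lemma cL_zero (T : H ⊠ H) : cL 0 T = 0 := by simp [cL]
noncomputable def fourier' : (H ⇾ ℂ) ⇾ H :=
  IsLinearMap.mk' (fun f => cL f (Δ I.Λ)) ⟨fun f g => by simp [cL, LinearMap.rTensor_add],
    fun c f => by simp [cL, LinearMap.rTensor_smul]⟩
lemma fourier'_apply (f) : I.fourier' f = cL f (Δ I.Λ) := rfl
lemma fourier'_inj : Function.Injective I.fourier' := by
  have : Function.Surjective I.fourier' := fun h => by
    refine ⟨rho ∘ₗ LinearMap.mulLeft ℂ (S h), ?_⟩
    rw [fourier'_apply, ← cL_1mul, ← I.recon']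
  refine (LinearMap.injective_iff_surjective_of_finrank_eq_finrank ?_).2 this
  exact Subspace.dual_finrank_eq
lemma right_unique {f : H ⇾ ℂ} (hf : ∀ h, cL f (Δ h) = f h • 1) : f = f I.Λ • rho := by
  apply I.fourier'_inj
  rw [map_smul, fourier'_apply, fourier'_apply, hf, I.rho_int, I.rho_Λ, one_smul]
noncomputable def g : H := cL lam (Δ I.Λ)
lemma lam_g_f (f : H ⇾ ℂ) : (toConv lam * toConv f).ofConv = f I.g • lam := by
  have h1 := I.left_unique (f := (toConv lam * toConv f).ofConv) (by
    intro h
    have : toConv (LinearMap.id : H ⇾ H) * toConv (eta (toConv lam * toConv f).ofConv) = toConv (eta (toConv lam * toConv f).ofConv) := by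
      rw [← eta_mul, ← mul_assoc, lam_int']
    have := congrArg (fun F : WithConv (H ⇾ H) => F h) this
    rw [← cR_conv] at this
    refine Eq.trans this (eta_apply _ _))
  rw [h1]
  congr 1
  exact conv_cL _ _ _
lemma lam_g (h : H) : cL lam (Δ h) = lam h • I.g := by
  apply dual_ext
  intro f
  have := congrArg (fun F : H ⇾ ℂ => F h) (I.lam_g_f f)
  simp only [LinearMap.smul_apply, smul_eq_mul] at this
  rw [← conv_cL, map_smul, smul_eq_mul, mul_comm, ← this]
lemma eps_g : counit (R := ℂ) I.g = 1 := by
  have h2 := conv_cL lam (counit (R := ℂ) (A := H)) I.Λ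
  rw [g, ← h2]
  have : toConv (counit (R := ℂ) (A := H)) = 1 := by ext h; simp
  rw [this, mul_one, ← I.lam_Λ]
lemma comul_g : Δ I.g = I.g ⊗ₜ I.g := by
  apply dual_ext
  intro F
  suffices h : ∀ f : H ⇾ ℂ, cR f (Δ I.g) = f I.g • I.g by
    let b := Module.finBasis ℂ H
    have h2 : Δ I.g = ∑ a, cR (b.coord a) (Δ I.g) ⊗ₜ b a := by
      induction (Δ I.g) using TI with
      | zero => simp
      | tmul x y =>
        simp only [cR_tmul, TensorProduct.smul_tmul, ← TensorProduct.tmul_sum]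
        simp only [Module.Basis.coord_apply, b.sum_repr]
      | add x y hx hy => rw [hx, hy]; simp [TensorProduct.add_tmul, Finset.sum_add_distrib, ← hx, ← hy]
    rw [h2]
    simp only [h, TensorProduct.smul_tmul, ← TensorProduct.tmul_sum]
    simp only [Module.Basis.coord_apply, b.sum_repr]
  intro f
  apply dual_ext
  intro f'
  rw [← conv_cR, map_smul, smul_eq_mul]
  have h1 := congrArg (fun F : H ⇾ ℂ => F I.Λ) (I.lam_g_f (toConv f' * toConv f).ofConv)
  simp only [LinearMap.smul_apply, smul_eq_mul, I.lam_Λ, mul_one] at h1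
  refine h1.symm.trans ?_
  change (toConv lam * (toConv f' * toConv f) : WithConv (H ⇾ ℂ)) I.Λ = _
  rw [← mul_assoc]
  have h2 : toConv lam * toConv f' = f' I.g • toConv lam := congrArg toConv (I.lam_g_f f')
  have h3 : toConv lam * toConv f = f I.g • toConv lam := congrArg toConv (I.lam_g_f f)
  rw [h2, smul_mul_assoc, h3, smul_smul]
  change (_ * _) * lam I.Λ = _
  rw [I.lam_Λ]; ring
lemma g_grouplike : IsGroupLikeElem ℂ I.g := ⟨I.eps_g, I.comul_g⟩
lemma rho_eq (h : H) : rho h = lam (h * I.g) := by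
  obtain ⟨gi, hg⟩ : ∃ k, I.g * k = 1 := ⟨_, I.g_grouplike.mul_antipode_cancel⟩
  have hL : ∀ (f : H ⇾ ℂ) (T : H ⊠ H) (k l : H), cL f (T * (k ⊗ₜ l)) = cL (f ∘ₗ LinearMap.mulRight ℂ k) T * l := by
    intro f T k l
    induction T using TI with
    | zero => simp
    | tmul a b => simp
    | add a b ha hb => simp only [map_add, ha, hb, add_mul]
  have h1 := I.right_unique (f := lam ∘ₗ LinearMap.mulRight ℂ I.g) (by
    intro h
    have h2 := I.lam_g (h * I.g)
    rw [Bialgebra.comul_mul, I.comul_g, hL] at h2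
    have h3 := congrArg (fun x => x * gi) h2
    simpa [mul_assoc, hg] using h3)
  have h2 := congrArg (fun F : H ⇾ ℂ => F h) h1
  simp only [LinearMap.comp_apply, LinearMap.mulRight_apply, LinearMap.smul_apply, I.right, I.eps_g, one_smul, I.lam_Λ] at h2
  exact h2.symm
lemma g_S4 (k : H) : k * I.g = I.g * S (S (S (S k))) := by
  rw [← sub_eq_zero]
  apply I.nondeg
  intro x
  rw [mul_sub, map_sub, sub_eq_zero, ← mul_assoc, ← I.rho_eq, rho_comm, I.rho_eq, mul_assoc, lam_comm, mul_assoc]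
include I in
lemma S2_central {z : H} (hz : ∀ x, z * x = x * z) : S (S z) = z := by
  rw [← sub_eq_zero]
  apply I.nondeg
  intro x
  rw [mul_sub, map_sub, sub_eq_zero, ← lam_comm, hz]
end Integ
end integrals
end HopfLR
end
section
open Coalgebra TensorProduct WithConv HopfAlgebra
namespace HopfLR
section order
open Matrix
open scoped ComplexOrder
lemma trace_inv_conj {n : ℕ} (A B : Matrix (Fin n) (Fin n) ℂ) (m : ℕ) (hm : 0 < m) (hA : A ^ m = 1) (hB : A * B = 1) :
    B.trace = star A.trace := by
  let P := ∑ j ∈ Finset.range m, (A ^ j)ᴴ * A ^ j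
  have hP : P.PosDef := by
    have h0 : P = 1 + ∑ j ∈ Finset.range (m - 1), (A ^ (j + 1))ᴴ * A ^ (j + 1) := by
      obtain ⟨k, rfl⟩ : ∃ k, m = k + 1 := ⟨m - 1, by omega⟩
      simp only [P, Finset.sum_range_succ', add_tsub_cancel_right]
      rw [add_comm]; simp
    rw [h0]
    refine Matrix.PosDef.one.add_posSemidef ?_
    exact Matrix.posSemidef_sum _ fun j _ => Matrix.posSemidef_conjTranspose_mul_self _
  have h1 : Aᴴ * P * A = P := by
    simp only [P, Finset.mul_sum, Finset.sum_mul]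
    have : ∀ j, Aᴴ * ((A ^ j)ᴴ * A ^ j) * A = (A ^ (j + 1))ᴴ * A ^ (j + 1) := by
      intro j
      rw [pow_succ, Matrix.conjTranspose_mul]; simp only [Matrix.mul_assoc]
    simp only [this]
    have e := Finset.sum_range_succ' (fun j => (A ^ j)ᴴ * A ^ j) m
    rw [Finset.sum_range_succ, hA] at e
    simpa using e.symm
  have h2 : Aᴴ * P = P * B := by
    rw [← h1]
    rw [h1]
    calc Aᴴ * P = Aᴴ * P * (A * B) := by rw [hB, mul_one]
      _ = (Aᴴ * P * A) * B := by simp only [Matrix.mul_assoc]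
      _ = P * B := by rw [h1]
  have hu : IsUnit P.det := (Matrix.isUnit_iff_isUnit_det _).1 hP.isUnit
  have h3 : B = P⁻¹ * (Aᴴ * P) := by rw [h2, Matrix.nonsing_inv_mul_cancel_left _ _ hu]
  rw [h3, Matrix.trace_mul_comm, Matrix.mul_nonsing_inv_cancel_right _ _ hu, Matrix.trace_conjTranspose]
lemma trace_prod_nonneg {n : ℕ} (A B : Matrix (Fin n) (Fin n) ℂ) (m : ℕ) (hm : 0 < m) (hB : A * B = 1)
    (hc : ∀ X, A ^ m * X = X * A ^ m) : ∃ r : ℝ, 0 ≤ r ∧ A.trace * B.trace = r := by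
  rcases Nat.eq_zero_or_pos n with rfl | hn
  · exact ⟨0, le_rfl, by simp [Matrix.trace]⟩
  have h1 : A ^ m ∈ Set.range (Matrix.scalar (Fin n)) := by
    rw [Matrix.mem_range_scalar_iff_commute_single]
    intro i j _
    exact (hc _).symm
  obtain ⟨c, hc⟩ := h1
  have hc0 : c ≠ 0 := by
    rintro rfl
    have : A ^ m * B ^ m = 1 := by
      have hBA : B * A = 1 := mul_eq_one_comm.1 hB
      rw [← Commute.mul_pow, hB, one_pow]
      exact hB.trans hBA.symm
    rw [← hc] at this
    have := congrFun (congrFun this ⟨0, hn⟩) ⟨0, hn⟩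
    simp at this
  obtain ⟨ζ, hζ⟩ := IsAlgClosed.exists_pow_nat_eq c hm
  have hζ0 : ζ ≠ 0 := by
    rintro rfl
    rw [zero_pow hm.ne'] at hζ
    exact hc0 hζ.symm
  have h2 := trace_inv_conj (ζ⁻¹ • A) (ζ • B) m hm (by
    rw [smul_pow, ← hc, inv_pow, hζ]
    ext i j
    by_cases h : i = j
    · subst h; simp [hc0]
    · simp [h]) (by simp [hB, smul_smul, hζ0])
  refine ⟨Complex.normSq (ζ⁻¹ • A).trace, Complex.normSq_nonneg _, ?_⟩
  rw [Complex.normSq_eq_conj_mul_self]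
  have h3 : A.trace * B.trace = (ζ • B).trace * (ζ⁻¹ • A).trace := by
    simp only [Matrix.trace_smul, smul_eq_mul]; field_simp
  rw [h3, h2]; rfl
variable {H : Type*} [Ring H] [HopfAlgebra ℂ H] [FiniteDimensional ℂ H]
lemma S2_order (I : Integ H) : ∃ m, 0 < m ∧ ((S ∘ₗ S : Module.End ℂ H)) ^ m = 1 := by
  have : Finite (GroupLike ℂ H) := (linearIndep_groupLikeVal (R := ℂ) (A := H)).finite
  let G : GroupLike ℂ H := ⟨I.g, I.g_grouplike⟩
  have hG : G ^ (Nat.card (GroupLike ℂ H)) = 1 := pow_card_eq_one'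
  have hg : I.g ^ (Nat.card (GroupLike ℂ H)) = 1 := by
    have := congrArg GroupLike.val hG
    rwa [GroupLike.val_pow, GroupLike.val_one] at this
  refine ⟨2 * Nat.card (GroupLike ℂ H), by have := Nat.card_pos (α := GroupLike ℂ H); omega, ?_⟩
  have key : ∀ j k, I.g ^ j * ((S ∘ₗ S : Module.End ℂ H) ^ (2 * j)) k = k * I.g ^ j := by
    intro j
    induction j with
    | zero => intro k; simp
    | succ j ih =>
      intro k
      have h1 := I.g_S4 k
      have h2 : ((S ∘ₗ S : Module.End ℂ H) ^ (2 * (j + 1))) k = ((S ∘ₗ S : Module.End ℂ H) ^ (2 * j)) (S (S (S (S k)))) := by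
        rw [show 2 * (j + 1) = 2 * j + 2 by ring, pow_add, Module.End.mul_apply, pow_two, Module.End.mul_apply]
        rfl
      rw [h2, pow_succ', mul_assoc, ih, ← mul_assoc, ← h1, mul_assoc]
  ext k
  have := key (Nat.card (GroupLike ℂ H)) k
  simpa [hg] using this
lemma S2_inner (I : Integ H) (W : Wedd.Wed H) : ∃ a b : H, a * b = 1 ∧ b * a = 1 ∧ ∀ x, S (S x) = a * x * b := by
  have hce : ∀ i, S (S (W.ce i)) = W.ce i := fun i => I.S2_central (W.ce_comm i)
  have hsing : ∀ i (x : H), W.e (W.ce i * x) = Pi.single i (W.e x i) := by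
    intro i x
    rw [map_mul, Wedd.Wed.ce, AlgEquiv.apply_symm_apply, ← Pi.single_mul_left, one_mul]
  have hT : ∀ i x, W.e (S (S x)) i = W.e (S (S (W.e.symm (Pi.single i (W.e x i))))) i := by
    intro i x
    rw [← hsing, AlgEquiv.symm_apply_apply, S2_mul, hce, hsing, Pi.single_eq_same]
  let σ (i) : Matrix (Fin (W.d i)) (Fin (W.d i)) ℂ ⇝ Matrix (Fin (W.d i)) (Fin (W.d i)) ℂ :=
    AlgHom.ofLinearMap (LinearMap.proj i ∘ₗ W.e.toLinearMap ∘ₗ S ∘ₗ S ∘ₗ W.e.symm.toLinearMap ∘ₗ LinearMap.single ℂ (fun i => Matrix (Fin (W.d i)) (Fin (W.d i)) ℂ) i)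
      (by
        change W.e (S (S (W.ce i))) i = 1
        rw [hce, Wedd.Wed.ce, AlgEquiv.apply_symm_apply, Pi.single_eq_same])
      (by
        intro x y
        change W.e (S (S (W.e.symm (Pi.single i (x * y))))) i = W.e (S (S (W.e.symm (Pi.single i x)))) i * W.e (S (S (W.e.symm (Pi.single i y)))) i
        rw [Pi.single_mul, map_mul, S2_mul, map_mul, Pi.mul_apply])
  have hσ : ∀ i x, σ i x = W.e (S (S (W.e.symm (Pi.single i x)))) i := fun i x => rfl
  have hσi : ∀ i, Function.Injective (σ i) := by
    intro i
    rw [injective_iff_map_eq_zero]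
    intro x hx
    rw [hσ] at hx
    have h1 : W.e.symm (Pi.single i x) = W.ce i * W.e.symm (Pi.single i x) := by
      apply W.e.injective
      rw [hsing]; simp
    have h2 : S (S (W.e.symm (Pi.single i x))) = 0 := by
      rw [h1, S2_mul, hce]
      apply W.e.injective
      rw [hsing, hx]; simp
    have h3 : W.e.symm (Pi.single i x) = 0 := by
      apply I.S_inj; apply I.S_inj; rw [h2]; simp
    have h4 : (Pi.single i x : Π j, Matrix (Fin (W.d j)) (Fin (W.d j)) ℂ) = 0 := by
      apply W.e.symm.injective; rw [h3]; simp
    simpa using h4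
  have hconj : ∀ i, ∃ A B : Matrix (Fin (W.d i)) (Fin (W.d i)) ℂ, A * B = 1 ∧ B * A = 1 ∧ ∀ x, σ i x = A * x * B := by
    intro i
    have hb : Function.Bijective (σ i) := ⟨hσi i, (LinearMap.injective_iff_surjective (f := (σ i).toLinearMap)).1 (hσi i)⟩
    let E := Matrix.toLinAlgEquiv' (R := ℂ) (n := Fin (W.d i))
    obtain ⟨T, hT⟩ := AlgEquiv.eq_linearEquivConjAlgEquiv ((E.symm.trans (AlgEquiv.ofBijective (σ i) hb)).trans E)
    refine ⟨E.symm T.toLinearMap, E.symm T.symm.toLinearMap, ?_, ?_, ?_⟩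
    · rw [← map_mul, ← map_one E.symm]; congr 1; ext; simp
    · rw [← map_mul, ← map_one E.symm]; congr 1; ext; simp
    · intro x
      have := congrArg (fun F => E.symm (F (E x))) hT
      simp only [AlgEquiv.trans_apply, AlgEquiv.symm_apply_apply] at this
      refine Eq.trans this ?_
      apply E.injective
      rw [map_mul, map_mul]
      simp only [AlgEquiv.apply_symm_apply]
      rfl
  choose A B h1 h2 h3 using hconj
  refine ⟨W.e.symm A, W.e.symm B, ?_, ?_, ?_⟩
  · rw [← map_mul, ← map_one W.e.symm]; congr 1; ext1 i; exact h1 i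
  · rw [← map_mul, ← map_one W.e.symm]; congr 1; ext1 i; exact h2 i
  · intro x
    apply W.e.injective
    ext1 i
    rw [hT, ← hσ, h3]
    simp
lemma trace_S2_pos (I : Integ H) (W : Wedd.Wed H) : ∃ r : ℝ, 1 ≤ r ∧ LinearMap.trace ℂ H (S ∘ₗ S) = r := by
  obtain ⟨a, b, hab, hba, hx⟩ := S2_inner I W
  obtain ⟨m, hm, hS⟩ := S2_order I
  have e1 : (S ∘ₗ S : H ⇾ H) = LinearMap.mulLeft ℂ a ∘ₗ LinearMap.mulRight ℂ b := by
    ext x; simp [hx, mul_assoc]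
  rw [e1, W.trace_LR]
  have hpow : ∀ j x, ((S ∘ₗ S : Module.End ℂ H) ^ j) x = a ^ j * x * b ^ j := by
    intro j
    induction j with
    | zero => simp
    | succ j ih => intro x; rw [pow_succ, Module.End.mul_apply, ih, LinearMap.comp_apply, hx, pow_succ, pow_succ']; simp only [mul_assoc]
  have hcomm : ∀ x, a ^ m * x = x * a ^ m := by
    intro x
    have h1 := hpow m x
    rw [hS, Module.End.one_apply] at h1
    have h2 : b ^ m * a ^ m = 1 := by
      rw [← Commute.mul_pow, hba, one_pow]
      exact hba.trans hab.symm
    conv_rhs => rw [h1]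
    rw [mul_assoc, h2, mul_one]
  have hblock : ∀ i, ∃ r : ℝ, 0 ≤ r ∧ W.χ i a * W.χ i b = r := by
    intro i
    apply trace_prod_nonneg _ _ m hm
    · change W.e a i * W.e b i = 1
      rw [← Pi.mul_apply, ← map_mul, hab]; simp
    · intro X
      have := congrArg (fun z => W.e z i) (hcomm (W.e.symm (Pi.single i X)))
      simpa using this
  choose r hr0 hr using hblock
  obtain ⟨o, ho, hχ⟩ := W.alg_hom (Bialgebra.counitAlgHom ℂ H)
  have hro : r o = 1 := by
    have := hr o
    rw [← hχ] at this
    simp only [AlgHom.toLinearMap_apply, ← map_mul, hab, map_one] at this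
    exact_mod_cast this.symm
  refine ⟨∑ i, r i, ?_, ?_⟩
  · rw [← hro]
    exact Finset.single_le_sum (fun i _ => hr0 i) (Finset.mem_univ o)
  · push_cast
    exact Finset.sum_congr rfl fun i _ => hr i
end order
end HopfLR
end
section
open Coalgebra TensorProduct WithConv HopfAlgebra
namespace HopfLR
lemma trace_cube {V : Type*} [AddCommGroup V] [Module ℂ V] [FiniteDimensional ℂ V]
    (T : Module.End ℂ V) (hT : T * T * T = T) :
    ∃ a b : ℕ, LinearMap.trace ℂ V T = (a : ℂ) - b := by
  have h4 : T * T * (T * T) = T * T := by rw [← mul_assoc, hT]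
  have h3' : T * (T * T) = T := by rw [← mul_assoc, hT]
  have h1 := Wedd.trace_idem ((1/2 : ℂ) • (T * T + T)) (by
    simp only [smul_mul_assoc, mul_smul_comm, smul_smul, mul_add, add_mul, h4, h3', hT]
    module)
  have h2 := Wedd.trace_idem ((1/2 : ℂ) • (T * T - T)) (by
    simp only [smul_mul_assoc, mul_smul_comm, smul_smul, mul_sub, sub_mul, h4, h3', hT]
    module)
  refine ⟨Module.finrank ℂ (LinearMap.range ((1/2 : ℂ) • (T * T + T))), Module.finrank ℂ (LinearMap.range ((1/2 : ℂ) • (T * T - T))), ?_⟩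
  rw [← h1, ← h2, ← map_sub]
  congr 1
  module
lemma eq_one_of_trace {V : Type*} [AddCommGroup V] [Module ℂ V] [FiniteDimensional ℂ V]
    (T : Module.End ℂ V) (hT : T * T = 1) {r : ℝ} (hr : LinearMap.trace ℂ V T = r)
    (hr' : (Module.finrank ℂ V : ℝ) ≤ r) : T = 1 := by
  have h2 := Wedd.trace_idem ((1/2 : ℂ) • (1 - T)) (by
    simp only [smul_mul_assoc, mul_smul_comm, smul_smul, mul_sub, sub_mul, hT, mul_one, one_mul]
    module)
  rw [map_smul, map_sub, hr, LinearMap.trace_one] at h2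
  have h3 : (1/2 : ℝ) * ((Module.finrank ℂ V : ℝ) - r) = (Module.finrank ℂ (LinearMap.range ((1/2 : ℂ) • (1 - T))) : ℝ) := by
    have := congrArg Complex.re h2
    simpa using this
  have h4 : (0 : ℝ) ≤ (Module.finrank ℂ (LinearMap.range ((1/2 : ℂ) • (1 - T))) : ℝ) := Nat.cast_nonneg _
  have h5 : (Module.finrank ℂ (LinearMap.range ((1/2 : ℂ) • (1 - T))) : ℝ) = 0 := by linarith
  have h6 : Module.finrank ℂ (LinearMap.range ((1/2 : ℂ) • (1 - T))) = 0 := by exact_mod_cast h5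
  rw [Submodule.finrank_eq_zero, LinearMap.range_eq_bot] at h6
  have h7 : (1 - T) = (2 : ℂ) • ((1/2 : ℂ) • (1 - T)) := by module
  rw [h6, smul_zero, sub_eq_zero] at h7
  exact h7.symm
section
variable {H : Type*} [Ring H] [HopfAlgebra ℂ H]
open MulOpposite
lemma cR_comp (f g : H ⇾ ℂ) (x : H) :
    cR f (Δ (cR g (Δ x))) = cR (toConv f * toConv g).ofConv (Δ x) := by
  apply dual_ext
  intro f'
  have h1 := conv_cR (toConv f' * toConv f).ofConv g x
  have h2 := conv_cR f' (toConv f * toConv g).ofConv x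
  refine ((conv_cR f' f _).symm.trans h1.symm).trans (Eq.trans ?_ h2)
  exact congrArg (fun F : WithConv (H ⇾ ℂ) => F x) (mul_assoc (toConv f') (toConv f) (toConv g))
variable [FiniteDimensional ℂ H]
noncomputable def reg : H ⇾ ℂ := LinearMap.trace ℂ H ∘ₗ (Algebra.lmul ℂ H).toLinearMap
lemma reg_apply (h : H) : reg h = LinearMap.trace ℂ H (LinearMap.mulLeft ℂ h) := rfl
lemma reg_Λ (I : Integ H) : reg I.Λ = 1 := by
  have : LinearMap.mulLeft ℂ I.Λ = (counit (R := ℂ) (A := H)).smulRight I.Λ := by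
    ext x; simp [I.right]
  rw [reg_apply, this, LinearMap.trace_smulRight, I.eps]
lemma reg_reg : toConv (reg (H := H)) * toConv reg = (Module.finrank ℂ H : ℂ) • toConv reg := by
  let Φ : H ⊠ H ⇾ H ⊠ H := LinearMap.mul' ℂ (H ⊠ H) ∘ₗ TensorProduct.map Δ i2.toLinearMap
  have hΦ : ∀ x y, Φ (x ⊗ₜ y) = Δ x * (1 ⊗ₜ y) := fun x y => rfl
  have hm : ∀ T y, Φ (T * (1 ⊗ₜ y)) = Φ T * (1 ⊗ₜ y) := by
    intro T y
    induction T using TI with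
    | zero => simp
    | tmul a b => simp [hΦ, mul_assoc]
    | add a b ha hb => simp only [map_add, ha, hb, add_mul]
  have hs : Function.Surjective Φ := by
    have e1 : toConv (Δ (H := H)) * toConv (i2.toLinearMap ∘ₗ S) = toConv i1.toLinearMap := by
      rw [comul_conv, mul_assoc, alg_S, mul_one]
    have e2 : ∀ x : H, Φ (LinearMap.lTensor H S (Δ x)) = x ⊗ₜ 1 := by
      intro x
      have := congrArg (fun F : WithConv (H ⇾ H ⊠ H) => F x) e1
      simp only [] at this
      rw [(ℛ ℂ x).convMul_apply] at this
      rw [← (ℛ ℂ x).eq]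
      simpa [hΦ] using this
    rw [← LinearMap.range_eq_top, eq_top_iff]
    intro T _
    induction T using TI with
    | zero => exact zero_mem _
    | tmul x y => exact ⟨LinearMap.lTensor H S (Δ x) * (1 ⊗ₜ y), by rw [hm, e2]; simp⟩
    | add a b ha hb => exact add_mem (ha trivial) (hb trivial)
  let E := LinearEquiv.ofBijective Φ ⟨LinearMap.injective_iff_surjective.2 hs, hs⟩
  have htr : ∀ T : H ⊠ H, LinearMap.trace ℂ (H ⊠ H) (LinearMap.mulLeft ℂ T) = Wedd.tens reg reg T := by
    intro T
    induction T using TI with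
    | zero => simp
    | tmul a b =>
      have : LinearMap.mulLeft ℂ (a ⊗ₜ[ℂ] b) = TensorProduct.map (LinearMap.mulLeft ℂ a) (LinearMap.mulLeft ℂ b) := by
        ext; simp
      rw [this, LinearMap.trace_tensorProduct']; simp [reg_apply]
    | add a b ha hb =>
      have : LinearMap.mulLeft ℂ (a + b) = LinearMap.mulLeft ℂ a + LinearMap.mulLeft ℂ b := by ext; simp [add_mul]
      rw [this, map_add, ha, hb, map_add]
  ext h
  have h1 : (LinearMap.mulLeft ℂ (Δ h)) = E.conj (TensorProduct.map (LinearMap.mulLeft ℂ h) LinearMap.id) := by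
    rw [LinearEquiv.conj_apply, LinearEquiv.eq_comp_toLinearMap_symm]
    apply TensorProduct.ext'
    intro x y
    change Δ h * Φ (x ⊗ₜ y) = Φ ((h * x) ⊗ₜ y)
    rw [hΦ, hΦ, Bialgebra.comul_mul, mul_assoc]
  have h2 := htr (Δ h)
  rw [h1, LinearMap.trace_conj', LinearMap.trace_tensorProduct', LinearMap.trace_id] at h2
  have h3 : (toConv reg * toConv reg : WithConv (H ⇾ ℂ)) h = Wedd.tens reg reg (Δ h) := rfl
  refine h3.trans ?_
  rw [← h2, mul_comm]; rfl
lemma trace_S2f (I : Integ H) (h4 : ∀ x : H, S (S (S (S x))) = x) (f : H ⇾ ℂ) :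
    LinearMap.trace ℂ H (S ∘ₗ S ∘ₗ cR f ∘ₗ Δ) = lam (1 : H) * f I.Λ := by
  rw [I.trace_eq]
  let oi : H ⇾ Hᵐᵒᵖ := (opLinearEquiv ℂ).toLinearMap
  have e2 : toConv oi * toConv (oi ∘ₗ S ∘ₗ S ∘ₗ S) = 1 := by
    ext y
    rw [(ℛ ℂ y).convMul_apply]
    have := congrArg (fun z : H => oi (S (S (S z)))) (S_conv_id y)
    simp only [map_sum, map_smul] at this
    simp only [LinearMap.convOne_apply, Algebra.algebraMap_eq_smul_one]
    convert this using 1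
    · refine Finset.sum_congr rfl fun i _ => ?_
      simp [oi, ← op_mul, S_mul, h4]
    · simp [oi]
  have e3 : toConv oi * toConv (oi ∘ₗ S ∘ₗ S ∘ₗ S ∘ₗ cR f ∘ₗ Δ) = toConv (eta f) := by
    have : toConv (oi ∘ₗ S ∘ₗ S ∘ₗ S ∘ₗ cR f ∘ₗ Δ) = toConv (oi ∘ₗ S ∘ₗ S ∘ₗ S) * toConv (eta f) := by
      ext x
      rw [(ℛ ℂ x).convMul_apply]
      change oi (S (S (S (cR f (Δ x))))) = _
      conv_lhs => rw [← (ℛ ℂ x).eq]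
      simp [eta_apply]
    rw [this, ← mul_assoc, e2, one_mul]
  have e4 := congrArg (fun F : WithConv (H ⇾ Hᵐᵒᵖ) => Integ.rho (unop (F I.Λ))) e3
  simp only [] at e4
  rw [(ℛ ℂ I.Λ).convMul_apply] at e4
  simp only [Finset.unop_sum, map_sum] at e4
  refine Eq.trans (Finset.sum_congr rfl fun i _ => ?_) (e4.trans ?_)
  · simp [oi]
  · simp [eta_apply, Integ.rho_apply, mul_comm]
theorem S2_one (I : Integ H) (W : Wedd.Wed H) (x : H) : S (S x) = x := by
  obtain ⟨r, hr1, hr⟩ := trace_S2_pos I W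
  have hN : lam (1 : H) = r := by rw [lam_one, hr]
  have hr0 : (r : ℂ) ≠ 0 := by
    intro h
    have : r = 0 := by exact_mod_cast h
    linarith
  have hg : I.g = 1 := by
    have := I.lam_g (1 : H)
    rw [Bialgebra.comul_one, Algebra.TensorProduct.one_def, cL_tmul, hN] at this
    exact (smul_right_injective _ hr0 this).symm
  have h4 : ∀ x : H, S (S (S (S x))) = x := by
    intro x
    have := I.g_S4 x
    simpa [hg] using this.symm
  have hnt : Nontrivial H := ⟨⟨I.Λ, 0, fun h => by have := I.eps; rw [h] at this; simp at this⟩⟩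
  have hd : (Module.finrank ℂ H : ℂ) ≠ 0 := by
    have := Module.finrank_pos (R := ℂ) (M := H)
    exact_mod_cast this.ne'
  let f : H ⇾ ℂ := (Module.finrank ℂ H : ℂ)⁻¹ • reg
  have hff : (toConv f * toConv f).ofConv = f := by
    apply toConv_injective
    change ((Module.finrank ℂ H : ℂ)⁻¹ • toConv (reg (H := H))) * ((Module.finrank ℂ H : ℂ)⁻¹ • toConv (reg (H := H))) = ((Module.finrank ℂ H : ℂ)⁻¹ • toConv (reg (H := H)))
    rw [smul_mul_assoc, mul_smul_comm, reg_reg, smul_smul, smul_smul]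
    congr 1
    field_simp
  have hfS : ∀ x, f (S (S x)) = f x := by
    intro x
    change _ * reg _ = _ * reg _
    rw [reg_apply, reg_apply]
    congr 1
    have : LinearMap.mulLeft ℂ (S (S x)) = (S ∘ₗ S) ∘ₗ (LinearMap.mulLeft ℂ x ∘ₗ S ∘ₗ S) := by
      ext y; simp [S_mul, h4]
    rw [this, LinearMap.trace_comp_comm']
    congr 1; ext y; simp [h4]
  let P : Module.End ℂ H := cR f ∘ₗ Δ
  let U : Module.End ℂ H := S ∘ₗ S
  have hUU : U * U = 1 := by ext x; simp [U, h4]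
  have hPP : P * P = P := by
    ext x
    change cR f (Δ (cR f (Δ x))) = cR f (Δ x)
    rw [cR_comp, hff]
  have hPU : P * U = U * P := by
    ext x
    change cR f (Δ (S (S x))) = S (S (cR f (Δ x)))
    have := congrArg (fun F : H ⇾ H ⊠ H => F x) (comul_S2 (H := H))
    simp only [LinearMap.comp_apply] at this
    rw [this]
    induction (Δ x) using TI with
    | zero => simp
    | tmul a b => simp [hfS]
    | add a b ha hb => simp only [map_add, ha, hb]
  obtain ⟨a, b, hab⟩ := trace_cube (U * P) (by
    have : U * P * (U * P) = P := by
      rw [mul_assoc, ← mul_assoc P, hPU, mul_assoc U, hPP, ← mul_assoc, hUU, one_mul]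
    rw [this, ← mul_assoc, hPU, mul_assoc, hPP])
  have h5 : LinearMap.trace ℂ H (U * P) = lam (1 : H) * f I.Λ := trace_S2f I h4 f
  rw [hab, hN] at h5
  have h6 : f I.Λ = (Module.finrank ℂ H : ℂ)⁻¹ := by
    change _ * reg _ = _
    rw [reg_Λ, mul_one]
  rw [h6] at h5
  have h7 : (r : ℂ) = (Module.finrank ℂ H : ℂ) * (a - b) := by rw [h5]; field_simp
  have h8 : r = (Module.finrank ℂ H : ℝ) * (((a : ℤ) - b : ℤ) : ℝ) := by
    have : (r : ℂ) = (((Module.finrank ℂ H : ℝ) * (((a : ℤ) - b : ℤ) : ℝ) : ℝ) : ℂ) := by rw [h7]; push_cast; rfl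
    exact_mod_cast this
  have hdp : (0 : ℝ) < Module.finrank ℂ H := by
    have := Module.finrank_pos (R := ℂ) (M := H)
    exact_mod_cast this
  have h9 : (1 : ℤ) ≤ (a : ℤ) - b := by
    by_contra h
    have h' : (a : ℤ) - b ≤ 0 := by omega
    have : (((a : ℤ) - b : ℤ) : ℝ) ≤ 0 := by exact_mod_cast h'
    nlinarith
  have h10 : (Module.finrank ℂ H : ℝ) ≤ r := by
    have : (1 : ℝ) ≤ (((a : ℤ) - b : ℤ) : ℝ) := by exact_mod_cast h9
    rw [h8]; nlinarith
  have := eq_one_of_trace U hUU hr h10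
  exact congrArg (fun F : Module.End ℂ H => F x) this
theorem TF (I : Integ H) (h2 : ∀ x : H, S (S x) = x) (f : H ⇾ ℂ) :
    LinearMap.trace ℂ H (cR f ∘ₗ Δ) = Module.finrank ℂ H * f I.Λ := by
  have := trace_S2f I (fun x => by rw [h2, h2]) f
  have hU : (S ∘ₗ S : H ⇾ H) = LinearMap.id := by ext x; exact h2 x
  rw [← LinearMap.comp_assoc, hU, LinearMap.id_comp] at this
  rw [this, lam_one, hU, LinearMap.trace_id]
theorem exists_integ [IsSemisimpleRing H] : Nonempty (Integ H) := by
  obtain ⟨W⟩ := Wedd.exists_wed H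
  obtain ⟨Λ, h1, h2, h3⟩ := W.integral (Bialgebra.counitAlgHom ℂ H)
  exact ⟨⟨Λ, h1, h2, h3⟩⟩
end
end HopfLR
end
section
open Coalgebra TensorProduct WithConv HopfAlgebra
namespace HopfLR
section
variable {K : Type*} [Ring K] [HopfAlgebra ℂ K]
lemma conv_tens (f g : K ⇾ ℂ) (x : K) : (toConv f * toConv g) x = Wedd.tens f g (Δ x) := rfl
lemma rc_conv {f g : K ⇾ ℂ} (hf : Wedd.IsRC f) (hg : Wedd.IsRC g) :
    Wedd.IsRC (toConv f * toConv g).ofConv := by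
  have := (hf.tens hg).comp (Bialgebra.comulAlgHom ℂ K)
  exact this
lemma conv_S (f g : K ⇾ ℂ) : toConv ((toConv f * toConv g).ofConv ∘ₗ S) =
    toConv (g ∘ₗ S) * toConv (f ∘ₗ S) := by
  ext x
  rw [conv_tens]
  change Wedd.tens f g (Δ (S x)) = _
  have := congrArg (fun F : K ⇾ K ⊠ K => F x) (comul_S (H := K))
  simp only [LinearMap.comp_apply] at this
  rw [this]
  induction (Δ x) using TI with
  | zero => simp
  | tmul a b => simp [mul_comm]
  | add a b ha hb => simp only [map_add, ha, hb]
lemma counit_conv : toConv (counit (R := ℂ) (A := K)) = 1 := by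
  ext x; simp
variable [FiniteDimensional ℂ K]
variable (I : Integ K) (W : Wedd.Wed K) (h2 : ∀ x : K, S (S x) = x)
lemma cas (I : Integ K) (h2 : ∀ x : K, S (S x) = x) (f : K ⇾ ℂ) (a : K) :
    cR (f ∘ₗ S) (Δ I.Λ) * a = cR (f ∘ₗ LinearMap.mulLeft ℂ a ∘ₗ S) (Δ I.Λ) := by
  rw [← cR_mul1, I.int1, Integ.cR_mul2]
  congr 2
  ext x; simp [S_mul, h2]
lemma ce_mul_χ (i j : Fin W.n) (x : K) : W.χ j (W.ce i * x) = if j = i then W.χ j x else 0 := by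
  rw [Wedd.Wed.χ_apply, map_mul, Wedd.Wed.ce, AlgEquiv.apply_symm_apply, Pi.mul_apply]
  split_ifs with h
  · subst h; simp [Wedd.Wed.χ_apply]
  · simp [h]
lemma reg_S (W : Wedd.Wed K) (h2 : ∀ x : K, S (S x) = x) (x : K) : reg (S x) = reg x := by
  rw [reg_apply, reg_apply]
  have : LinearMap.mulLeft ℂ (S x) = S ∘ₗ (LinearMap.mulRight ℂ x ∘ₗ S) := by
    ext y; simp [S_mul, h2]
  rw [this, LinearMap.trace_comp_comm']
  have h3 : (LinearMap.mulRight ℂ x ∘ₗ S) ∘ₗ S = LinearMap.mulLeft ℂ 1 ∘ₗ LinearMap.mulRight ℂ x := by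
    ext y; simp [h2]
  have h4 : LinearMap.mulLeft ℂ x = LinearMap.mulLeft ℂ x ∘ₗ LinearMap.mulRight ℂ 1 := by
    ext y; simp
  rw [h3, h4, W.trace_LR, W.trace_LR]
  exact Finset.sum_congr rfl fun i _ => mul_comm _ _
lemma orth (I : Integ K) (W : Wedd.Wed K) (h2 : ∀ x : K, S (S x) = x) (i j : Fin W.n) :
    (toConv (W.χ i) * toConv (W.χ j ∘ₗ S)) I.Λ = if i = j then 1 else 0 := by
  have key : ∀ i j, i ≠ j → W.χ i (cR (W.χ j ∘ₗ S) (Δ I.Λ)) = 0 := by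
    intro i j hij
    have h1 := ce_mul_χ W i i (cR (W.χ j ∘ₗ S) (Δ I.Λ))
    rw [if_pos rfl, W.ce_comm, cas I h2] at h1
    rw [← h1]
    have : W.χ j ∘ₗ LinearMap.mulLeft ℂ (W.ce i) ∘ₗ S = 0 := by
      ext x
      simp [ce_mul_χ, hij.symm]
    rw [this, Integ.cR_zero, map_zero]
  rw [conv_cR]
  split_ifs with h
  · subst h
    have e1 : cR reg (Δ I.Λ) = 1 := by
      have h3 := lam_int I.Λ
      rw [I.lam_Λ, one_smul] at h3
      have : (reg : K ⇾ ℂ) = lam := by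
        ext x; rw [reg_apply, lam_apply]; congr 1; ext y; simp [h2]
      rw [this, h3]
    have e2 : (reg : K ⇾ ℂ) = ∑ j, (W.d j : ℂ) • (W.χ j ∘ₗ S) := by
      ext x
      rw [← reg_S W h2, reg_apply, W.trace_reg]
      simp
    have e3 : cR reg (Δ I.Λ) = ∑ j, (W.d j : ℂ) • cR (W.χ j ∘ₗ S) (Δ I.Λ) := by
      rw [e2, ← I.fourier_apply, map_sum]
      exact Finset.sum_congr rfl fun j _ => by rw [map_smul]; rfl
    have e4 := congrArg (W.χ i) (e1.symm.trans e3)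
    rw [W.χ_one, map_sum, Finset.sum_eq_single i] at e4
    · have h0 : (W.d i : ℂ) ≠ 0 := by exact_mod_cast (W.pos i).ne'
      rw [map_smul, smul_eq_mul] at e4
      exact (mul_left_cancel₀ h0 (by rw [mul_one]; exact e4)).symm
    · intro j _ hj
      rw [map_smul, key i j hj.symm, smul_zero]
    · simp
  · exact key i j h
lemma star_exists (W : Wedd.Wed K) (h2 : ∀ x : K, S (S x) = x) (i : Fin W.n) :
    ∃ j, W.χ i ∘ₗ S = W.χ j := by
  have hM : ∀ i j, ∃ m : ℕ, W.χ i (S (W.p j)) = m := fun i j =>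
    (W.χ_rc i).nat (by rw [← S_mul, W.p_idem])
  choose M hM using hM
  have hc : ∀ i x, W.χ i (S x) = ∑ j, (M i j : ℂ) * W.χ j x := by
    intro i x
    have := W.class_eq (f := W.χ i ∘ₗ S) (fun x y => by simp [S_mul, (W.χ_rc i).comm]) x
    simpa [hM] using this
  have hMM : ∀ i k, ∑ j, M i j * M j k = if i = k then 1 else 0 := by
    intro i k
    have h3 := hc i (S (W.p k))
    rw [h2, W.χ_p] at h3
    simp only [hM] at h3
    split_ifs at h3 ⊢ <;> exact_mod_cast h3.symm
  have h1 := hMM i i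
  rw [if_pos rfl] at h1
  obtain ⟨j, hj⟩ : ∃ j, M i j * M j i ≠ 0 := by
    by_contra! h
    simp [h] at h1
  have hjle : M i j * M j i ≤ 1 := by
    rw [← h1]; exact Finset.single_le_sum (f := fun j => M i j * M j i) (fun _ _ => Nat.zero_le _) (Finset.mem_univ j)
  have hj1 : M i j * M j i = 1 := by omega
  obtain ⟨h3, h4⟩ := (⟨Nat.eq_one_of_mul_eq_one_right hj1, Nat.eq_one_of_mul_eq_one_left hj1⟩ : _ ∧ _)
  have h5 : ∀ k, k ≠ i → M j k = 0 := by
    intro k hk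
    have h6 := hMM i k
    rw [if_neg hk.symm, Finset.sum_eq_zero_iff] at h6
    have := h6 j (Finset.mem_univ j)
    rw [h3, one_mul] at this
    exact this
  have h7 : ∀ x, W.χ j (S x) = W.χ i x := by
    intro x
    rw [hc, Finset.sum_eq_single i]
    · rw [h4]; simp
    · intro k _ hk; rw [h5 k hk]; simp
    · simp
  refine ⟨j, ?_⟩
  ext x
  rw [LinearMap.comp_apply, ← h7, h2]
noncomputable def star (i : Fin W.n) : Fin W.n := (star_exists W h2 i).choose
lemma star_spec (i : Fin W.n) : W.χ i ∘ₗ S = W.χ (star W h2 i) := (star_exists W h2 i).choose_spec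
lemma χ_inj {i j : Fin W.n} (h : W.χ i = W.χ j) : i = j := by
  have h1 := W.χ_p i i
  rw [h, W.χ_p] at h1
  by_contra hne
  rw [if_pos rfl, if_neg (fun h => hne h.symm)] at h1
  exact zero_ne_one h1
lemma star_star (i : Fin W.n) : star W h2 (star W h2 i) = i := by
  apply χ_inj W
  rw [← star_spec, ← star_spec]
  ext x; simp [h2]
noncomputable def oo : Fin W.n := (W.alg_hom (Bialgebra.counitAlgHom ℂ K)).choose
lemma d_oo : W.d (oo W) = 1 := (W.alg_hom (Bialgebra.counitAlgHom ℂ K)).choose_spec.1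
lemma χ_oo : W.χ (oo W) = counit := (W.alg_hom (Bialgebra.counitAlgHom ℂ K)).choose_spec.2.symm
noncomputable def NN (i j k : Fin W.n) : ℕ := W.mult (toConv (W.χ i) * toConv (W.χ j)).ofConv k
lemma NN_spec (i j : Fin W.n) : toConv (W.χ i) * toConv (W.χ j) = ∑ k, (NN W i j k : ℂ) • toConv (W.χ k) := by
  have h1 : (toConv (W.χ i) * toConv (W.χ j)).ofConv = ∑ k, (NN W i j k : ℂ) • W.χ k :=
    W.rc_eq (rc_conv (W.χ_rc i) (W.χ_rc j))
  apply ofConv_injective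
  rw [h1]
  ext x
  simp
lemma orth' (I : Integ K) (W : Wedd.Wed K) (h2 : ∀ x : K, S (S x) = x) (i j : Fin W.n) :
    (toConv (W.χ i) * toConv (W.χ (star W h2 j))) I.Λ = if i = j then 1 else 0 := by
  rw [← star_spec, orth I W h2]
lemma ev_sum {ι : Type*} (s : Finset ι) (c : ι → ℂ) (f : ι → WithConv (K ⇾ ℂ)) (x : K) :
    (∑ i ∈ s, c i • f i) x = ∑ i ∈ s, c i * f i x := by
  have : (∑ i ∈ s, c i • f i).ofConv = ∑ i ∈ s, c i • (f i).ofConv := by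
    simp
  have h := congrArg (fun F : K ⇾ ℂ => F x) this
  simpa using h
lemma NN_eq (I : Integ K) (W : Wedd.Wed K) (h2 : ∀ x : K, S (S x) = x) (i j k : Fin W.n) :
    (NN W i j k : ℂ) = (toConv (W.χ i) * toConv (W.χ j) * toConv (W.χ (star W h2 k))) I.Λ := by
  rw [NN_spec, Finset.sum_mul]
  simp only [smul_mul_assoc]
  rw [ev_sum]
  simp [orth' I W h2]
lemma tau_comm (I : Integ K) (W : Wedd.Wed K) (h2 : ∀ x : K, S (S x) = x) (i j : Fin W.n) :
    (toConv (W.χ i) * toConv (W.χ j)) I.Λ = (toConv (W.χ j) * toConv (W.χ i)) I.Λ := by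
  have h1 := orth' I W h2 i (star W h2 j)
  have h3 := orth' I W h2 j (star W h2 i)
  rw [star_star] at h1 h3
  rw [h1, h3]
  congr 1
  rw [eq_iff_iff]
  constructor
  · rintro rfl; rw [star_star]
  · rintro rfl; rw [star_star]
lemma tau3 (I : Integ K) (W : Wedd.Wed K) (h2 : ∀ x : K, S (S x) = x) (i j k : Fin W.n) :
    (toConv (W.χ i) * toConv (W.χ j) * toConv (W.χ k)) I.Λ = (toConv (W.χ k) * toConv (W.χ i) * toConv (W.χ j)) I.Λ := by
  rw [mul_assoc (toConv (W.χ k)), NN_spec, Finset.sum_mul, Finset.mul_sum]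
  simp only [smul_mul_assoc, mul_smul_comm]
  rw [ev_sum, ev_sum]
  exact Finset.sum_congr rfl fun l _ => by rw [tau_comm I W h2]
lemma tauS (I : Integ K) (W : Wedd.Wed K) (h2 : ∀ x : K, S (S x) = x) (i j k : Fin W.n) :
    (toConv (W.χ i) * toConv (W.χ j) * toConv (W.χ k)) I.Λ =
    (toConv (W.χ (star W h2 k)) * toConv (W.χ (star W h2 j)) * toConv (W.χ (star W h2 i))) I.Λ := by
  have h3 := conv_S (toConv (W.χ i) * toConv (W.χ j)).ofConv (W.χ k)
  have h4 := conv_S (W.χ i) (W.χ j)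
  rw [h4, star_spec W h2, star_spec W h2, star_spec W h2, ← mul_assoc] at h3
  rw [← h3]
  change _ = (toConv (W.χ i) * toConv (W.χ j) * toConv (W.χ k)) (S I.Λ)
  rw [I.S_Λ]
noncomputable def frd (I : Integ K) (W : Wedd.Wed K) (h2 : ∀ x : K, S (S x) = x) : FR (Fin W.n) where
  N := NN W
  d := W.d
  st := star W h2
  o := oo W
  d_pos := W.pos
  d_o := d_oo W
  d_mul i j := by
    have h1 := congrArg (fun F : WithConv (K ⇾ ℂ) => F 1) (NN_spec W i j)
    simp only [ev_sum, conv_tens, Bialgebra.comul_one, Algebra.TensorProduct.one_def, Wedd.tens_tmul, W.χ_one] at h1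
    exact_mod_cast h1
  one_mul i k := by
    have h1 : (toConv (W.χ (oo W)) * toConv (W.χ i)).ofConv = W.χ i := by
      rw [χ_oo, counit_conv, _root_.one_mul]
    have h3 := W.mult_spec (W.χ_rc i) k
    rw [W.χ_p] at h3
    have : (NN W (oo W) i k : ℂ) = if i = k then 1 else 0 := by rw [NN, h1]; exact h3.symm
    split_ifs at this ⊢ <;> exact_mod_cast this
  st_st := star_star W h2
  st_o := by
    apply χ_inj W
    rw [← star_spec, χ_oo]
    ext x; simp
  d_st i := by
    have h1 := congrArg (fun F : K ⇾ ℂ => F 1) (star_spec W h2 i)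
    simp only [LinearMap.comp_apply, S_one, W.χ_one] at h1
    exact_mod_cast h1.symm
  frob i j k := by
    have : (NN W i j k : ℂ) = NN W (star W h2 i) k j := by
      rw [NN_eq I W h2, NN_eq I W h2, tauS I W h2 (star W h2 i), star_star, star_star, tau3 I W h2 i]
      rw [tau3 I W h2 (star W h2 k)]
    exact_mod_cast this
  frob2 i j k := by
    have : (NN W i j k : ℂ) = NN W k (star W h2 j) i := by
      rw [NN_eq I W h2, NN_eq I W h2, tauS I W h2 k, star_star, star_star]
    exact_mod_cast this
end
end HopfLR
end
section
open Coalgebra TensorProduct WithConv HopfAlgebra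
namespace HopfLR
section slice
variable {A : Type*} [Ring A] [Algebra ℂ A] {V : Type*} [AddCommGroup V] [Module ℂ V]
noncomputable def sl (f : V ⇾ ℂ) : A ⊠ V ⇾ A :=
  (TensorProduct.rid ℂ A).toLinearMap ∘ₗ LinearMap.lTensor A f
@[simp] lemma sl_tmul (f : V ⇾ ℂ) (a : A) (v : V) : sl f (a ⊗ₜ[ℂ] v) = f v • a := by simp [sl]
lemma sl_recon {ι : Type*} [Fintype ι] (b : Module.Basis ι ℂ V) (x : A ⊠ V) :
    x = ∑ a, sl (b.coord a) x ⊗ₜ[ℂ] b a := by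
  classical
  induction x using TI with
  | zero => simp
  | tmul a v =>
    simp only [sl_tmul, TensorProduct.smul_tmul, ← TensorProduct.tmul_sum]
    congr 1
    exact (b.sum_repr v).symm
  | add x y hx hy =>
    simp only [map_add, TensorProduct.add_tmul, Finset.sum_add_distrib]
    rw [← hx, ← hy]
lemma sl_ext [FiniteDimensional ℂ V] {x y : A ⊠ V} (h : ∀ f : V ⇾ ℂ, sl f x = sl f y) : x = y := by
  rw [sl_recon (Module.finBasis ℂ V) x, sl_recon (Module.finBasis ℂ V) y]
  simp [h]
lemma sl_ext2 {H : Type*} [Ring H] [Algebra ℂ H] [FiniteDimensional ℂ H] {x y : A ⊠ (H ⊠ H)}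
    (h : ∀ f g : H ⇾ ℂ, sl (Wedd.tens f g) x = sl (Wedd.tens f g) y) : x = y := by
  let b := Module.finBasis ℂ H
  rw [sl_recon (b.tensorProduct b) x, sl_recon (b.tensorProduct b) y]
  refine Finset.sum_congr rfl fun a _ => ?_
  congr 1
  have : (b.tensorProduct b).coord a = Wedd.tens (b.coord a.1) (b.coord a.2) := by
    apply TensorProduct.ext'
    intro u v
    obtain ⟨a1, a2⟩ := a
    simp [Module.Basis.tensorProduct_repr_tmul_apply, mul_comm]
  rw [this, h]
lemma sl_mul_tmul {H : Type*} [Ring H] [Algebra ℂ H] (f : H ⇾ ℂ) (C : A ⊠ H) (a : A) (b : H) :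
    sl f (C * (a ⊗ₜ b)) = sl (f ∘ₗ LinearMap.mulRight ℂ b) C * a := by
  induction C using TI with
  | zero => simp
  | tmul x y => simp
  | add x y hx hy => simp only [add_mul, map_add, hx, hy]
lemma sl_tmul_mul {H : Type*} [Ring H] [Algebra ℂ H] (f : H ⇾ ℂ) (C : A ⊠ H) (a : A) (b : H) :
    sl f ((a ⊗ₜ b) * C) = a * sl (f ∘ₗ LinearMap.mulLeft ℂ b) C := by
  induction C using TI with
  | zero => simp
  | tmul x y => simp
  | add x y hx hy => simp only [mul_add, map_add, hx, hy]
lemma sl_map {B : Type*} [Ring B] [Algebra ℂ B] {V' : Type*} [AddCommGroup V'] [Module ℂ V']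
    (φ : A ⇾ B) (u : V ⇾ V') (f : V' ⇾ ℂ) (x : A ⊠ V) :
    sl f (TensorProduct.map φ u x) = φ (sl (f ∘ₗ u) x) := by
  induction x using TI with
  | zero => simp
  | tmul x y => simp
  | add x y hx hy => simp only [map_add, hx, hy]
end slice
section double
variable {H : Type*} [Ring H] [HopfAlgebra ℂ H]
variable {A : Type*} [Ring A] [Algebra ℂ A]
noncomputable def xL (i : H ⇾ A) (j : (H ⇾ ℂ) ⇾ A) (f : H ⇾ ℂ) : H ⊠ H ⇾ A :=
  LinearMap.mul' ℂ A ∘ₗ TensorProduct.map (j ∘ₗ (LinearMap.mul ℂ H).flip.compr₂ f) i ∘ₗ (TensorProduct.comm ℂ H H).toLinearMap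
noncomputable def xR (i : H ⇾ A) (j : (H ⇾ ℂ) ⇾ A) (f : H ⇾ ℂ) : H ⊠ H ⇾ A :=
  LinearMap.mul' ℂ A ∘ₗ TensorProduct.map i (j ∘ₗ (LinearMap.mul ℂ H).compr₂ f) ∘ₗ (TensorProduct.comm ℂ H H).toLinearMap
lemma xL_tmul (i : H ⇾ A) (j : (H ⇾ ℂ) ⇾ A) (f : H ⇾ ℂ) (a b : H) :
    xL i j f (a ⊗ₜ b) = j (f ∘ₗ LinearMap.mulRight ℂ b) * i a := rfl
lemma xR_tmul (i : H ⇾ A) (j : (H ⇾ ℂ) ⇾ A) (f : H ⇾ ℂ) (a b : H) :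
    xR i j f (a ⊗ₜ b) = i b * j (f ∘ₗ LinearMap.mulLeft ℂ a) := rfl
lemma xL_comp {B : Type*} [Ring B] [Algebra ℂ B] (φ : A ⇝ B) (i : H ⇾ A) (j : (H ⇾ ℂ) ⇾ A) (f : H ⇾ ℂ) (x) :
    φ (xL i j f x) = xL (φ.toLinearMap ∘ₗ i) (φ.toLinearMap ∘ₗ j) f x := by
  induction x using TI with
  | zero => simp
  | tmul x y => simp [xL_tmul]
  | add x y hx hy => simp only [map_add, hx, hy]
lemma xR_comp {B : Type*} [Ring B] [Algebra ℂ B] (φ : A ⇝ B) (i : H ⇾ A) (j : (H ⇾ ℂ) ⇾ A) (f : H ⇾ ℂ) (x) :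
    φ (xR i j f x) = xR (φ.toLinearMap ∘ₗ i) (φ.toLinearMap ∘ₗ j) f x := by
  induction x using TI with
  | zero => simp
  | tmul x y => simp [xR_tmul]
  | add x y hx hy => simp only [map_add, hx, hy]
variable (H) in
abbrev Pre := TensorAlgebra ℂ (H × (H ⇾ ℂ))
noncomputable def pI : H ⇾ Pre H := TensorAlgebra.ι ℂ ∘ₗ LinearMap.inl ℂ _ _
noncomputable def pJ : (H ⇾ ℂ) ⇾ Pre H := TensorAlgebra.ι ℂ ∘ₗ LinearMap.inr ℂ _ _
inductive DRel : Pre H → Pre H → Prop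
  | imul (h k : H) : DRel (pI (h * k)) (pI h * pI k)
  | ione : DRel (pI 1) 1
  | jone : DRel (pJ counit) 1
  | jmul (f g : H ⇾ ℂ) : DRel (pJ (toConv f * toConv g).ofConv) (pJ g * pJ f)
  | cross (f : H ⇾ ℂ) (h : H) : DRel (xL pI pJ f (Δ h)) (xR pI pJ f (Δ h))
variable (H) in
def DD := RingQuot (DRel (H := H))
noncomputable instance : Ring (DD H) := inferInstanceAs (Ring (RingQuot (DRel (H := H))))
noncomputable instance : Algebra ℂ (DD H) := inferInstanceAs (Algebra ℂ (RingQuot (DRel (H := H))))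
noncomputable def qD : Pre H ⇝ DD H := RingQuot.mkAlgHom ℂ DRel
lemma qD_rel {x y : Pre H} (h : DRel x y) : qD x = qD y := RingQuot.mkAlgHom_rel ℂ h
noncomputable def iD : H ⇝ DD H := AlgHom.ofLinearMap (qD.toLinearMap ∘ₗ pI)
  ((qD_rel .ione).trans (map_one _)) (fun h k => (qD_rel (.imul h k)).trans (map_mul _ _ _))
noncomputable def jD : (H ⇾ ℂ) ⇾ DD H := qD.toLinearMap ∘ₗ pJ
lemma jD_one : jD (H := H) counit = 1 := (qD_rel .jone).trans (map_one _)
lemma jD_mul (f g : H ⇾ ℂ) : jD (toConv f * toConv g).ofConv = jD g * jD f :=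
  (qD_rel (.jmul f g)).trans (map_mul _ _ _)
lemma D_cross (f : H ⇾ ℂ) (h : H) : xL iD.toLinearMap jD f (Δ h) = xR iD.toLinearMap jD f (Δ h) := by
  have := qD_rel (.cross f h)
  rw [xL_comp, xR_comp] at this
  exact this
lemma D_lift (i : H ⇝ A) (j : (H ⇾ ℂ) ⇾ A) (h1 : j counit = 1)
    (hm : ∀ f g : H ⇾ ℂ, j (toConv f * toConv g).ofConv = j g * j f)
    (hx : ∀ (f : H ⇾ ℂ) (h : H), xL i.toLinearMap j f (Δ h) = xR i.toLinearMap j f (Δ h)) :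
    ∃ φ : DD H ⇝ A, (∀ h, φ (iD h) = i h) ∧ ∀ f, φ (jD f) = j f := by
  let φ0 : Pre H ⇝ A := TensorAlgebra.lift ℂ (LinearMap.coprod i.toLinearMap j)
  have hI : ∀ h, φ0 (pI h) = i h := fun h => by simp [φ0, pI]
  have hJ : ∀ f, φ0 (pJ f) = j f := fun f => by simp [φ0, pJ]
  have hI' : φ0.toLinearMap ∘ₗ pI = i.toLinearMap := LinearMap.ext hI
  have hJ' : φ0.toLinearMap ∘ₗ pJ = j := LinearMap.ext hJ
  refine ⟨RingQuot.liftAlgHom ℂ ⟨φ0, ?_⟩, fun h => ?_, fun f => ?_⟩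
  · intro x y hxy
    cases hxy with
    | imul h k => simp [hI]
    | ione => simp [hI]
    | jone => simp [hJ, h1]
    | jmul f g => simp [hJ, hm]
    | cross f h => rw [xL_comp, xR_comp, hI', hJ', hx]
  · exact (RingQuot.liftAlgHom_mkAlgHom_apply _ _ _ _).trans (hI h)
  · exact (RingQuot.liftAlgHom_mkAlgHom_apply _ _ _ _).trans (hJ f)
lemma D_ext {φ ψ : DD H ⇝ A} (h1 : ∀ h, φ (iD h) = ψ (iD h)) (h2 : ∀ f, φ (jD f) = ψ (jD f)) : φ = ψ := by
  apply RingQuot.ringQuot_ext'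
  apply TensorAlgebra.hom_ext
  apply LinearMap.prod_ext
  · ext h; exact h1 h
  · ext f; exact h2 f
lemma D_ind {P : DD H → Prop} (h0 : ∀ c, P (algebraMap ℂ _ c)) (hi : ∀ h, P (iD h)) (hj : ∀ f, P (jD f))
    (hadd : ∀ x y, P x → P y → P (x + y)) (hmul : ∀ x y, P x → P y → P (x * y)) (x : DD H) : P x := by
  obtain ⟨y, rfl⟩ := RingQuot.mkAlgHom_surjective ℂ (DRel (H := H)) x
  induction y using TensorAlgebra.induction with
  | algebraMap r => rw [AlgHom.commutes]; exact h0 r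
  | ι m =>
    have : TensorAlgebra.ι ℂ m = pI m.1 + pJ m.2 := by
      simp [pI, pJ, ← map_add]
    rw [this, map_add]
    exact hadd _ _ (hi _) (hj _)
  | mul a b ha hb => rw [map_mul]; exact hmul _ _ ha hb
  | add a b ha hb => rw [map_add]; exact hadd _ _ ha hb
variable [FiniteDimensional ℂ H]
noncomputable def CD : DD H ⊠ H := ∑ a, jD ((Module.finBasis ℂ H).coord a) ⊗ₜ[ℂ] (Module.finBasis ℂ H) a
@[simp] lemma sl_CD (f : H ⇾ ℂ) : sl f (CD (H := H)) = jD f := by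
  simp only [CD, map_sum, sl_tmul, ← map_smul]
  rw [← map_sum]
  congr 1
  apply (Module.finBasis ℂ H).ext
  intro j
  simp only [LinearMap.sum_apply, LinearMap.smul_apply, Module.Basis.coord_apply, Module.Basis.repr_self]
  rw [Finset.sum_eq_single j] <;> simp +contextual [Finsupp.single_apply, eq_comm]
noncomputable abbrev inL : A ⇝ A ⊠ H := Algebra.TensorProduct.includeLeft
noncomputable abbrev inR : H ⇝ A ⊠ H := Algebra.TensorProduct.includeRight
noncomputable abbrev l12 : A ⊠ H ⇝ A ⊠ (H ⊠ H) := Algebra.TensorProduct.map (AlgHom.id ℂ A) i1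
noncomputable abbrev l13 : A ⊠ H ⇝ A ⊠ (H ⊠ H) := Algebra.TensorProduct.map (AlgHom.id ℂ A) i2
structure DRep (i : H ⇝ A) (C : A ⊠ H) : Prop where
  c1 : sl counit C = 1
  c2 : LinearMap.lTensor A Δ C = l13 C * l12 C
  c3 : toConv (cst C) * (toConv (inL.toLinearMap ∘ₗ i.toLinearMap) * toConv inR.toLinearMap) =
    (toConv inR.toLinearMap * toConv (inL.toLinearMap ∘ₗ i.toLinearMap) : WithConv (H ⇾ A ⊠ H)) * toConv (cst C)
lemma c2_sl (C C' : A ⊠ H) (f g : H ⇾ ℂ) : sl (Wedd.tens f g) (l13 C * l12 C') = sl g C * sl f C' := by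
  induction C using TI with
  | zero => simp
  | tmul x y =>
    induction C' using TI with
    | zero => simp
    | tmul x' y' => simp [mul_comm, smul_smul]
    | add x y hx hy => simp only [map_add, mul_add, hx, hy]
  | add x y hx hy => simp only [map_add, add_mul, hx, hy]
lemma lT_sl (C : A ⊠ H) (f g : H ⇾ ℂ) : sl (Wedd.tens f g) (LinearMap.lTensor A Δ C) = sl (toConv f * toConv g).ofConv C := by
  have := sl_map (LinearMap.id : A ⇾ A) (Δ (H := H)) (Wedd.tens f g) C
  exact this
lemma ab_apply (i : H ⇝ A) (h : H) : (toConv (inL.toLinearMap ∘ₗ i.toLinearMap) * toConv inR.toLinearMap : WithConv (H ⇾ A ⊠ H)) h =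
    TensorProduct.map i.toLinearMap LinearMap.id (Δ h) := by
  rw [(ℛ ℂ h).convMul_apply, ← (ℛ ℂ h).eq]
  simp
lemma ba_apply (i : H ⇝ A) (h : H) : (toConv inR.toLinearMap * toConv (inL.toLinearMap ∘ₗ i.toLinearMap) : WithConv (H ⇾ A ⊠ H)) h =
    TensorProduct.map i.toLinearMap LinearMap.id (TensorProduct.comm ℂ H H (Δ h)) := by
  rw [(ℛ ℂ h).convMul_apply, ← (ℛ ℂ h).eq]
  simp
noncomputable def jC (C : A ⊠ H) : (H ⇾ ℂ) ⇾ A := IsLinearMap.mk' (fun f => sl f C)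
  ⟨fun f g => by simp [sl, LinearMap.lTensor_add], fun c f => by simp [sl, LinearMap.lTensor_smul]⟩
lemma jC_apply (C : A ⊠ H) (f) : jC C f = sl f C := rfl
lemma sl_xL (i : H ⇝ A) (C : A ⊠ H) (f : H ⇾ ℂ) (T : H ⊠ H) :
    sl f (C * TensorProduct.map i.toLinearMap LinearMap.id T) = xL i.toLinearMap (jC C) f T := by
  induction T using TI with
  | zero => simp
  | tmul x y => simp [xL_tmul, sl_mul_tmul, jC_apply]
  | add x y hx hy => simp only [map_add, mul_add, hx, hy]
lemma sl_xR (i : H ⇝ A) (C : A ⊠ H) (f : H ⇾ ℂ) (T : H ⊠ H) :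
    sl f (TensorProduct.map i.toLinearMap LinearMap.id (TensorProduct.comm ℂ H H T) * C) = xR i.toLinearMap (jC C) f T := by
  induction T using TI with
  | zero => simp
  | tmul x y => simp [xR_tmul, sl_tmul_mul, jC_apply]
  | add x y hx hy => simp only [map_add, add_mul, hx, hy]
lemma cst_mul' {B : Type*} [Ring B] [Algebra ℂ B] (a : B) (F : WithConv (H ⇾ B)) (h : H) :
    (toConv (cst a) * F : WithConv (H ⇾ B)) h = a * F h := cst_mul a F.ofConv h
lemma mul_cst' {B : Type*} [Ring B] [Algebra ℂ B] (a : B) (F : WithConv (H ⇾ B)) (h : H) :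
    (F * toConv (cst a) : WithConv (H ⇾ B)) h = F h * a := mul_cst a F.ofConv h
lemma c3_iff (i : H ⇝ A) (C : A ⊠ H) : (toConv (cst C) * (toConv (inL.toLinearMap ∘ₗ i.toLinearMap) * toConv inR.toLinearMap) =
    (toConv inR.toLinearMap * toConv (inL.toLinearMap ∘ₗ i.toLinearMap) : WithConv (H ⇾ A ⊠ H)) * toConv (cst C)) ↔
    ∀ h, C * TensorProduct.map i.toLinearMap LinearMap.id (Δ h) = TensorProduct.map i.toLinearMap LinearMap.id (TensorProduct.comm ℂ H H (Δ h)) * C := by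
  constructor
  · intro e h
    have := congrArg (fun F : WithConv (H ⇾ A ⊠ H) => F h) e
    rw [cst_mul', mul_cst', ab_apply, ba_apply] at this
    exact this
  · intro e
    ext h
    rw [cst_mul', mul_cst', ab_apply, ba_apply, e]
lemma DRep_D : DRep (iD (H := H)) CD where
  c1 := by rw [sl_CD, jD_one]
  c2 := by
    apply sl_ext2
    intro f g
    rw [c2_sl, lT_sl, sl_CD, sl_CD, sl_CD, jD_mul]
  c3 := by
    rw [c3_iff]
    intro h
    apply sl_ext
    intro f
    rw [sl_xL, sl_xR]
    have : jC (CD (H := H)) = jD := by ext f; rw [jC_apply, sl_CD]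
    rw [this, D_cross]
lemma DRep.lift {i : H ⇝ A} {C : A ⊠ H} (h : DRep i C) :
    ∃ φ : DD H ⇝ A, (∀ h, φ (iD h) = i h) ∧ TensorProduct.map φ.toLinearMap LinearMap.id CD = C := by
  obtain ⟨φ, h1, h2⟩ := D_lift i (jC C) h.c1 (fun f g => by
    rw [jC_apply, jC_apply, jC_apply, ← c2_sl, ← h.c2, lT_sl]) (fun f x => by
    rw [← sl_xL, ← sl_xR, (c3_iff i C).1 h.c3])
  refine ⟨φ, h1, sl_ext fun f => ?_⟩
  rw [sl_map, LinearMap.comp_id, sl_CD]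
  exact h2 f
lemma D_ext' {φ ψ : DD H ⇝ A} (h1 : ∀ h, φ (iD h) = ψ (iD h))
    (h2 : TensorProduct.map φ.toLinearMap LinearMap.id (CD (H := H)) = TensorProduct.map ψ.toLinearMap LinearMap.id CD) : φ = ψ := by
  refine D_ext h1 fun f => ?_
  have := congrArg (sl f) h2
  rw [sl_map, sl_map, LinearMap.comp_id, sl_CD] at this
  exact this
end double
end HopfLR
end
section
open Coalgebra TensorProduct WithConv HopfAlgebra
namespace HopfLR
set_option linter.unusedSectionVars false
section dbl
variable {H : Type*} [Ring H] [HopfAlgebra ℂ H] [FiniteDimensional ℂ H]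
variable {A B : Type*} [Ring A] [Algebra ℂ A] [Ring B] [Algebra ℂ B]
noncomputable abbrev nn (φ : A ⇝ B) : A ⊠ H ⇝ B ⊠ H := Algebra.TensorProduct.map φ (AlgHom.id ℂ H)
lemma sl_counit_mul (x y : A ⊠ H) : sl counit (x * y) = sl counit x * sl counit y := by
  induction x using TI with
  | zero => simp
  | tmul x y' =>
    induction y using TI with
    | zero => simp
    | tmul x' y' => simp [smul_smul, mul_comm]
    | add x y hx hy => simp only [map_add, mul_add, hx, hy]
  | add x y hx hy => simp only [map_add, add_mul, hx, hy]
lemma lT_mul (x y : A ⊠ H) : LinearMap.lTensor A Δ (x * y) = LinearMap.lTensor A Δ x * LinearMap.lTensor A Δ y :=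
  map_mul (Algebra.TensorProduct.map (AlgHom.id ℂ A) (Bialgebra.comulAlgHom ℂ H)) x y
lemma cst_cst {B : Type*} [Ring B] [Algebra ℂ B] (a b : B) : toConv (cst (H := H) (a * b)) = toConv (cst a) * toConv (cst b) := by
  ext h
  rw [cst_mul']
  simp [cst_apply]
lemma cst_comm {B : Type*} [Ring B] [Algebra ℂ B] (a : B) (F : WithConv (H ⇾ B)) (h : ∀ x, Commute a (F x)) :
    toConv (cst a) * F = F * toConv (cst a) := by
  ext x
  rw [cst_mul', mul_cst']
  exact h x
lemma DRep.mul {i i1 i2 : H ⇝ A} {C1 C2 : A ⊠ H} (d1 : DRep i1 C1) (d2 : DRep i2 C2)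
    (hi : toConv i.toLinearMap = toConv i1.toLinearMap * toConv i2.toLinearMap)
    (h12 : ∀ x, Commute C2 (inL (i1 x))) (h21 : ∀ x, Commute C1 (inL (i2 x)))
    (hC : Commute (l12 C1) (l13 C2)) : DRep i (C1 * C2) where
  c1 := by rw [sl_counit_mul, d1.c1, d2.c1, one_mul]
  c2 := by
    rw [lT_mul, d1.c2, d2.c2, map_mul, map_mul]
    simp only [mul_assoc]
    rw [hC.left_comm]
  c3 := by
    have hi' : toConv (inL.toLinearMap ∘ₗ i.toLinearMap : H ⇾ A ⊠ H) =
        toConv (inL.toLinearMap ∘ₗ i1.toLinearMap) * toConv (inL.toLinearMap ∘ₗ i2.toLinearMap) := by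
      have := congrArg (fun F => toConv ((inL (A := A) (H := H)).toLinearMap ∘ₗ F.ofConv)) hi
      refine this.trans ?_
      exact congrArg toConv (LinearMap.algHom_comp_convMul_distrib inL (toConv i1.toLinearMap) (toConv i2.toLinearMap))
    rw [hi', cst_cst]
    have e1 := d1.c3
    have e2 := d2.c3
    have f1 := cst_comm C1 (toConv (inL.toLinearMap ∘ₗ i2.toLinearMap)) h21
    have f2 := cst_comm C2 (toConv (inL.toLinearMap ∘ₗ i1.toLinearMap)) h12
    generalize (toConv (inL.toLinearMap ∘ₗ i1.toLinearMap) : WithConv (H ⇾ A ⊠ H)) = a1 at *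
    generalize (toConv (inL.toLinearMap ∘ₗ i2.toLinearMap) : WithConv (H ⇾ A ⊠ H)) = a2 at *
    generalize toConv (cst (H := H) C1) = c1 at *
    generalize toConv (cst (H := H) C2) = c2 at *
    generalize (toConv inR.toLinearMap : WithConv (H ⇾ A ⊠ H)) = b at *
    calc c1 * c2 * (a1 * a2 * b) = c1 * (c2 * a1) * a2 * b := by simp only [mul_assoc]
      _ = c1 * a1 * (c2 * (a2 * b)) := by rw [f2]; simp only [mul_assoc]
      _ = (c1 * (a1 * b)) * a2 * c2 := by rw [e2]; simp only [mul_assoc]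
      _ = b * a1 * (c1 * a2) * c2 := by rw [e1]; simp only [mul_assoc]
      _ = _ := by rw [f1]; simp only [mul_assoc]
lemma nn_eq (φ : A ⇝ B) (x : A ⊠ H) : nn φ x = TensorProduct.map φ.toLinearMap LinearMap.id x := rfl
noncomputable abbrev nn2 (φ : A ⇝ B) : A ⊠ (H ⊠ H) ⇝ B ⊠ (H ⊠ H) := Algebra.TensorProduct.map φ (AlgHom.id ℂ (H ⊠ H))
lemma nn2_l12 (φ : A ⇝ B) (x : A ⊠ H) : nn2 φ (l12 x) = l12 (nn φ x) := by
  induction x using TI with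
  | zero => simp
  | tmul => simp
  | add x y hx hy => simp only [map_add, hx, hy]
lemma nn2_l13 (φ : A ⇝ B) (x : A ⊠ H) : nn2 φ (l13 x) = l13 (nn φ x) := by
  induction x using TI with
  | zero => simp
  | tmul => simp
  | add x y hx hy => simp only [map_add, hx, hy]
lemma nn2_lT (φ : A ⇝ B) (x : A ⊠ H) : nn2 φ (LinearMap.lTensor A Δ x) = LinearMap.lTensor B Δ (nn φ x) := by
  induction x using TI with
  | zero => simp
  | tmul => simp
  | add x y hx hy => simp only [map_add, hx, hy]
lemma nn_map (φ : A ⇝ B) (i : H ⇝ A) (T : H ⊠ H) : nn φ (TensorProduct.map i.toLinearMap LinearMap.id T) =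
    TensorProduct.map (φ.comp i).toLinearMap LinearMap.id T := by
  induction T using TI with
  | zero => simp
  | tmul => simp
  | add x y hx hy => simp only [map_add, hx, hy]
lemma DRep.map {i : H ⇝ A} {C : A ⊠ H} (d : DRep i C) (φ : A ⇝ B) : DRep (φ.comp i) (nn φ C) where
  c1 := by
    have := sl_map φ.toLinearMap (LinearMap.id : H ⇾ H) counit C
    refine this.trans ?_
    rw [LinearMap.comp_id, d.c1]; simp
  c2 := by
    have := congrArg (nn2 φ) d.c2
    rwa [map_mul, nn2_lT, nn2_l12, nn2_l13] at this
  c3 := by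
    rw [c3_iff]
    intro h
    have := congrArg (nn φ) ((c3_iff i C).1 d.c3 h)
    rwa [map_mul, map_mul, nn_map, nn_map] at this
lemma commLR {K : Type*} [Ring K] [Algebra ℂ K] (x : A ⊠ K) (y : B ⊠ H) {E : Type*} [Ring E] [Algebra ℂ E] 
    (φ : A ⊠ K ⇝ E) (ψ : B ⊠ H ⇝ E)
    (h : ∀ a k b l, Commute (φ (a ⊗ₜ k)) (ψ (b ⊗ₜ l))) : Commute (φ x) (ψ y) := by
  induction x using TI with
  | zero => simp
  | tmul x y' =>
    induction y using TI with
    | zero => simp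
    | tmul x' y' => exact h _ _ _ _
    | add x y hx hy => rw [map_add]; exact hx.add_right hy
  | add x y hx hy => rw [map_add]; exact hx.add_left hy
variable (H) in
lemma exists_epsD : ∃ φ : DD H ⇝ ℂ, (∀ h, φ (iD h) = counit (R := ℂ) h) ∧ nn φ (CD (H := H)) = 1 := by
  have : DRep (Bialgebra.counitAlgHom ℂ H) (1 : ℂ ⊠ H) := by
    refine ⟨?_, ?_, ?_⟩
    · simp [Algebra.TensorProduct.one_def]
    · simp [Algebra.TensorProduct.one_def]
    · rw [c3_iff]
      intro h
      rw [one_mul, mul_one, ← (ℛ ℂ h).eq]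
      simp only [map_sum, TensorProduct.map_tmul, TensorProduct.comm_tmul]
      have e1 := congrArg (TensorProduct.comm ℂ H ℂ) (sum_tmul_counit_eq (R := ℂ) (ℛ ℂ h))
      have e2 := (sum_counit_tmul_eq (R := ℂ) (ℛ ℂ h))
      simp only [map_sum, TensorProduct.comm_tmul] at e1
      exact e2.trans e1.symm
  exact this.lift
noncomputable def epsD : DD H ⇝ ℂ := (exists_epsD H).choose
@[simp] lemma epsD_iD (h : H) : epsD (iD h) = counit (R := ℂ) h := (exists_epsD H).choose_spec.1 h
lemma epsD_CD : nn epsD (CD (H := H)) = 1 := (exists_epsD H).choose_spec.2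
noncomputable abbrev nL : A ⇝ A ⊠ B := Algebra.TensorProduct.includeLeft
noncomputable abbrev nR : B ⇝ A ⊠ B := Algebra.TensorProduct.includeRight
lemma nn_comm {E : Type*} [Ring E] [Algebra ℂ E] (φ : A ⇝ E) (a : E) (h : ∀ x, Commute (φ x) a) (C : A ⊠ H) :
    Commute (nn φ C) (inL a) := by
  induction C using TI with
  | zero => simp
  | tmul x y => simp [Commute, SemiconjBy, (h x).eq]
  | add x y hx hy => rw [map_add]; exact hx.add_left hy
lemma DRep_tens {i : H ⇝ A} {C : A ⊠ H} (d : DRep i C) {i' : H ⇝ B} {C' : B ⊠ H} (d' : DRep i' C') :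
    DRep ((Algebra.TensorProduct.map i i').comp (Bialgebra.comulAlgHom ℂ H)) (nn (nL (B := B)) C * nn (nR (A := A)) C') := by
  refine DRep.mul (d.map nL) (d'.map nR) ?_ ?_ ?_ ?_
  · have := comp_mul (Algebra.TensorProduct.map i i') i1.toLinearMap i2.toLinearMap
    rw [← comul_conv] at this
    refine this.trans ?_
    congr 2
    · ext x; simp
    · ext x; simp
  · intro x
    exact nn_comm _ _ (by intro y; simp [Commute, SemiconjBy]) _
  · intro x
    exact nn_comm _ _ (by intro y; simp [Commute, SemiconjBy]) _
  · exact commLR C C' (l12.comp (nn nL)) (l13.comp (nn nR)) (by intro a k b l; simp [Commute, SemiconjBy])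
noncomputable def DelD : DD H ⇝ DD H ⊠ DD H := (DRep_tens DRep_D DRep_D).lift.choose
lemma DelD_iD (h : H) : DelD (iD h) = Algebra.TensorProduct.map iD iD (Δ h) := (DRep_tens DRep_D DRep_D).lift.choose_spec.1 h
lemma DelD_CD : nn DelD (CD (H := H)) = nn nL CD * nn nR CD := (DRep_tens DRep_D DRep_D).lift.choose_spec.2
lemma nn_nn {E : Type*} [Ring E] [Algebra ℂ E] (φ : A ⇝ B) (ψ : B ⇝ E) (C : A ⊠ H) :
    nn ψ (nn φ C) = nn (ψ.comp φ) C := by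
  induction C using TI with
  | zero => simp
  | tmul x y => simp 
  | add x y hx hy => simp only [map_add, hx, hy]
lemma nn_id (C : A ⊠ H) : nn (AlgHom.id ℂ A) C = C := by simp
lemma nn_ofId (φ : A ⇝ B) (ψ : A ⇝ ℂ) (h : φ = (Algebra.ofId ℂ B).comp ψ) (C : A ⊠ H) (hC : nn ψ C = 1) : nn φ C = 1 := by
  rw [h, ← nn_nn, hC, map_one]
lemma nat1 (x : H ⊠ H) : Algebra.TensorProduct.map (DelD (H := H)) (AlgHom.id ℂ (DD H)) (Algebra.TensorProduct.map iD iD x) =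
    Algebra.TensorProduct.map (Algebra.TensorProduct.map (iD (H := H)) (iD (H := H))) (iD (H := H)) (LinearMap.rTensor H Δ x) := by
  induction x using TI with
  | zero => simp
  | tmul x y => simp [DelD_iD]
  | add x y hx hy => simp only [map_add, hx, hy]
lemma nat2 (x : H ⊠ H) : Algebra.TensorProduct.map (AlgHom.id ℂ (DD H)) (DelD (H := H)) (Algebra.TensorProduct.map iD iD x) =
    Algebra.TensorProduct.map (iD (H := H)) (Algebra.TensorProduct.map (iD (H := H)) (iD (H := H))) (LinearMap.lTensor H Δ x) := by
  induction x using TI with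
  | zero => simp
  | tmul x y => simp [DelD_iD]
  | add x y hx hy => simp only [map_add, hx, hy]
lemma nat3 (φ : A ⇝ B) (x : (A ⊠ A) ⊠ A) : (Algebra.TensorProduct.assoc ℂ ℂ ℂ B B B) (Algebra.TensorProduct.map (Algebra.TensorProduct.map φ φ) φ x) =
    Algebra.TensorProduct.map φ (Algebra.TensorProduct.map φ φ) (TensorProduct.assoc ℂ A A A x) := by
  induction x using TI with
  | zero => simp
  | tmul x y => 
    induction x using TI with
    | zero => simp
    | tmul => simp
    | add x y hx hy => simp only [map_add, TensorProduct.add_tmul, hx, hy]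
  | add x y hx hy => simp only [map_add, hx, hy]
lemma nat4 (x : H ⊠ H) : Algebra.TensorProduct.map epsD (AlgHom.id ℂ (DD H)) (Algebra.TensorProduct.map iD iD x) =
    Algebra.TensorProduct.map (AlgHom.id ℂ ℂ) iD (LinearMap.rTensor H (counit (R := ℂ)) x) := by
  induction x using TI with
  | zero => simp
  | tmul x y => simp
  | add x y hx hy => simp only [map_add, hx, hy]
lemma nat5 (x : H ⊠ H) : Algebra.TensorProduct.map (AlgHom.id ℂ (DD H)) epsD (Algebra.TensorProduct.map iD iD x) =
    Algebra.TensorProduct.map iD (AlgHom.id ℂ ℂ) (LinearMap.lTensor H (counit (R := ℂ)) x) := by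
  induction x using TI with
  | zero => simp
  | tmul x y => simp
  | add x y hx hy => simp only [map_add, hx, hy]
noncomputable instance : Bialgebra ℂ (DD H) := Bialgebra.ofAlgHom DelD epsD
  (by
    refine D_ext' (fun h => ?_) ?_
    · simp only [AlgHom.comp_apply, DelD_iD, nat1, nat2]
      refine (nat3 iD _).trans ?_
      rw [Coalgebra.coassoc_apply]
    · rw [← nn_eq, ← nn_eq, ← nn_nn, ← nn_nn, ← nn_nn, DelD_CD, map_mul, map_mul, map_mul]
      simp only [nn_nn, AlgHom.comp_assoc]
      rw [show (Algebra.TensorProduct.map (DelD (H := H)) (AlgHom.id ℂ (DD H))).comp (nL (A := DD H) (B := DD H)) = nL.comp DelD by ext x; simp,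
        show (Algebra.TensorProduct.map (AlgHom.id ℂ (DD H)) (DelD (H := H))).comp (nR (A := DD H) (B := DD H)) = nR.comp DelD by ext x; simp]
      rw [← AlgHom.comp_assoc, ← nn_nn DelD, DelD_CD, ← nn_nn DelD, DelD_CD]
      simp only [map_mul]
      simp only [nn_nn, mul_assoc]
      refine congrArg₂ (· * ·) ?_ (congrArg₂ (· * ·) ?_ ?_)
      · congr 2; ext x; simp [Algebra.TensorProduct.one_def]
      · congr 2
      · congr 2; ext x; simp [Algebra.TensorProduct.one_def])
  (by
    refine D_ext' (fun h => ?_) ?_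
    · simp only [AlgHom.comp_apply, DelD_iD, nat4, Coalgebra.rTensor_counit_comul]
      simp
    · rw [← nn_eq, ← nn_eq, ← nn_nn, DelD_CD, map_mul, nn_nn, nn_nn]
      rw [nn_ofId _ epsD ?_ CD epsD_CD, one_mul]
      · congr 2; ext x; simp
      · ext x; simp)
  (by
    refine D_ext' (fun h => ?_) ?_
    · simp only [AlgHom.comp_apply, DelD_iD, nat5, Coalgebra.lTensor_counit_comul]
      simp
    · rw [← nn_eq, ← nn_eq, ← nn_nn, DelD_CD, map_mul, nn_nn, nn_nn]
      rw [nn_ofId ((Algebra.TensorProduct.map (AlgHom.id ℂ (DD H)) epsD).comp nR) epsD ?_ CD epsD_CD, mul_one]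
      · congr 2; ext x; simp
      · ext x; simp [Algebra.ofId_apply, Algebra.TensorProduct.one_def, Algebra.algebraMap_eq_smul_one]; rw [← TensorProduct.tmul_smul]; simp)
end dbl
end HopfLR
end
section
open Coalgebra TensorProduct WithConv HopfAlgebra
namespace HopfLR
set_option linter.unusedSectionVars false
class SI (H : Type*) [Ring H] [HopfAlgebra ℂ H] : Prop where
  h2 : ∀ x : H, S (S x) = x
section dbl3
variable {H : Type*} [Ring H] [HopfAlgebra ℂ H] [FiniteDimensional ℂ H]
variable {A : Type*} [Ring A] [Algebra ℂ A]
noncomputable def opL : A ⇾ Aᵐᵒᵖ := (MulOpposite.opLinearEquiv ℂ).toLinearMap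
@[simp] lemma opL_apply (a : A) : opL a = MulOpposite.op a := rfl
lemma anti_ext {K E : Type*} [Ring K] [Algebra ℂ K] [Ring E] [Algebra ℂ E] (Θ : A ⊠ K ⇾ E)
   (h : ∀ a k b l, Θ ((a ⊗ₜ k) * (b ⊗ₜ l)) = Θ (b ⊗ₜ l) * Θ (a ⊗ₜ k)) (x y : A ⊠ K) : Θ (x * y) = Θ y * Θ x := by
  induction x using TI with
  | zero => simp
  | tmul x y' =>
    induction y using TI with
    | zero => simp
    | tmul x' y' => exact h _ _ _ _
    | add x y hx hy => simp only [map_add, mul_add, add_mul, hx, hy]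
  | add x y hx hy => simp only [map_add, mul_add, add_mul, hx, hy]
noncomputable def Th : A ⊠ H ⇾ Aᵐᵒᵖ ⊠ H := TensorProduct.map opL S
noncomputable def Th2 : A ⊠ (H ⊠ H) ⇾ Aᵐᵒᵖ ⊠ (H ⊠ H) :=
  TensorProduct.map opL (TensorProduct.map S S ∘ₗ (TensorProduct.comm ℂ H H).toLinearMap)
lemma Th_mul (x y : A ⊠ H) : Th (x * y) = Th y * Th x := by
  apply anti_ext
  intro a k b l
  simp [Th, S_mul]
lemma SSc_mul (x y : H ⊠ H) : (TensorProduct.map S S ∘ₗ (TensorProduct.comm ℂ H H).toLinearMap) (x * y) =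
   (TensorProduct.map S S ∘ₗ (TensorProduct.comm ℂ H H).toLinearMap) y *  (TensorProduct.map S S ∘ₗ (TensorProduct.comm ℂ H H).toLinearMap) x := by
  apply anti_ext
  intro a k b l
  simp [S_mul]
lemma Th2_mul (x y : A ⊠ (H ⊠ H)) : Th2 (x * y) = Th2 y * Th2 x := by
  apply anti_ext
  intro a k b l
  rw [Algebra.TensorProduct.tmul_mul_tmul]
  simp only [Th2, TensorProduct.map_tmul, SSc_mul]
  simp
lemma Th2_l12 (x : A ⊠ H) : Th2 (l12 x) = l13 (Th x) := by
  induction x using TI with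
  | zero => simp
  | tmul => simp [Th2, Th]
  | add x y hx hy => simp only [map_add, hx, hy]
lemma Th2_l13 (x : A ⊠ H) : Th2 (l13 x) = l12 (Th x) := by
  induction x using TI with
  | zero => simp
  | tmul => simp [Th2, Th]
  | add x y hx hy => simp only [map_add, hx, hy]
lemma Th2_lT (x : A ⊠ H) : Th2 (LinearMap.lTensor A Δ x) = LinearMap.lTensor _ Δ (Th x) := by
  induction x using TI with
  | zero => simp
  | tmul a b =>
    have := LinearMap.congr_fun (comul_S (H := H)) b
    simp only [LinearMap.comp_apply] at this
    simp [Th2, Th, this]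
  | add x y hx hy => simp only [map_add, hx, hy]
noncomputable def iS (i : H ⇝ A) : H ⇝ Aᵐᵒᵖ := AlgHom.ofLinearMap (opL ∘ₗ i.toLinearMap ∘ₗ S)
  (by simp) (by intro x y; simp [S_mul])
lemma iS_apply (i : H ⇝ A) (h : H) : iS i h = MulOpposite.op (i (S h)) := rfl
variable [SI H]
lemma Th_map (i : H ⇝ A) (x : H ⊠ H) : Th (TensorProduct.map i.toLinearMap LinearMap.id (TensorProduct.map S S x)) =
    TensorProduct.map (iS i).toLinearMap LinearMap.id x := by
  induction x using TI with
  | zero => simp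
  | tmul => simp [Th, SI.h2, iS_apply]
  | add x y hx hy => simp only [map_add, hx, hy]
lemma DRep.op {i : H ⇝ A} {C : A ⊠ H} (d : DRep i C) : DRep (iS i) (Th C) where
  c1 := by
    rw [Th, sl_map]
    have : (counit (R := ℂ) (A := H)) ∘ₗ S = counit := by ext; simp
    rw [this, d.c1]; simp
  c2 := by rw [← Th2_lT, d.c2, Th2_mul, Th2_l12, Th2_l13]
  c3 := by
    rw [c3_iff]
    intro h
    have := congrArg Th ((c3_iff i C).1 d.c3 (S h))
    have e := LinearMap.congr_fun (comul_S (H := H)) h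
    simp only [LinearMap.comp_apply, LinearEquiv.coe_coe] at e
    rw [Th_mul, Th_mul, e, Th_map, ← TensorProduct.map_comm, Th_map, TensorProduct.comm_comm] at this
    exact this.symm
variable (H) in
lemma exists_SD : ∃ φ : DD H ⇝ (DD H)ᵐᵒᵖ, (∀ h, φ (iD h) = iS iD h) ∧ nn φ (CD (H := H)) = Th CD :=
  (DRep.op DRep_D).lift
noncomputable def SD : DD H ⇾ DD H := (MulOpposite.opLinearEquiv ℂ).symm.toLinearMap ∘ₗ (exists_SD H).choose.toLinearMap
lemma SD_mul (x y : DD H) : SD (x * y) = SD y * SD x := by simp [SD]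
@[simp] lemma SD_one : SD (1 : DD H) = 1 := by simp [SD]
lemma SD_iD (h : H) : SD (iD h) = iD (S h) :=
  congrArg MulOpposite.unop ((exists_SD H).choose_spec.1 h)
lemma SD_CD : TensorProduct.map SD LinearMap.id (CD (H := H)) = LinearMap.lTensor _ S CD := by
  have h0 := (exists_SD H).choose_spec.2
  have := congrArg (TensorProduct.map ((MulOpposite.opLinearEquiv ℂ).symm.toLinearMap : (DD H)ᵐᵒᵖ ⇾ DD H) (LinearMap.id : H ⇾ H)) h0
  unfold Th at this
  rw [nn_eq, ← LinearMap.comp_apply, ← LinearMap.comp_apply, ← TensorProduct.map_comp, ← TensorProduct.map_comp] at this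
  exact this
lemma SD_jD (f : H ⇾ ℂ) : SD (jD f) = jD (f ∘ₗ S) := by
  have := congrArg (sl f) (SD_CD (H := H))
  rw [sl_map, LinearMap.lTensor, sl_map, LinearMap.comp_id, sl_CD, sl_CD] at this
  exact this
lemma SD_SD (x : DD H) : SD (SD x) = x := by
  induction x using D_ind with
  | h0 c => simp [Algebra.algebraMap_eq_smul_one]
  | hi h => simp [SD_iD, SI.h2]
  | hj f => simp only [SD_jD]; congr 1; ext; simp [SI.h2]
  | hadd x y hx hy => simp [hx, hy]
  | hmul x y hx hy => simp [SD_mul, hx, hy]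
lemma x2Sx1 (x : H) : ∑ i ∈ (ℛ ℂ x).index, (ℛ ℂ x).right i * S ((ℛ ℂ x).left i) = counit (R := ℂ) x • 1 := by
  have := congrArg S (id_conv_S x)
  simpa [S_mul, SI.h2] using this
lemma Sx2x1 (x : H) : ∑ i ∈ (ℛ ℂ x).index, S ((ℛ ℂ x).right i) * ((ℛ ℂ x).left i) = counit (R := ℂ) x • 1 := by
  have := congrArg S (S_conv_id x)
  simpa [S_mul, SI.h2] using this
noncomputable def mC : H ⊠ H ⇾ H := LinearMap.mul' ℂ H ∘ₗ (TensorProduct.comm ℂ H H).toLinearMap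
lemma mC_ll (f g : H ⇾ H) (x y : A ⊠ H) : TensorProduct.map (LinearMap.id (M := A)) (mC ∘ₗ TensorProduct.map f g) (l13 x * l12 y) =
    LinearMap.lTensor A g x * LinearMap.lTensor A f y := by
  induction x using TI with
  | zero => simp
  | tmul x y' =>
    induction y using TI with
    | zero => simp
    | tmul x' y' => simp [mC]
    | add x y hx hy => simp only [map_add, mul_add, hx, hy]
  | add x y hx hy => simp only [map_add, add_mul, hx, hy]
lemma map_eta {K : Type*} [Ring K] [Algebra ℂ K] (f : H ⇾ ℂ) (C : A ⊠ H) :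
    TensorProduct.map (LinearMap.id (M := A)) (Algebra.linearMap ℂ K ∘ₗ f) C = sl f C ⊗ₜ 1 := by
  induction C using TI with
  | zero => simp
  | tmul x y => simp [Algebra.algebraMap_eq_smul_one, TensorProduct.smul_tmul]
  | add x y hx hy => simp only [map_add, hx, hy, TensorProduct.add_tmul]
lemma C_inv1 {i : H ⇝ A} {C : A ⊠ H} (d : DRep i C) : C * LinearMap.lTensor A S C = 1 := by
  have := mC_ll (A := A) S LinearMap.id C C
  rw [← d.c2, LinearMap.lTensor_id] at this
  refine this.symm.trans ?_
  rw [LinearMap.lTensor, ← LinearMap.comp_apply, ← TensorProduct.map_comp]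
  have e : (mC ∘ₗ TensorProduct.map S LinearMap.id) ∘ₗ Δ = (Algebra.linearMap ℂ H) ∘ₗ counit := by
    ext x
    simp only [LinearMap.comp_apply]
    conv_lhs => rw [← (ℛ ℂ x).eq]
    simp only [map_sum]
    simpa [mC, Algebra.algebraMap_eq_smul_one] using x2Sx1 x
  rw [e, LinearMap.id_comp, map_eta, d.c1]; rfl
lemma C_inv2 {i : H ⇝ A} {C : A ⊠ H} (d : DRep i C) : LinearMap.lTensor A S C * C = 1 := by
  have := mC_ll (A := A) LinearMap.id S C C
  rw [← d.c2, LinearMap.lTensor_id] at this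
  refine this.symm.trans ?_
  rw [LinearMap.lTensor, ← LinearMap.comp_apply, ← TensorProduct.map_comp]
  have e : (mC ∘ₗ TensorProduct.map LinearMap.id S) ∘ₗ Δ = (Algebra.linearMap ℂ H) ∘ₗ counit := by
    ext x
    simp only [LinearMap.comp_apply]
    conv_lhs => rw [← (ℛ ℂ x).eq]
    simp only [map_sum]
    simpa [mC, Algebra.algebraMap_eq_smul_one] using Sx2x1 x
  rw [e, LinearMap.id_comp, map_eta, d.c1]; rfl
noncomputable def mSl : DD H ⊠ DD H ⇾ DD H := LinearMap.mul' ℂ _ ∘ₗ LinearMap.rTensor _ SD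
noncomputable def mSr : DD H ⊠ DD H ⇾ DD H := LinearMap.mul' ℂ _ ∘ₗ LinearMap.lTensor _ SD
lemma mSl_mul (x : DD H ⊠ DD H) (a b : DD H) : mSl (x * (a ⊗ₜ b)) = SD a * mSl x * b := by
  induction x using TI with
  | zero => simp
  | tmul x y => simp [mSl, SD_mul, mul_assoc]
  | add x y hx hy => simp only [map_add, hx, hy, add_mul, mul_add]
lemma mSr_mul (x : DD H ⊠ DD H) (a b : DD H) : mSr ((a ⊗ₜ b) * x) = a * mSr x * SD b := by
  induction x using TI with
  | zero => simp
  | tmul x y => simp [mSr, SD_mul, mul_assoc]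
  | add x y hx hy => simp only [map_add, hx, hy, add_mul, mul_add]
lemma mSl_mul' (c : ℂ) (x y : DD H ⊠ DD H) (h : mSl x = c • 1) : mSl (x * y) = c • mSl y := by
  induction y using TI with
  | zero => simp
  | tmul a b => rw [mSl_mul, h]; simp [mSl]
  | add x y hx hy => simp only [map_add, hx, hy, mul_add, smul_add]
lemma mSr_mul' (c : ℂ) (x y : DD H ⊠ DD H) (h : mSr x = c • 1) : mSr (y * x) = c • mSr y := by
  induction y using TI with
  | zero => simp
  | tmul a b => rw [mSr_mul, h]; simp [mSr]
  | add x y hx hy => simp only [map_add, hx, hy, add_mul, smul_add]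
lemma mSl_LR (x y : DD H ⊠ H) : TensorProduct.map mSl LinearMap.id (nn nL x * nn nR y) = TensorProduct.map SD LinearMap.id x * y := by
  induction x using TI with
  | zero => simp
  | tmul x y' =>
    induction y using TI with
    | zero => simp
    | tmul x' y' => simp [mSl]
    | add x y hx hy => simp only [map_add, mul_add, hx, hy]
  | add x y hx hy => simp only [map_add, add_mul, hx, hy]
lemma mSr_LR (x y : DD H ⊠ H) : TensorProduct.map mSr LinearMap.id (nn nL x * nn nR y) = x * TensorProduct.map SD LinearMap.id y := by
  induction x using TI with
  | zero => simp
  | tmul x y' =>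
    induction y using TI with
    | zero => simp
    | tmul x' y' => simp [mSr]
    | add x y hx hy => simp only [map_add, mul_add, hx, hy]
  | add x y hx hy => simp only [map_add, add_mul, hx, hy]
lemma epsD_jD (f : H ⇾ ℂ) : epsD (jD f) = f 1 := by
  have := congrArg (sl f) (epsD_CD (H := H))
  rw [nn_eq, sl_map, LinearMap.comp_id, sl_CD, Algebra.TensorProduct.one_def] at this
  simpa using this
lemma DelD_jD (f : H ⇾ ℂ) : DelD (jD f) = sl f (nn nL CD * nn nR CD) := by
  rw [← DelD_CD, nn_eq, sl_map, LinearMap.comp_id, sl_CD]; rfl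
lemma mSl_Del (x : DD H) : mSl (DelD x) = epsD x • 1 := by
  induction x using D_ind with
  | h0 c => simp [Algebra.algebraMap_eq_smul_one, mSl, Algebra.TensorProduct.one_def]
  | hi h =>
    rw [DelD_iD, ← (ℛ ℂ h).eq]
    have := congrArg iD (S_conv_id h)
    simpa [mSl, SD_iD] using this
  | hj f =>
    have := sl_map mSl (LinearMap.id : H ⇾ H) f (nn nL CD * nn nR CD)
    rw [LinearMap.comp_id, ← DelD_jD, mSl_LR, SD_CD, C_inv2 DRep_D] at this
    rw [← this, epsD_jD, Algebra.TensorProduct.one_def]; simp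
  | hadd x y hx hy => simp [hx, hy, add_smul]
  | hmul x y hx hy => rw [map_mul, mSl_mul' _ _ _ hx, hy, map_mul, smul_smul]
lemma mSr_Del (x : DD H) : mSr (DelD x) = epsD x • 1 := by
  induction x using D_ind with
  | h0 c => simp [Algebra.algebraMap_eq_smul_one, mSr, Algebra.TensorProduct.one_def]
  | hi h =>
    rw [DelD_iD, ← (ℛ ℂ h).eq]
    have := congrArg iD (id_conv_S h)
    simpa [mSr, SD_iD] using this
  | hj f =>
    have := sl_map mSr (LinearMap.id : H ⇾ H) f (nn nL CD * nn nR CD)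
    rw [LinearMap.comp_id, ← DelD_jD, mSr_LR, SD_CD, C_inv1 DRep_D] at this
    rw [← this, epsD_jD, Algebra.TensorProduct.one_def]; simp
  | hadd x y hx hy => simp [hx, hy, add_smul]
  | hmul x y hx hy => rw [map_mul, mSr_mul' _ _ _ hy, hx, map_mul, smul_smul, mul_comm]
noncomputable instance : HopfAlgebra ℂ (DD H) where
  antipode := SD
  mul_antipode_rTensor_comul := by
    ext x
    refine (mSl_Del x).trans ?_
    exact (Algebra.algebraMap_eq_smul_one _).symm
  mul_antipode_lTensor_comul := by
    ext x
    refine (mSr_Del x).trans ?_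
    exact (Algebra.algebraMap_eq_smul_one _).symm
instance : SI (DD H) := ⟨SD_SD⟩
end dbl3
end HopfLR
end
section
open Coalgebra TensorProduct WithConv HopfAlgebra
namespace HopfLR
set_option linter.unusedSectionVars false
section gen
variable {K : Type*} [Ring K] [HopfAlgebra ℂ K]
def Integ.ofLeft (Λ : K) (left : ∀ x, x * Λ = counit (R := ℂ) x • Λ) (eps : counit (R := ℂ) Λ = 1) [SI K] : Integ K := by
  have hr : ∀ x, S Λ * x = counit (R := ℂ) x • S Λ := by
    intro x
    have := congrArg S (left (S x))
    rw [S_mul, SI.h2, map_smul, eps_S] at this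
    exact this
  have e : S Λ = Λ := by
    have h1 := hr Λ
    have h2 := left (S Λ)
    rw [eps, one_smul] at h1
    rw [eps_S, eps, one_smul, h1] at h2
    exact h2
  rw [e] at hr
  exact ⟨Λ, left, hr, eps⟩
lemma lam_reg [FiniteDimensional ℂ K] [SI K] : lam (H := K) = reg := by
  ext x
  rw [lam_apply, reg_apply]
  congr 1; ext y; simp [SI.h2]
lemma Integ.semisimple [FiniteDimensional ℂ K] [SI K] (I : Integ K) : IsSemisimpleRing K := by
  haveI : IsArtinianRing K := IsArtinianRing.of_finite ℂ K
  rw [IsArtinianRing.isSemisimpleRing_iff_jacobson, eq_bot_iff]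
  intro h hh
  refine I.nondeg fun x => ?_
  obtain ⟨n, hn⟩ := IsArtinianRing.isNilpotent_jacobson_bot (R := K)
  have hx : x * h ∈ (⊥ : Ideal K).jacobson := by
    rw [Ideal.jacobson_bot]
    exact Ideal.mul_mem_left _ _ hh
  have h1 : (x * h) ^ n = 0 := by
    have := Ideal.pow_mem_pow hx n
    rw [hn] at this
    exact this
  rw [lam_reg, reg_apply]
  refine (LinearMap.isNilpotent_trace_of_isNilpotent ⟨n, ?_⟩).eq_zero
  have := map_pow (Algebra.lmul ℂ K) (x * h) n
  rw [h1, map_zero] at this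
  exact this.symm
end gen
section dbl4
variable {H : Type*} [Ring H] [HopfAlgebra ℂ H] [FiniteDimensional ℂ H] 
lemma iC (h : H) : inL (iD h) * CD = ∑ i ∈ (ℛ ℂ h).index, inR (S ((ℛ ℂ h).left i)) * (CD * TensorProduct.map iD.toLinearMap LinearMap.id (Δ ((ℛ ℂ h).right i))) := by
  have e := (DRep_D (H := H)).c3
  have b := S_alg (inR (A := DD H) (H := H))
  have : (toConv (inL.toLinearMap ∘ₗ iD.toLinearMap) : WithConv (H ⇾ DD H ⊠ H)) * toConv (cst CD) = 
     toConv ((inR (A := DD H)).toLinearMap ∘ₗ S) * (toConv (cst CD) * (toConv (inL.toLinearMap ∘ₗ iD.toLinearMap) * toConv inR.toLinearMap)) := by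
    rw [e]
    rw [← mul_assoc, ← mul_assoc, b, one_mul]
  have := congrArg (fun F : WithConv (H ⇾ DD H ⊠ H) => F h) this
  rw [mul_cst', (ℛ ℂ h).convMul_apply] at this
  refine this.trans (Finset.sum_congr rfl fun i _ => ?_)
  rw [cst_mul', ab_apply]
  rfl
lemma sl_inR_mul {A : Type*} [Ring A] [Algebra ℂ A] (f : H ⇾ ℂ) (b : H) (X : A ⊠ H) :
    sl f (inR b * X) = sl (f ∘ₗ LinearMap.mulLeft ℂ b) X := by
  have := sl_tmul_mul f X 1 b
  rw [one_mul] at this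
  exact this
lemma ij (h : H) (f : H ⇾ ℂ) : iD h * jD f = ∑ i ∈ (ℛ ℂ h).index, 
    sl (f ∘ₗ LinearMap.mulLeft ℂ (S ((ℛ ℂ h).left i))) (CD * TensorProduct.map iD.toLinearMap LinearMap.id (Δ ((ℛ ℂ h).right i))) := by
  have := congrArg (sl f) (iC h)
  rw [map_sum] at this
  simp only [sl_inR_mul] at this
  rw [← this]
  have := sl_tmul_mul f CD (iD h) (1 : H)
  refine Eq.trans ?_ this.symm
  rw [LinearMap.mulLeft_one, LinearMap.comp_id, sl_CD]
variable (H) in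
noncomputable def muD : (H ⇾ ℂ) ⊠ H ⇾ DD H := LinearMap.mul' ℂ _ ∘ₗ TensorProduct.map jD iD.toLinearMap
lemma ji_mem (f : H ⇾ ℂ) (h : H) : jD f * iD h ∈ LinearMap.range (muD H) := ⟨f ⊗ₜ h, rfl⟩
lemma sl_mem (f : H ⇾ ℂ) (T : H ⊠ H) (k : H) : sl f (CD * TensorProduct.map iD.toLinearMap LinearMap.id T) * iD k ∈ LinearMap.range (muD H) := by
  induction T using TI with
  | zero => simp
  | tmul a b =>
    rw [TensorProduct.map_tmul, sl_mul_tmul, sl_CD, mul_assoc]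
    have := ji_mem (f ∘ₗ LinearMap.mulRight ℂ b) (a * k)
    rw [map_mul] at this
    exact this
  | add x y hx hy => simp only [map_add, mul_add, add_mul]; exact add_mem hx hy
lemma mul_mem_range (x y : DD H) (hy : y ∈ LinearMap.range (muD H)) : x * y ∈ LinearMap.range (muD H) := by
  induction x using D_ind generalizing y with
  | h0 c => rw [← Algebra.smul_def]; exact Submodule.smul_mem _ _ hy
  | hi h =>
    obtain ⟨T, rfl⟩ := hy
    induction T using TI with
    | zero => simp
    | tmul f k =>
      change iD h * (jD f * iD k) ∈ _
      rw [← mul_assoc, ij, Finset.sum_mul]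
      exact sum_mem fun i _ => sl_mem _ _ _
    | add x y hx hy => simp only [map_add, mul_add]; exact add_mem hx hy
  | hj g =>
    obtain ⟨T, rfl⟩ := hy
    induction T using TI with
    | zero => simp
    | tmul f k =>
      change jD g * (jD f * iD k) ∈ _
      rw [← mul_assoc, ← jD_mul]
      exact ji_mem _ _
    | add x y hx hy => simp only [map_add, mul_add]; exact add_mem hx hy
  | hadd a b ha hb => rw [add_mul]; exact add_mem (ha _ hy) (hb _ hy)
  | hmul a b ha hb => rw [mul_assoc]; exact ha _ (hb _ hy)
lemma muD_surj : Function.Surjective (muD H) := by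
  intro x
  have := mul_mem_range x 1 (by
    have := ji_mem (H := H) counit 1
    rwa [jD_one, map_one, one_mul] at this)
  rwa [mul_one] at this
instance : FiniteDimensional ℂ (DD H) := Module.Finite.of_surjective (muD H) muD_surj
lemma iL (I : Integ H) (T : H ⊠ H) : TensorProduct.map iD.toLinearMap LinearMap.id T * (iD I.Λ ⊗ₜ 1) = iD I.Λ ⊗ₜ cL counit T := by
  induction T using TI with
  | zero => simp
  | tmul a b =>
    simp [← map_mul, I.left, cL_tmul]
    rw [TensorProduct.smul_tmul']
  | add x y hx hy => simp only [map_add, hx, hy, add_mul, TensorProduct.tmul_add]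
lemma cL_counit (h : H) : cL (counit (R := ℂ)) (Δ h) = h := by
  rw [← (ℛ ℂ h).eq]
  simp only [map_sum, cL_tmul]
  exact sum_counit_smul (R := ℂ) (ℛ ℂ h)
lemma ijL (I : Integ H) (h : H) (f : H ⇾ ℂ) : iD h * (jD f * iD I.Λ) = ∑ i ∈ (ℛ ℂ h).index, 
    jD (f ∘ₗ LinearMap.mulLeft ℂ (S ((ℛ ℂ h).left i)) ∘ₗ LinearMap.mulRight ℂ ((ℛ ℂ h).right i)) * iD I.Λ := by
  rw [← mul_assoc, ij, Finset.sum_mul]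
  refine Finset.sum_congr rfl fun i _ => ?_
  have := sl_mul_tmul (f ∘ₗ LinearMap.mulLeft ℂ (S ((ℛ ℂ h).left i))) (CD * TensorProduct.map iD.toLinearMap LinearMap.id (Δ ((ℛ ℂ h).right i))) (iD I.Λ) 1
  rw [LinearMap.mulRight_one, LinearMap.comp_id] at this
  rw [← this, mul_assoc, iL, cL_counit, sl_mul_tmul, sl_CD]
  rfl
variable [SI H]
lemma lam_cL (I : Integ H) (W : Wedd.Wed H) (h : H) : cL lam (Δ h) = lam h • 1 := by
  have := I.rho_int h
  have e : Integ.rho (H := H) = lam := by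
    ext x
    rw [Integ.rho_apply, lam_reg, reg_S W SI.h2]
  rwa [e] at this
lemma lam_conv (I : Integ H) (W : Wedd.Wed H) (g : H ⇾ ℂ) : (toConv lam * toConv g).ofConv = g 1 • lam := by
  ext h
  change (toConv lam * toConv g : WithConv (H ⇾ ℂ)) h = _
  rw [conv_cL, lam_cL I W, map_smul]; simp [mul_comm]
lemma lam_i (h : H) : ∑ i ∈ (ℛ ℂ h).index, lam ∘ₗ LinearMap.mulLeft ℂ (S ((ℛ ℂ h).left i)) ∘ₗ LinearMap.mulRight ℂ ((ℛ ℂ h).right i) = counit (R := ℂ) h • lam := by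
  ext x
  have : ∀ i, lam (S ((ℛ ℂ h).left i) * (x * (ℛ ℂ h).right i)) = lam (x * ((ℛ ℂ h).right i * S ((ℛ ℂ h).left i))) := by
    intro i
    rw [lam_comm, SI.h2, mul_assoc]
  simp only [LinearMap.sum_apply, LinearMap.comp_apply, LinearMap.mulLeft_apply, LinearMap.mulRight_apply, this]
  rw [← map_sum, ← Finset.mul_sum, x2Sx1]; simp
noncomputable def IntD (I : Integ H) (W : Wedd.Wed H) : Integ (DD H) := by
  have h1 : lam (1 : H) = Module.finrank ℂ H := by
    rw [lam_reg, reg_apply, LinearMap.mulLeft_one, LinearMap.trace_id]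
  have h0 : (Module.finrank ℂ H : ℂ) ≠ 0 := by
    haveI : Nontrivial H := ⟨⟨I.Λ, 0, fun h => by have := I.eps; rw [h] at this; simp at this⟩⟩
    exact_mod_cast Module.finrank_pos.ne'
  refine Integ.ofLeft ((Module.finrank ℂ H : ℂ)⁻¹ • (jD lam * iD I.Λ)) (fun x => ?_) ?_
  · rw [mul_smul_comm, smul_comm]
    congr 1
    change _ = epsD x • _
    induction x using D_ind with
    | h0 c => simp [Algebra.algebraMap_eq_smul_one]
    | hi h => rw [ijL, ← Finset.sum_mul, ← map_sum, lam_i, map_smul, epsD_iD, smul_mul_assoc]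
    | hj g => rw [← mul_assoc, ← jD_mul, lam_conv I W, map_smul, epsD_jD, smul_mul_assoc]
    | hadd a b ha hb => rw [add_mul, ha, hb, map_add, add_smul]
    | hmul a b ha hb => rw [mul_assoc, hb, mul_smul_comm, ha, map_mul, smul_smul, mul_comm]
  · change epsD _ = 1
    rw [map_smul, map_mul, epsD_jD, epsD_iD, I.eps, h1]
    simp [h0]
end dbl4
end HopfLR
end
section
open Coalgebra TensorProduct WithConv HopfAlgebra
namespace HopfLR
set_option linter.unusedSectionVars false
section dbl5
variable {H : Type*} [Ring H] [HopfAlgebra ℂ H] [FiniteDimensional ℂ H]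
variable {A B : Type*} [Ring A] [Algebra ℂ A] [Ring B] [Algebra ℂ B]
noncomputable abbrev ri : A ⊠ H ⇝ A ⊠ DD H := Algebra.TensorProduct.map (AlgHom.id ℂ A) iD
variable (H) in
noncomputable def RR : DD H ⊠ DD H := ri CD
variable (H) in
noncomputable abbrev tw : DD H ⊠ DD H ⇝ DD H ⊠ DD H := (Algebra.TensorProduct.comm ℂ (DD H) (DD H)).toAlgHom
noncomputable abbrev PP : A ⊠ (H ⊠ H) ⇝ A ⊠ (DD H ⊠ H) :=
  Algebra.TensorProduct.map (AlgHom.id ℂ A) (Algebra.TensorProduct.map iD (AlgHom.id ℂ H))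
noncomputable abbrev cc : A ⊠ (H ⊠ H) ⇝ A ⊠ (H ⊠ H) :=
  Algebra.TensorProduct.map (AlgHom.id ℂ A) (Algebra.TensorProduct.comm ℂ H H).toAlgHom
lemma YB1 (X : A ⊠ H) : nR (A := A) (CD (H := H)) * PP (LinearMap.lTensor A Δ X) = PP (cc (LinearMap.lTensor A Δ X)) * nR CD := by
  induction X using TI with
  | zero => simp
  | tmul a h =>
    have := (c3_iff iD CD).1 (DRep_D (H := H)).c3 h
    have := congrArg (fun T => a ⊗ₜ[ℂ] T) this
    simp only [LinearMap.lTensor_tmul, Algebra.TensorProduct.map_tmul, Algebra.TensorProduct.includeRight_apply, Algebra.TensorProduct.tmul_mul_tmul, AlgHom.id_apply,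
      one_mul, mul_one]
    exact this
  | add x y hx hy => simp only [map_add, mul_add, add_mul, hx, hy]
lemma cc_l12 (X : A ⊠ H) : cc (l12 X) = l13 X := by
  induction X using TI with
  | zero => simp
  | tmul a h => simp
  | add x y hx hy => simp only [map_add, hx, hy]
lemma cc_l13 (X : A ⊠ H) : cc (l13 X) = l12 X := by
  induction X using TI with
  | zero => simp
  | tmul a h => simp
  | add x y hx hy => simp only [map_add, hx, hy]
variable (H) in
noncomputable abbrev as' : DD H ⊠ (DD H ⊠ H) ⇝ (DD H ⊠ DD H) ⊠ H :=
  (Algebra.TensorProduct.assoc ℂ ℂ ℂ (DD H) (DD H) H).symm.toAlgHom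
lemma as_nR (X : DD H ⊠ H) : as' H (nR X) = nn nR X := by
  induction X using TI with
  | zero => simp
  | tmul a h => simp
  | add x y hx hy => simp only [map_add, hx, hy]
lemma as_l13 (X : DD H ⊠ H) : as' H (PP (l13 X)) = nn nL X := by
  induction X using TI with
  | zero => simp
  | tmul a h => simp
  | add x y hx hy => simp only [map_add, hx, hy]
lemma as_l12 (X : DD H ⊠ H) : as' H (PP (l12 X)) = inL (ri X) := by
  induction X using TI with
  | zero => simp
  | tmul a h => simp [Algebra.TensorProduct.one_def]
  | add x y hx hy => simp only [map_add, hx, hy]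
variable (H) in
lemma YB2 : nn nR CD * (nn nL CD * inL (RR H)) = (inL (RR H) * nn nL CD) * nn nR (CD (H := H)) := by
  have := congrArg (as' H) (YB1 (H := H) CD)
  rw [(DRep_D (H := H)).c2, map_mul, map_mul, map_mul, map_mul, map_mul, map_mul, map_mul, cc_l12, cc_l13, as_nR, as_l12, as_l13] at this
  exact this
lemma sl_inL_mul (f : H ⇾ ℂ) (a : A) (X : A ⊠ H) : sl f (inL a * X) = a * sl f X := by
  have := sl_tmul_mul f X a 1
  rwa [LinearMap.mulLeft_one, LinearMap.comp_id] at this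
lemma sl_mul_inL (f : H ⇾ ℂ) (a : A) (X : A ⊠ H) : sl f (X * inL a) = sl f X * a := by
  have := sl_mul_tmul f X a 1
  rwa [LinearMap.mulRight_one, LinearMap.comp_id] at this
lemma RDel (x : DD H) : RR H * DelD x = tw H (DelD x) * RR H := by
  induction x using D_ind with
  | h0 c => simp [Algebra.algebraMap_eq_smul_one]
  | hi h =>
    have := congrArg ri ((c3_iff iD CD).1 (DRep_D (H := H)).c3 h)
    rw [map_mul, map_mul] at this
    rw [DelD_iD]
    have e : ∀ T : H ⊠ H, ri (TensorProduct.map (iD (H := H)).toLinearMap (LinearMap.id (M := H)) T) = Algebra.TensorProduct.map (iD (H := H)) (iD (H := H)) T := by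
      intro T
      induction T using TI with
      | zero => simp
      | tmul a h => simp
      | add x y hx hy => simp only [map_add, hx, hy]
    have e' : ∀ T : H ⊠ H, Algebra.TensorProduct.map (iD (H := H)) (iD (H := H)) (TensorProduct.comm ℂ H H T) = tw H (Algebra.TensorProduct.map (iD (H := H)) (iD (H := H)) T) := by
      intro T
      induction T using TI with
      | zero => simp
      | tmul a h => simp
      | add x y hx hy => simp only [map_add, hx, hy]
    rw [e, e, e'] at this
    exact this
  | hj f =>
    have := congrArg (sl f) (YB2 H)
    rw [← mul_assoc, sl_mul_inL] at this
    rw [mul_assoc, sl_inL_mul, ← DelD_CD] at this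
    have e1 : sl f (nn DelD (CD (H := H))) = DelD (jD f) := by rw [nn_eq, sl_map, LinearMap.comp_id, sl_CD]; rfl
    have e2 : tw H (DelD (jD f)) = sl f (nn nR CD * nn nL CD) := by
      have : nn nR CD * nn nL CD = nn (tw H) (nn DelD CD) := by
        rw [DelD_CD, map_mul, nn_nn, nn_nn]
        congr 3 <;> (ext x; simp)
      rw [this, nn_nn, nn_eq, sl_map, LinearMap.comp_id, sl_CD]; rfl
    rw [e1] at this
    rw [e2, this]
  | hadd a b ha hb => rw [map_add, mul_add, ha, hb, map_add, add_mul]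
  | hmul a b ha hb => rw [map_mul, ← mul_assoc, ha, mul_assoc, hb, map_mul, mul_assoc]
variable (H) in
noncomputable def QQ : DD H ⊠ DD H := tw H (RR H) * RR H
lemma tw_tw (x : DD H ⊠ DD H) : tw H (tw H x) = x := by
  induction x using TI with
  | zero => simp
  | tmul a h => simp
  | add x y hx hy => simp only [map_add, hx, hy]
lemma QDel (x : DD H) : QQ H * DelD x = DelD x * QQ H := by
  rw [QQ, mul_assoc, RDel, ← mul_assoc, ← mul_assoc]
  have := congrArg (tw H) (RDel x)
  rw [map_mul, map_mul, tw_tw] at this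
  rw [this]
end dbl5
end HopfLR
end
section
open Coalgebra TensorProduct WithConv HopfAlgebra
namespace HopfLR
set_option linter.unusedSectionVars false
section gen6
variable {K : Type*} [Ring K] [HopfAlgebra ℂ K] [FiniteDimensional ℂ K]
lemma cL_1mul1 (f : K ⇾ ℂ) (hf : ∀ x y, f (x * y) = f (y * x)) (T : K ⊠ K) (a b : K) :
    cL f ((a ⊗ₜ 1) * T * (b ⊗ₜ 1)) = cL f (T * ((b * a) ⊗ₜ 1)) := by
  induction T using TI with
  | zero => simp
  | tmul x y => simp [mul_assoc]; rw [hf]; simp [mul_assoc]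
  | add x y hx hy => simp only [map_add, mul_add, add_mul, hx, hy]
lemma z_central [SI K] (Q : K ⊠ K) (hQ : ∀ x, Q * Δ x = Δ x * Q) (f : K ⇾ ℂ) (hf : ∀ x y, f (x * y) = f (y * x))
    (x : K) : cL f Q * x = x * cL f Q := by
  have e0 : toConv (cst Q) * toConv (Δ (H := K)) = toConv (Δ (H := K)) * toConv (cst Q) := by
    ext x
    rw [cst_mul', mul_cst']
    exact hQ x
  have e1 : toConv ((i1 (H := K)).toLinearMap ∘ₗ S) * (toConv (cst Q) * toConv (i1 (H := K)).toLinearMap) = 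
      toConv (i2 (H := K)).toLinearMap * (toConv (cst Q) * toConv ((i2 (H := K)).toLinearMap ∘ₗ S)) := by
    rw [comul_conv] at e0
    have h1 := S_alg (i1 (H := K))
    have h2 := alg_S (i2 (H := K))
    generalize toConv (i1 (H := K)).toLinearMap = a at *
    generalize toConv (i2 (H := K)).toLinearMap = b at *
    generalize toConv ((i1 (H := K)).toLinearMap ∘ₗ S) = a' at *
    generalize toConv ((i2 (H := K)).toLinearMap ∘ₗ S) = b' at *
    generalize toConv (cst (H := K) Q) = c at *
    calc a' * (c * a) = a' * (c * (a * b)) * b' := by simp only [mul_assoc, h2, mul_one]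
      _ = (a' * a) * (b * (c * b')) := by rw [e0]; simp only [mul_assoc]
      _ = _ := by rw [h1, one_mul]
  have e2 : toConv (cst (H := K) (cL f Q)) = toConv (LinearMap.id : K ⇾ K) * (toConv (cst (cL f Q)) * toConv S) := by
    ext h
    have := congrArg (fun F : WithConv (K ⇾ K ⊠ K) => cL f (F h)) e1
    change cL f ((toConv ((i1 (H := K)).toLinearMap ∘ₗ S) * (toConv (cst Q) * toConv (i1 (H := K)).toLinearMap) : WithConv (K ⇾ K ⊠ K)) h) = cL f ((toConv (i2 (H := K)).toLinearMap * (toConv (cst Q) * toConv ((i2 (H := K)).toLinearMap ∘ₗ S)) : WithConv (K ⇾ K ⊠ K)) h) at this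
    rw [(ℛ ℂ h).convMul_apply, (ℛ ℂ h).convMul_apply, map_sum, map_sum] at this
    rw [(ℛ ℂ h).convMul_apply]
    have a1 : ∀ i, cL f ((toConv ((i1 (H := K)).toLinearMap ∘ₗ S)) ((ℛ ℂ h).left i) * (toConv (cst Q) * toConv (i1 (H := K)).toLinearMap : WithConv (K ⇾ K ⊠ K)) ((ℛ ℂ h).right i))
       = cL f (Q * (((ℛ ℂ h).right i * S ((ℛ ℂ h).left i)) ⊗ₜ 1)) := by
      intro i
      rw [cst_mul', ← mul_assoc]
      exact cL_1mul1 f hf Q _ _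
    have a2 : ∀ i, cL f ((toConv ((i2 (H := K)).toLinearMap)) ((ℛ ℂ h).left i) * (toConv (cst Q) * toConv ((i2 (H := K)).toLinearMap ∘ₗ S) : WithConv (K ⇾ K ⊠ K)) ((ℛ ℂ h).right i))
       = (ℛ ℂ h).left i * (cL f Q * S ((ℛ ℂ h).right i)) := by
      intro i
      rw [cst_mul', ← cL_mul2, ← cL_2mul]
      rfl
    simp only [a1, a2] at this
    rw [← map_sum, ← Finset.mul_sum, ← TensorProduct.sum_tmul, x2Sx1, ← TensorProduct.smul_tmul', ← Algebra.TensorProduct.one_def, mul_smul_comm, mul_one, map_smul] at this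
    simp only [cst_mul', tc_apply, LinearMap.id_apply]
    rw [cst_apply]
    exact this
  have e3 : toConv (cst (H := K) (cL f Q)) * toConv (LinearMap.id : K ⇾ K) = toConv (LinearMap.id : K ⇾ K) * toConv (cst (cL f Q)) := by
    conv_lhs => rw [e2]
    rw [mul_assoc, mul_assoc, LinearMap.antipode_mul_id, mul_one]
  have := congrArg (fun F : WithConv (K ⇾ K) => F x) e3
  rw [cst_mul', mul_cst'] at this
  exact this
variable (K) in
noncomputable abbrev n1 : K ⊠ K ⇝ (K ⊠ K) ⊠ K := Algebra.TensorProduct.map i1 (AlgHom.id ℂ K)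
variable (K) in
noncomputable abbrev n2 : K ⊠ K ⇝ (K ⊠ K) ⊠ K := Algebra.TensorProduct.map i2 (AlgHom.id ℂ K)
noncomputable def GG (f g : K ⇾ ℂ) : (K ⊠ K) ⊠ K ⇾ K :=
  (TensorProduct.lid ℂ K).toLinearMap ∘ₗ LinearMap.rTensor K (Wedd.tens f g)
lemma GG_tmul (f g : K ⇾ ℂ) (a b c : K) : GG f g ((a ⊗ₜ b) ⊗ₜ c) = (f a * g b) • c := by simp [GG]
lemma GG_n (f g : K ⇾ ℂ) (X Y Z : K ⊠ K) : GG f g (n2 K X * n1 K Y * n2 K Z) = cL g (X * (1 ⊗ₜ cL f Y) * Z) := by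
  induction X using TI with
  | zero => simp
  | tmul x x' =>
    induction Y using TI with
    | zero => simp
    | tmul y y' =>
      induction Z using TI with
      | zero => simp
      | tmul z z' => simp [GG_tmul, smul_smul, mul_comm]
      | add x y hx hy => simp only [map_add, mul_add, hx, hy]
    | add x y hx hy => simp only [map_add, mul_add, add_mul, hx, hy, TensorProduct.tmul_add]
  | add x y hx hy => simp only [map_add, add_mul, hx, hy]
lemma GG_Δ (f g : K ⇾ ℂ) (X : K ⊠ K) : GG f g (Algebra.TensorProduct.map (Bialgebra.comulAlgHom ℂ K) (AlgHom.id ℂ K) X) =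
    cL (toConv f * toConv g).ofConv X := by
  induction X using TI with
  | zero => simp
  | tmul a b => simp [GG, cL]; rfl
  | add x y hx hy => simp only [map_add, hx, hy]
lemma z_mul (R' R : K ⊠ K) (h1 : Algebra.TensorProduct.map (Bialgebra.comulAlgHom ℂ K) (AlgHom.id ℂ K) R = n1 K R * n2 K R)
   (h2 : Algebra.TensorProduct.map (Bialgebra.comulAlgHom ℂ K) (AlgHom.id ℂ K) R' = n2 K R' * n1 K R')
   (f g : K ⇾ ℂ) (hf : ∀ x, cL f (R' * R) * x = x * cL f (R' * R)) :
   cL (toConv f * toConv g).ofConv (R' * R) = cL f (R' * R) * cL g (R' * R) := by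
  rw [← GG_Δ, map_mul, h1, h2]
  have : n2 K R' * n1 K R' * (n1 K R * n2 K R) = n2 K R' * n1 K (R' * R) * n2 K R := by rw [map_mul]; simp only [mul_assoc]
  rw [this, GG_n]
  have hc : ∀ T : K ⊠ K, T * (1 ⊗ₜ cL f (R' * R)) = (1 ⊗ₜ cL f (R' * R)) * T := by
    intro T
    induction T using TI with
    | zero => simp
    | tmul a b => simp [hf]
    | add x y hx hy => simp only [mul_add, add_mul, hx, hy]
  rw [hc, mul_assoc, cL_2mul]
lemma tens_cL (f g : K ⇾ ℂ) (X : K ⊠ K) : Wedd.tens f g X = g (cL f X) := by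
  induction X using TI with
  | zero => simp
  | tmul a b => simp
  | add x y hx hy => simp only [map_add, hx, hy]
lemma central_mul (W : Wedd.Wed K) (z : K) (hz : ∀ x, z * x = x * z) (i : Fin W.n) (x : K) :
    (W.d i : ℂ) * W.χ i (z * x) = W.χ i z * W.χ i x := by
  have : W.e z i ∈ Set.range (Matrix.scalar (Fin (W.d i)) (α := ℂ)) := by
    rw [Matrix.mem_range_scalar_iff_commute_single']
    intro a b
    have := congrArg (fun y => W.e y i) (hz (W.E i a b))
    simp [Wedd.Wed.E] at this
    exact this.symm
  obtain ⟨c, hc⟩ := this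
  rw [W.χ_apply, W.χ_apply, W.χ_apply, map_mul, Pi.mul_apply, ← hc]
  simp [← Matrix.smul_eq_diagonal_mul, Matrix.trace_smul]
  ring
end gen6
section dbl6
variable {H : Type*} [Ring H] [HopfAlgebra ℂ H] [FiniteDimensional ℂ H]
variable {A B : Type*} [Ring A] [Algebra ℂ A] [Ring B] [Algebra ℂ B]
variable [SI H]
variable (H) in
lemma Delid_RR : Algebra.TensorProduct.map (Bialgebra.comulAlgHom ℂ (DD H)) (AlgHom.id ℂ (DD H)) (RR H) = n1 (DD H) (RR H) * n2 (DD H) (RR H) := by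
  have e : ∀ {B : Type _} [Ring B] [Algebra ℂ B] (φ : DD H ⇝ B) (X : DD H ⊠ H), Algebra.TensorProduct.map φ (AlgHom.id ℂ (DD H)) (ri X) = ri (nn φ X) := by
    intro B _ _ φ X
    induction X using TI with
    | zero => simp
    | tmul a b => simp
    | add x y hx hy => simp only [map_add, hx, hy]
  rw [RR, e, n1, n2, e, e, ← map_mul]
  exact congrArg ri (DelD_CD (H := H))
variable (H) in
noncomputable abbrev psi : DD H ⊠ (H ⊠ H) ⇝ (DD H ⊠ DD H) ⊠ DD H :=
  (Algebra.TensorProduct.comm ℂ (DD H) (DD H ⊠ DD H)).toAlgHom.comp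
   (Algebra.TensorProduct.map (AlgHom.id ℂ (DD H)) (Algebra.TensorProduct.map (iD (H := H)) (iD (H := H))))
variable (H) in
lemma Delid_twRR : Algebra.TensorProduct.map (Bialgebra.comulAlgHom ℂ (DD H)) (AlgHom.id ℂ (DD H)) (tw H (RR H)) = n2 (DD H) (tw H (RR H)) * n1 (DD H) (tw H (RR H)) := by
  have e : ∀ (X : DD H ⊠ H), Algebra.TensorProduct.map (Bialgebra.comulAlgHom ℂ (DD H)) (AlgHom.id ℂ (DD H)) (tw H (ri X)) = psi H (LinearMap.lTensor _ Δ X) := by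
    intro X
    induction X using TI with
    | zero => simp
    | tmul a b =>
      simp only [Algebra.TensorProduct.map_tmul, LinearMap.lTensor_tmul, AlgHom.comp_apply, AlgEquiv.toAlgHom_eq_coe, AlgHom.coe_coe, Algebra.TensorProduct.comm_tmul, AlgHom.id_apply]
      rw [← DelD_iD]; rfl
    | add x y hx hy => simp only [map_add, hx, hy]
  have e2 : ∀ (X : DD H ⊠ H), psi H (l13 X) = n2 (DD H) (tw H (ri X)) := by
    intro X
    induction X using TI with
    | zero => simp
    | tmul a b => simp
    | add x y hx hy => simp only [map_add, hx, hy]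
  have e1 : ∀ (X : DD H ⊠ H), psi H (l12 X) = n1 (DD H) (tw H (ri X)) := by
    intro X
    induction X using TI with
    | zero => simp
    | tmul a b => simp
    | add x y hx hy => simp only [map_add, hx, hy]
  rw [RR, e, (DRep_D (H := H)).c2, map_mul, e1, e2]
noncomputable def zz (f : DD H ⇾ ℂ) : DD H := cL f (QQ H)
lemma zz_comm (f : DD H ⇾ ℂ) (hf : ∀ x y, f (x * y) = f (y * x)) (x : DD H) : zz f * x = x * zz f :=
  z_central (QQ H) (fun x => QDel x) f hf x
lemma zz_mul (f g : DD H ⇾ ℂ) (hf : ∀ x y, f (x * y) = f (y * x)) : zz (toConv f * toConv g).ofConv = zz f * zz g :=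
  z_mul _ _ (Delid_RR H) (Delid_twRR H) f g (zz_comm f hf)
lemma zz_counit : zz (counit (R := ℂ) (A := DD H)) = 1 := by
  let E : DD H ⊠ DD H ⇝ DD H := (Algebra.TensorProduct.lid ℂ (DD H)).toAlgHom.comp (Algebra.TensorProduct.map (epsD (H := H)) (AlgHom.id ℂ (DD H)))
  have hE : ∀ X, cL (counit (R := ℂ) (A := DD H)) X = E X := by
    intro X
    induction X using TI with
    | zero => simp
    | tmul a b => simp [E]; rfl
    | add x y hx hy => simp only [map_add, hx, hy]
  rw [zz, hE, QQ, map_mul]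
  have h1 : ∀ X : DD H ⊠ H, E (ri X) = Algebra.TensorProduct.lid ℂ (DD H) (Algebra.TensorProduct.map (AlgHom.id ℂ ℂ) (iD (H := H)) (nn epsD X)) := by
    intro X
    induction X using TI with
    | zero => simp
    | tmul a b => simp [E]
    | add x y hx hy => simp only [map_add, hx, hy]
  have h2 : ∀ X : DD H ⊠ H, E (tw H (ri X)) = sl counit X := by
    intro X
    induction X using TI with
    | zero => simp
    | tmul a b => simp [E]
    | add x y hx hy => simp only [map_add, hx, hy]
  rw [RR, h1, h2, epsD_CD, (DRep_D (H := H)).c1, map_one, map_one, mul_one]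
lemma zz_symm (f g : DD H ⇾ ℂ) (hf : Wedd.IsRC f) (hg : Wedd.IsRC g) : g (zz f) = f (zz g) := by
  rw [zz, zz, ← tens_cL, ← tens_cL]
  have e : ∀ X, Wedd.tens f g X = Wedd.tens g f (tw H X) := by
    intro X
    induction X using TI with
    | zero => simp
    | tmul a b => simp [mul_comm]
    | add x y hx hy => simp only [map_add, hx, hy]
  rw [e, QQ, map_mul, tw_tw, (hg.tens hf).comm]
lemma zz_Λ (I : Integ H) (f : DD H ⇾ ℂ) : zz f * iD I.Λ = jD (f ∘ₗ iD.toLinearMap) * iD I.Λ := by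
  have h1 : ∀ X : DD H ⊠ H, ri X * (1 ⊗ₜ iD I.Λ) = sl counit X ⊗ₜ iD I.Λ := by
    intro X
    induction X using TI with
    | zero => simp
    | tmul a b => simp [← map_mul, I.left, TensorProduct.smul_tmul]
    | add x y hx hy => simp only [map_add, add_mul, hx, hy, TensorProduct.add_tmul]
  have h2 : ∀ X : DD H ⊠ H, cL f (tw H (ri X)) = sl (f ∘ₗ iD.toLinearMap) X := by
    intro X
    induction X using TI with
    | zero => simp
    | tmul a b => simp
    | add x y hx hy => simp only [map_add, hx, hy]
  rw [zz, ← cL_mul2, QQ, mul_assoc]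
  conv_lhs => rw [RR, h1, (DRep_D (H := H)).c1, cL_mul2, h2, sl_CD]
end dbl6
end HopfLR
end
section
open Coalgebra TensorProduct WithConv HopfAlgebra
namespace HopfLR
set_option linter.unusedSectionVars false
section dbl7
variable {H : Type*} [Ring H] [HopfAlgebra ℂ H] [FiniteDimensional ℂ H]
variable (H) in
noncomputable def ad : H ⇝ Module.End ℂ H :=
  (AlgHom.mulLeftRight ℂ H).comp ((Algebra.TensorProduct.map (AlgHom.id ℂ H) (iS (AlgHom.id ℂ H))).comp (Bialgebra.comulAlgHom ℂ H))
lemma ad_apply (h x : H) : ad H h x = ∑ i ∈ (ℛ ℂ h).index, (ℛ ℂ h).left i * x * S ((ℛ ℂ h).right i) := by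
  change AlgHom.mulLeftRight ℂ H (Algebra.TensorProduct.map (AlgHom.id ℂ H) (iS (AlgHom.id ℂ H)) (Δ h)) x = _
  conv_lhs => rw [← (ℛ ℂ h).eq]
  simp [map_sum, LinearMap.sum_apply, iS_apply]
lemma ad_conv (h x : H) : ad H h x = (toConv (LinearMap.id : H ⇾ H) * (toConv (cst x) * toConv S) : WithConv (H ⇾ H)) h := by
  rw [ad_apply, (ℛ ℂ h).convMul_apply]
  refine Finset.sum_congr rfl fun i _ => ?_
  rw [cst_mul', mul_assoc]; rfl
variable (H) in
noncomputable def jH : (H ⇾ ℂ) ⇾ Module.End ℂ H :=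
  IsLinearMap.mk' (fun f => cL f ∘ₗ Δ) ⟨fun f g => by ext; simp [cL, LinearMap.rTensor_add],
    fun c f => by ext; simp [cL, LinearMap.rTensor_smul]⟩
lemma jH_apply (f : H ⇾ ℂ) (x : H) : jH H f x = cL f (Δ x) := rfl
lemma cL_a1 (f : H ⇾ ℂ) (a : H) (X : H ⊠ H) : cL (f ∘ₗ LinearMap.mulLeft ℂ a) X = cL f ((a ⊗ₜ 1) * X) := by
  induction X using TI with
  | zero => simp
  | tmul a b => simp
  | add x y hx hy => simp only [map_add, mul_add, hx, hy]
lemma cL_1a (f : H ⇾ ℂ) (a : H) (X : H ⊠ H) : cL (f ∘ₗ LinearMap.mulRight ℂ a) X = cL f (X * (a ⊗ₜ 1)) := by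
  induction X using TI with
  | zero => simp
  | tmul a b => simp
  | add x y hx hy => simp only [map_add, add_mul, hx, hy]
lemma ad_cL (f : H ⇾ ℂ) (a b : H) (X : H ⊠ H) :
    cL f ((a ⊗ₜ 1) * (toConv (i2 (H := H)).toLinearMap * (toConv (cst X) * toConv ((i2 (H := H)).toLinearMap ∘ₗ S)) : WithConv (H ⇾ H ⊠ H)) b)
      = ad H b (cL f ((a ⊗ₜ 1) * X)) := by
  rw [ad_apply, (ℛ ℂ b).convMul_apply, Finset.mul_sum, map_sum]
  refine Finset.sum_congr rfl fun i _ => ?_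
  rw [cst_mul', ← cL_2mul, ← cL_mul2]
  congr 1
  simp only [tc_apply, LinearMap.comp_apply, AlgHom.toLinearMap_apply, Algebra.TensorProduct.includeRight_apply, ← mul_assoc]
  congr 2
  simp
lemma jH_mul (f g : H ⇾ ℂ) : jH H (toConv f * toConv g).ofConv = jH H g * jH H f := by
  ext x
  apply dual_ext
  intro k
  rw [jH_apply, ← conv_cL]
  change ((toConv f * toConv g) * toConv k : WithConv (H ⇾ ℂ)) x = k (cL g (Δ (cL f (Δ x))))
  rw [mul_assoc, ← conv_cL g k]
  exact conv_cL f (toConv g * toConv k).ofConv x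
lemma ad_cross (f : H ⇾ ℂ) (h : H) : xL (ad H).toLinearMap (jH H) f (Δ h) = xR (ad H).toLinearMap (jH H) f (Δ h) := by
  ext x
  let F : H ⇾ H ⊠ H := Δ ∘ₗ (toConv (LinearMap.id : H ⇾ H) * (toConv (cst x) * toConv S)).ofConv
  have hF : toConv F = toConv i1.toLinearMap * (toConv i2.toLinearMap * (toConv (cst (Δ x)) * (toConv (i2.toLinearMap ∘ₗ S) * toConv (i1.toLinearMap ∘ₗ S)))) := by
    have e1 := comp_mul (Bialgebra.comulAlgHom ℂ H) (LinearMap.id : H ⇾ H) (toConv (cst x) * toConv S).ofConv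
    have e2 := comp_mul (Bialgebra.comulAlgHom ℂ H) (cst x) S
    have e4 : (Bialgebra.comulAlgHom ℂ H).toLinearMap ∘ₗ cst (H := H) x = cst (Δ x) := by ext y; simp [cst_apply]
    have e3 := comul_S_conv (H := H)
    refine e1.trans ?_
    refine (congrArg (fun t => toConv ((Bialgebra.comulAlgHom ℂ H).toLinearMap ∘ₗ LinearMap.id) * t) e2).trans ?_
    rw [e4, ← e3, ← mul_assoc, ← mul_assoc, ← comul_conv]
    simp only [mul_assoc]
    rfl
  have hL : xL (ad H).toLinearMap (jH H) f (Δ h) x = cL f ((toConv F * toConv i1.toLinearMap : WithConv (H ⇾ H ⊠ H)) h) := by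
    rw [(ℛ ℂ h).convMul_apply]
    conv_lhs => rw [← (ℛ ℂ h).eq]
    simp only [map_sum, LinearMap.sum_apply]
    refine Finset.sum_congr rfl fun i _ => ?_
    rw [xL_tmul]
    change cL (f ∘ₗ LinearMap.mulRight ℂ ((ℛ ℂ h).right i)) (Δ (ad H ((ℛ ℂ h).left i) x)) = _
    rw [cL_1a, ad_conv]; rfl
  have hR : xR (ad H).toLinearMap (jH H) f (Δ h) x = cL f ((toConv i1.toLinearMap * (toConv (i2 (H := H)).toLinearMap * (toConv (cst (Δ x)) * toConv ((i2 (H := H)).toLinearMap ∘ₗ S))) : WithConv (H ⇾ H ⊠ H)) h) := by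
    rw [(ℛ ℂ h).convMul_apply]
    conv_lhs => rw [← (ℛ ℂ h).eq]
    simp only [map_sum, LinearMap.sum_apply]
    refine Finset.sum_congr rfl fun i _ => ?_
    rw [xR_tmul]
    change ad H ((ℛ ℂ h).right i) (cL (f ∘ₗ LinearMap.mulLeft ℂ ((ℛ ℂ h).left i)) (Δ x)) = _
    rw [cL_a1, ← ad_cL]; rfl
  rw [hL, hR, hF]
  have := S_alg (i1 (H := H))
  simp only [mul_assoc, this, mul_one]
variable (H) in
lemma exists_rho : ∃ φ : DD H ⇝ Module.End ℂ H, (∀ h, φ (iD h) = ad H h) ∧ ∀ f, φ (jD f) = jH H f :=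
  D_lift (ad H) (jH H) (by
    ext x
    rw [jH_apply, cL_counit]; rfl) jH_mul ad_cross
noncomputable def phi (I : Integ H) : (H ⇾ ℂ) ⇾ DD H := LinearMap.mulRight ℂ (iD I.Λ) ∘ₗ jD
lemma phi_apply (I : Integ H) (f) : phi I f = jD f * iD I.Λ := rfl
lemma phi_inj (I : Integ H) : Function.Injective (phi I) := by
  obtain ⟨ρ, h1, h2⟩ := exists_rho H
  have : ∀ f, ρ (phi I f) I.Λ = I.fourier' f := by
    intro f
    rw [phi_apply, map_mul, h1, h2]
    change jH H f (ad H I.Λ I.Λ) = _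
    have : ad H I.Λ I.Λ = I.Λ := by
      rw [ad_apply]
      simp only [I.left, smul_mul_assoc, I.right, eps_S, smul_smul]
      rw [← Finset.sum_smul]
      have := congrArg (counit (R := ℂ)) (sum_counit_smul (R := ℂ) (ℛ ℂ I.Λ))
      simp only [map_sum, map_smul, smul_eq_mul, I.eps] at this
      rw [this, one_smul]
    rw [this]; rfl
  intro f g hfg
  apply I.fourier'_inj
  rw [← this, ← this, hfg]
lemma phi_range (I : Integ H) (x : DD H) : ∃ f, x * iD I.Λ = phi I f := by
  obtain ⟨T, rfl⟩ := muD_surj x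
  induction T using TI with
  | zero => exact ⟨0, by simp⟩
  | tmul f h =>
    refine ⟨counit (R := ℂ) h • f, ?_⟩
    change jD f * iD h * iD I.Λ = _
    rw [mul_assoc, ← map_mul, I.left, map_smul, map_smul, phi_apply, mul_smul_comm]
  | add x y hx hy =>
    obtain ⟨f, hf⟩ := hx
    obtain ⟨g, hg⟩ := hy
    exact ⟨f + g, by rw [map_add, add_mul, hf, hg, map_add]⟩
lemma trace_phi (I : Integ H) (a : DD H) (T : (H ⇾ ℂ) ⇾ (H ⇾ ℂ)) (hT : ∀ f, a * phi I f = phi I (T f)) :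
    LinearMap.trace ℂ (DD H) (LinearMap.mulLeft ℂ a ∘ₗ LinearMap.mulRight ℂ (iD I.Λ)) = LinearMap.trace ℂ _ T := by
  obtain ⟨l, hl⟩ := LinearMap.exists_leftInverse_of_injective (phi I) (LinearMap.ker_eq_bot.2 (phi_inj I))
  have hl' : ∀ f, l (phi I f) = f := fun f => LinearMap.congr_fun hl f
  have e1 : LinearMap.mulLeft ℂ a ∘ₗ LinearMap.mulRight ℂ (iD I.Λ) = phi I ∘ₗ (T ∘ₗ l ∘ₗ LinearMap.mulRight ℂ (iD I.Λ)) := by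
    ext x
    obtain ⟨f, hf⟩ := phi_range I x
    simp only [LinearMap.comp_apply, LinearMap.mulLeft_apply, LinearMap.mulRight_apply, hf, hl', hT]
  rw [e1, LinearMap.trace_comp_comm']
  congr 1
  ext1 f
  have : phi I f * iD I.Λ = phi I f := by rw [phi_apply, mul_assoc, ← map_mul, I.left, I.eps, one_smul]
  simp only [LinearMap.comp_apply, LinearMap.mulRight_apply, this, hl']
lemma trace_tr (A : H ⇾ H) (T : (H ⇾ ℂ) ⇾ (H ⇾ ℂ)) (h : ∀ f x, T f x = f (A x)) : 
    LinearMap.trace ℂ _ T = LinearMap.trace ℂ _ A := by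
  rw [← LinearMap.trace_transpose' (R := ℂ) (M := H) A]
  congr 1
  ext f x
  exact h f x
variable [SI H]
lemma TF' (I : Integ H) (f : H ⇾ ℂ) : LinearMap.trace ℂ H (cL f ∘ₗ Δ) = Module.finrank ℂ H * f I.Λ := by
  have e : cL f ∘ₗ Δ = S ∘ₗ ((cR (f ∘ₗ S) ∘ₗ Δ) ∘ₗ S) := by
    ext x
    have := LinearMap.congr_fun (comul_S (H := H)) x
    simp only [LinearMap.comp_apply] at this ⊢
    rw [this, ← (ℛ ℂ x).eq]
    simp [SI.h2]
  rw [e, LinearMap.trace_comp_comm']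
  have : (cR (f ∘ₗ S) ∘ₗ Δ) ∘ₗ S ∘ₗ S = cR (f ∘ₗ S) ∘ₗ Δ (H := H) := by ext x; simp [SI.h2]
  rw [LinearMap.comp_assoc, this, TF I SI.h2, LinearMap.comp_apply, I.S_Λ]
lemma S1_tr (I : Integ H) (W : Wedd.Wed (DD H)) (f : DD H ⇾ ℂ) (hf : ∀ x y, f (x * y) = f (y * x)) :
    ∑ X, W.χ X (zz f) * W.χ X (iD I.Λ) = Module.finrank ℂ H * f (iD I.Λ) := by
  let T : (H ⇾ ℂ) ⇾ (H ⇾ ℂ) := Module.Dual.transpose (R := ℂ) (cL (f ∘ₗ iD.toLinearMap) ∘ₗ Δ)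
  rw [← W.trace_LR, trace_phi I _ T, trace_tr (cL (f ∘ₗ iD.toLinearMap) ∘ₗ Δ) T (fun _ _ => rfl), TF' I]
  · rfl
  · intro g
    rw [phi_apply, ← mul_assoc, zz_comm f hf, mul_assoc, zz_Λ, ← mul_assoc, ← jD_mul, phi_apply]
    congr 2
    ext x
    exact conv_cL _ _ _
lemma S2_tr (I : Integ H) (W : Wedd.Wed (DD H)) (V : Wedd.Wed H) (h : H) :
    ∑ X, W.χ X (iD h) * W.χ X (iD I.Λ) = ∑ i, (toConv (V.χ i ∘ₗ S) * toConv (V.χ i) : WithConv (H ⇾ ℂ)) h := by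
  let A : H ⇾ H := ∑ i ∈ (ℛ ℂ h).index, LinearMap.mulLeft ℂ (S ((ℛ ℂ h).left i)) ∘ₗ LinearMap.mulRight ℂ ((ℛ ℂ h).right i)
  let T : (H ⇾ ℂ) ⇾ (H ⇾ ℂ) := Module.Dual.transpose (R := ℂ) A
  rw [← W.trace_LR, trace_phi I _ T, trace_tr A T (fun _ _ => rfl)]
  · simp only [A, map_sum, V.trace_LR]
    rw [Finset.sum_comm]
    refine Finset.sum_congr rfl fun i _ => ?_
    rw [(ℛ ℂ h).convMul_apply]; rfl
  · intro g
    rw [phi_apply, ijL, phi_apply, ← Finset.sum_mul, ← map_sum]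
    congr 2
    ext x
    simp [T, A, Module.Dual.transpose]
end dbl7
end HopfLR
end
section
open Coalgebra TensorProduct WithConv HopfAlgebra
namespace HopfLR
set_option linter.unusedSectionVars false
section dbl8
variable {H : Type*} [Ring H] [HopfAlgebra ℂ H] [FiniteDimensional ℂ H]
lemma χ_Λ (I : Integ H) (V : Wedd.Wed H) (h2 : ∀ x : H, S (S x) = x) (k : Fin V.n) :
    V.χ k I.Λ = if k = oo V then 1 else 0 := by
  rw [← orth I V h2]
  have : V.χ (oo V) ∘ₗ S = counit := by rw [χ_oo]; ext x; simp
  rw [this, counit_conv, mul_one]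
variable [SI H]
variable (H) in
noncomputable def zzL : (DD H ⇾ ℂ) ⇾ DD H :=
  IsLinearMap.mk' (fun f => zz f) ⟨fun f g => by simp [zz, cL, LinearMap.rTensor_add],
    fun c f => by simp [zz, cL, LinearMap.rTensor_smul]⟩
lemma zz_sum {ι : Type*} (s : Finset ι) (c : ι → ℂ) (f : ι → (DD H ⇾ ℂ)) :
    zz (∑ i ∈ s, c i • f i) = ∑ i ∈ s, c i • zz (f i) := by
  change zzL H _ = ∑ i ∈ s, c i • zzL H (f i)
  rw [map_sum]; simp only [map_smul]
variable (I : Integ H) (V : Wedd.Wed H) (W : Wedd.Wed (DD H))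
noncomputable def rs (f : DD H ⇾ ℂ) : H ⇾ ℂ := f ∘ₗ (iD (H := H)).toLinearMap
lemma rs_apply (f : DD H ⇾ ℂ) (x : H) : rs f x = f (iD x) := rfl
lemma rs_rc (Y) : Wedd.IsRC (rs (W.χ Y)) := (W.χ_rc Y).comp (iD (H := H))
lemma rs_conv (f g : DD H ⇾ ℂ) : rs (toConv f * toConv g).ofConv = (toConv (rs f) * toConv (rs g)).ofConv := by
  ext x
  change Wedd.tens f g (DelD (iD x)) = Wedd.tens (rs f) (rs g) (Δ x)
  rw [DelD_iD]
  induction (Δ x) using TI with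
  | zero => simp
  | tmul a b => simp [rs_apply]
  | add a b ha hb => simp only [map_add, ha, hb]
noncomputable def FF (Y : Fin W.n) (k : Fin V.n) : ℕ := V.mult (rs (W.χ Y)) k
lemma FF_p (Y k) : W.χ Y (iD (V.p k)) = FF V W Y k := V.mult_spec (rs_rc W Y) k
lemma FF_eq (Y) (x) : W.χ Y (iD x) = ∑ k, (FF V W Y k : ℂ) * V.χ k x := by
  have := congrArg (fun f : H ⇾ ℂ => f x) (V.rc_eq (rs_rc W Y))
  simpa [rs_apply, FF] using this
lemma FF_o' (Y) : W.χ Y (iD I.Λ) = FF V W Y (oo V) := by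
  rw [FF_eq V]
  simp [χ_Λ I V SI.h2]
lemma NN_ap {K : Type*} [Ring K] [HopfAlgebra ℂ K] (W : Wedd.Wed K) (i j : Fin W.n) :
    (toConv (W.χ i) * toConv (W.χ j)).ofConv = ∑ k, (NN W i j k : ℂ) • W.χ k :=
  W.rc_eq (rc_conv (W.χ_rc i) (W.χ_rc j))
lemma FF_o (k) : FF V W (oo W) k = if k = oo V then 1 else 0 := by
  have h := FF_p V W (oo W) k
  rw [χ_oo] at h
  have h3 : (counit (R := ℂ) (A := DD H)) (iD (V.p k)) = V.χ (oo V) (V.p k) := by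
    rw [χ_oo]; exact epsD_iD _
  rw [h3, V.χ_p] at h
  split_ifs with h5
  · rw [if_pos h5.symm] at h; exact_mod_cast h.symm
  · rw [if_neg (fun e => h5 e.symm)] at h; exact_mod_cast h.symm
lemma FF_mul (X X' k) : ∑ Y, NN W X X' Y * FF V W Y k = ∑ i, ∑ j, FF V W X i * FF V W X' j * NN V i j k := by
  have h1 := congrArg (fun f : H ⇾ ℂ => f (V.p k)) (rs_conv (W.χ X) (W.χ X'))
  simp only [NN_ap] at h1
  rw [V.rc_eq (rs_rc W X), V.rc_eq (rs_rc W X')] at h1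
  rw [rs_apply] at h1
  have h2 : toConv (∑ i, (V.mult (rs (W.χ X)) i : ℂ) • V.χ i) * toConv (∑ i, (V.mult (rs (W.χ X')) i : ℂ) • V.χ i)
     = ∑ i, ∑ j, ((FF V W X i : ℂ) * (FF V W X' j : ℂ)) • (toConv (V.χ i) * toConv (V.χ j)) := by
    simp only [toConv_sum, toConv_smul, Finset.sum_mul, Finset.mul_sum, smul_mul_assoc, mul_smul_comm]
    rw [Finset.sum_comm]
    simp only [Finset.smul_sum, smul_smul]
    refine Finset.sum_congr rfl fun j _ => Finset.sum_congr rfl fun i _ => ?_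
    rw [mul_comm]; rfl
  rw [h2] at h1
  simp only [ofConv_sum, ofConv_smul, NN_ap, LinearMap.sum_apply, LinearMap.smul_apply, smul_eq_mul, FF_p, V.χ_p] at h1
  simp only [mul_ite, mul_one, mul_zero, Finset.sum_ite_eq', Finset.mem_univ, if_true, Finset.sum_ite_eq] at h1
  exact_mod_cast h1
lemma FF_d (Y) : ∑ i, FF V W Y i * V.d i = W.d Y := by
  have := FF_eq V W Y 1
  rw [map_one, W.χ_one] at this
  simp only [V.χ_one] at this
  exact_mod_cast this.symm
lemma FF_st (Y i) : FF V W (star W SI.h2 Y) i = FF V W Y (star V SI.h2 i) := by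
  have h := FF_p V W (star W SI.h2 Y) i
  rw [← star_spec] at h
  have h3 : (W.χ Y ∘ₗ S) (iD (V.p i)) = W.χ Y (iD (S (V.p i))) := congrArg (W.χ Y) (SD_iD (V.p i))
  rw [h3, FF_eq V] at h
  have h4 : ∀ k, V.χ k (S (V.p i)) = if k = star V SI.h2 i then 1 else 0 := by
    intro k
    have := congrArg (fun f : H ⇾ ℂ => f (V.p i)) (star_spec V SI.h2 k)
    simp only [LinearMap.comp_apply, V.χ_p] at this
    rw [this]
    congr 1
    rw [eq_iff_iff]
    constructor
    · rintro rfl; rw [star_star]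
    · rintro rfl; rw [star_star]
  simp only [h4, mul_ite, mul_one, mul_zero, Finset.sum_ite_eq', Finset.sum_ite_eq, Finset.mem_univ, if_true] at h
  exact_mod_cast h.symm
lemma dim_frd : (frd I V SI.h2).dim Finset.univ = Module.finrank ℂ H := V.finrank_eq.symm
noncomputable def zdat (h1 : ∀ B, (frd I V SI.h2).IsFus B → B = {oo V} ∨ B = Finset.univ)
    (h2 : ∀ i, V.d i = 1 → i = oo V) (h3 : 1 < Module.finrank ℂ H) :
    ZDat (frd I V SI.h2) (frd (IntD I V) W SI.h2) where
  S X Y := W.χ Y (zz (W.χ X))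
  S_symm X Y := zz_symm _ _ (W.χ_rc X) (W.χ_rc Y)
  S_mul X X' Y := by
    rw [← central_mul W _ (zz_comm _ (W.χ_rc X).comm), ← zz_mul _ _ (W.χ_rc X).comm, NN_ap, zz_sum, map_sum]
    simp only [map_smul, smul_eq_mul]
    rfl
  S_o Y := by
    change W.χ Y (zz (W.χ (oo W))) = _
    rw [χ_oo, zz_counit, W.χ_one]; rfl
  F := FF V W
  F_o := FF_o V W
  F_mul X X' k := FF_mul V W X X' k
  F_d := FF_d V W
  F_st := FF_st V W
  S1 Y := by
    rw [dim_frd]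
    change ∑ X, (FF V W X (oo V) : ℂ) * W.χ Y (zz (W.χ X)) = Module.finrank ℂ H * (FF V W Y (oo V) : ℂ)
    rw [← FF_o' I, ← S1_tr I W _ (W.χ_rc Y).comm]
    refine Finset.sum_congr rfl fun X _ => ?_
    rw [← FF_o' I, zz_symm _ _ (W.χ_rc X) (W.χ_rc Y), mul_comm]
  S2 k := by
    change ∑ Y, FF V W Y (oo V) * FF V W Y k = ∑ i, NN V (star V SI.h2 i) i k
    have := S2_tr I W V (V.p k)
    simp only [FF_p, FF_o' I V] at this
    have h5 : ∀ i, (toConv (V.χ i ∘ₗ S) * toConv (V.χ i) : WithConv (H ⇾ ℂ)) (V.p k) = (NN V (star V SI.h2 i) i k : ℂ) := by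
      intro i
      rw [star_spec V SI.h2, NN_spec, ev_sum]
      simp [V.χ_p]
    rw [Finset.sum_congr rfl fun i _ => h5 i] at this
    have h6 : ∑ Y, FF V W Y k * FF V W Y (oo V) = ∑ i, NN V (star V SI.h2 i) i k := by exact_mod_cast this
    rw [← h6]
    exact Finset.sum_congr rfl fun _ _ => mul_comm _ _
  C1 := h1
  C2 := h2
  one_lt := by rw [dim_frd]; exact h3
lemma no_simple (I : Integ H) (V : Wedd.Wed H) (h1 : ∀ B, (frd I V SI.h2).IsFus B → B = {oo V} ∨ B = Finset.univ)
    (h2 : ∀ i, V.d i = 1 → i = oo V) (h3 : 1 < Module.finrank ℂ H) (p q r s : ℕ) (hp : p.Prime) (hq : q.Prime)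
    (hdim : Module.finrank ℂ H = p ^ r * q ^ s) : False := by
  haveI := (IntD I V).semisimple
  obtain ⟨W⟩ := Wedd.exists_wed (DD H)
  exact (zdat I V W h1 h2 h3).contra' p q r s hp hq (by rw [dim_frd]; exact hdim)
end dbl8
end HopfLR
end
section
open Coalgebra TensorProduct WithConv HopfAlgebra
namespace HopfLR
set_option linter.unusedSectionVars false
lemma FR.fus_sum {I : Type} [Fintype I] [DecidableEq I] (C : FR I) {B : Finset I} (hB : C.IsFus B) (k : I) :
    ∑ i ∈ B, ∑ j ∈ B, C.d i * C.d j * C.N i j k = if k ∈ B then C.dim B * C.d k else 0 := by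
  split_ifs with hk
  · rw [FR.dim, Finset.sum_mul]
    refine Finset.sum_congr rfl fun i hi => ?_
    rw [pow_two, mul_assoc, ← C.sum_N_d i k, Finset.mul_sum,
      ← Finset.sum_subset (Finset.subset_univ B) (f := fun j => C.d i * (C.N i j k * C.d j))]
    · exact Finset.sum_congr rfl fun j _ => by ring
    · intro j _ hj
      by_cases h : C.N i j k = 0
      · simp [h]
      · rw [C.frob] at h
        exact absurd (hB.mul_mem _ (hB.st_mem i hi) k hk j h) hj
  · refine Finset.sum_eq_zero fun i hi => Finset.sum_eq_zero fun j hj => ?_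
    by_cases h : C.N i j k = 0
    · simp [h]
    · exact absurd (hB.mul_mem i hi j hj k h) hk
universe u
section quo
variable {H : Type*} [Ring H] [HopfAlgebra ℂ H] [FiniteDimensional ℂ H]
variable (I : Integ H) (V : Wedd.Wed H) (B : Finset (Fin V.n))
noncomputable def fB : H ⇾ ℂ := ∑ i ∈ B, (V.d i : ℂ) • V.χ i
lemma fB_apply (x : H) : fB V B x = ∑ i ∈ B, (V.d i : ℂ) * V.χ i x := by simp [fB]
lemma fB_conv [SI H] (hB : (frd I V SI.h2).IsFus B) :
    (toConv (fB V B) * toConv (fB V B)).ofConv = ((frd I V SI.h2).dim B : ℂ) • fB V B := by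
  have h1 : toConv (fB V B) * toConv (fB V B) =
      ∑ i ∈ B, ∑ j ∈ B, ((V.d i : ℂ) * (V.d j : ℂ)) • (toConv (V.χ i) * toConv (V.χ j)) := by
    rw [fB]
    simp only [toConv_sum, toConv_smul, Finset.sum_mul, Finset.mul_sum, smul_mul_assoc, mul_smul_comm]
    rw [Finset.sum_comm]
    simp only [Finset.smul_sum, smul_smul]
    refine Finset.sum_congr rfl fun j _ => Finset.sum_congr rfl fun i _ => ?_
    rw [mul_comm]
  rw [h1]
  simp only [ofConv_sum, ofConv_smul, NN_ap]
  have h2 : ∀ k, ((∑ i ∈ B, ∑ j ∈ B, V.d i * V.d j * NN V i j k : ℕ) : ℂ) =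
      ((if k ∈ B then (frd I V SI.h2).dim B * V.d k else 0 : ℕ) : ℂ) := fun k => by
    exact_mod_cast FR.fus_sum _ hB k
  ext x
  simp only [LinearMap.sum_apply, LinearMap.smul_apply, smul_eq_mul, fB_apply, Finset.mul_sum]
  calc _ = ∑ k, ((∑ i ∈ B, ∑ j ∈ B, V.d i * V.d j * NN V i j k : ℕ) : ℂ) * V.χ k x := by
        push_cast
        simp only [Finset.sum_mul]
        symm
        rw [Finset.sum_comm]
        refine Finset.sum_congr rfl fun i _ => ?_
        rw [Finset.sum_comm]
        refine Finset.sum_congr rfl fun j _ => Finset.sum_congr rfl fun k _ => ?_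
        ring
    _ = _ := by
        simp only [h2]
        rw [← Finset.sum_subset (Finset.subset_univ B)]
        · refine Finset.sum_congr rfl fun k hk => ?_
          rw [if_pos hk]; push_cast; ring
        · intro k _ hk; simp [hk]
lemma fB_Λ [SI H] (hB : (frd I V SI.h2).IsFus B) : fB V B I.Λ = 1 := by
  rw [fB_apply]
  simp only [χ_Λ I V SI.h2, mul_ite, mul_one, mul_zero, Finset.sum_ite_eq']
  have h0 : oo V ∈ B := hB.o_mem
  rw [if_pos h0, d_oo]; simp
lemma dim_pos [SI H] (hB : (frd I V SI.h2).IsFus B) : 0 < (frd I V SI.h2).dim B :=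
  Finset.sum_pos (fun i _ => pow_pos (V.pos i) 2) ⟨_, hB.o_mem⟩
lemma dim_dvd [SI H] (hB : (frd I V SI.h2).IsFus B) : (frd I V SI.h2).dim B ∣ Module.finrank ℂ H := by
  have hpos : ((frd I V SI.h2).dim B : ℂ) ≠ 0 := by exact_mod_cast (dim_pos I V B hB).ne'
  have hc := fB_conv I V B hB
  generalize (frd I V SI.h2).dim B = D at *
  let T : Module.End ℂ H := (D : ℂ)⁻¹ • jH H (fB V B)
  have hT : T * T = T := by
    change ((D : ℂ)⁻¹ • jH H (fB V B)) * ((D : ℂ)⁻¹ • jH H (fB V B)) = (D : ℂ)⁻¹ • jH H (fB V B)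
    rw [smul_mul_smul_comm, ← jH_mul, hc, map_smul, smul_smul]
    congr 1
    field_simp
  have h1 := Wedd.trace_idem T hT
  have h2 : LinearMap.trace ℂ H (jH H (fB V B)) = Module.finrank ℂ H := by
    have := TF' I (fB V B)
    rw [fB_Λ I V B hB, mul_one] at this
    exact this
  have h3 : LinearMap.trace ℂ H T = (D : ℂ)⁻¹ * Module.finrank ℂ H := by
    change LinearMap.trace ℂ H ((D : ℂ)⁻¹ • jH H (fB V B)) = _
    rw [map_smul, h2, smul_eq_mul]
  rw [h3] at h1
  have h4 : (Module.finrank ℂ H : ℂ) = D * Module.finrank ℂ (LinearMap.range T) := by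
    rw [← h1]; field_simp
  exact ⟨_, by exact_mod_cast h4⟩
noncomputable def piB : H ⇝ (Π i : B, Matrix (Fin (V.d i)) (Fin (V.d i)) ℂ) :=
  (AlgHom.pi fun i : B => Pi.evalAlgHom ℂ _ (i : Fin V.n)).comp V.e.toAlgHom
lemma piB_apply (x : H) (i : B) : piB V B x i = V.e x i := rfl
lemma piB_surj : Function.Surjective (piB V B) := by
  intro y
  refine ⟨V.e.symm (fun i => if h : i ∈ B then y ⟨i, h⟩ else 0), ?_⟩
  ext1 i
  rw [piB_apply, AlgEquiv.apply_symm_apply]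
  simp
noncomputable abbrev JB : Ideal H := RingHom.ker (piB V B)
lemma mem_JB (x : H) : x ∈ JB V B ↔ ∀ i ∈ B, V.e x i = 0 := by
  rw [RingHom.mem_ker]
  constructor
  · intro h i hi
    exact congrFun h ⟨i, hi⟩
  · intro h
    ext1 i
    exact h i i.2
lemma mem_JB' (x : H) : x ∈ JB V B ↔ ∀ i ∈ B, ∀ y, V.χ i (x * y) = 0 := by
  rw [mem_JB]
  constructor
  · intro h i hi y
    rw [V.χ_apply, map_mul, Pi.mul_apply, h i hi]; simp
  · intro h i hi
    rw [Matrix.ext_iff_trace_mul_right]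
    intro M
    have := h i hi (V.e.symm (Pi.single i M))
    rw [V.χ_apply, map_mul, AlgEquiv.apply_symm_apply, Pi.mul_apply, Pi.single_eq_same] at this
    rw [this]; simp
noncomputable def cB : H := V.e.symm (fun i => if i ∈ B then 1 else 0)
lemma e_cB (i) : V.e (cB V B) i = if i ∈ B then 1 else 0 := by rw [cB, AlgEquiv.apply_symm_apply]
lemma cB_comm (x : H) : cB V B * x = x * cB V B := by
  apply V.e.injective
  ext1 i
  rw [map_mul, map_mul, Pi.mul_apply, Pi.mul_apply, e_cB]
  split_ifs <;> simp
lemma cB_idem : cB V B * cB V B = cB V B := by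
  apply V.e.injective
  ext1 i
  rw [map_mul, Pi.mul_apply, e_cB]
  split_ifs <;> simp
lemma mem_cB {x : H} (h : x ∈ JB V B) : x * (1 - cB V B) = x := by
  rw [mem_JB] at h
  apply V.e.injective
  ext1 i
  rw [map_mul, Pi.mul_apply, map_sub, map_one, Pi.sub_apply, e_cB]
  split_ifs with hi
  · simp [h i hi]
  · simp
lemma cB_mem : 1 - cB V B ∈ JB V B := by
  rw [mem_JB]
  intro i hi
  rw [map_sub, map_one, Pi.sub_apply, e_cB, if_pos hi]; simp
lemma fB_cB : fB V B (1 - cB V B) = 0 := by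
  rw [fB_apply]
  refine Finset.sum_eq_zero fun i hi => ?_
  have := (mem_JB' V B _).1 (cB_mem V B) i hi 1
  rw [mul_one] at this
  rw [this, mul_zero]
lemma reg_cB (x : H) : LinearMap.trace ℂ H (LinearMap.mulLeft ℂ (x * cB V B)) = fB V B x := by
  rw [V.trace_reg, fB_apply, ← Finset.sum_subset (Finset.subset_univ B)]
  · refine Finset.sum_congr rfl fun i hi => ?_
    rw [V.χ_apply, V.χ_apply, map_mul, Pi.mul_apply, e_cB, if_pos hi, mul_one]
  · intro i _ hi
    rw [V.χ_apply, map_mul, Pi.mul_apply, e_cB, if_neg hi]; simp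
lemma reg_tens (X : H ⊠ H) :
    LinearMap.trace ℂ (H ⊠ H) (LinearMap.mulLeft ℂ (X * (cB V B ⊗ₜ cB V B))) = Wedd.tens (fB V B) (fB V B) X := by
  induction X using TI with
  | zero => simp
  | tmul a b =>
    rw [Wedd.tens_tmul, ← reg_cB, ← reg_cB, ← LinearMap.trace_tensorProduct']
    congr 1
    ext x y
    simp [mul_assoc]
  | add a b ha hb =>
    rw [add_mul, map_add, ← ha, ← hb, ← map_add]
    congr 1
    ext; simp [add_mul, mul_assoc]
lemma del_cB [SI H] (hB : (frd I V SI.h2).IsFus B) : Δ (1 - cB V B) * (cB V B ⊗ₜ cB V B) = 0 := by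
  have hcc : ∀ X : H ⊠ H, (cB V B ⊗ₜ cB V B) * X = X * (cB V B ⊗ₜ cB V B) := by
    intro X
    induction X using TI with
    | zero => simp
    | tmul a b => simp [cB_comm]
    | add a b ha hb => rw [mul_add, add_mul, ha, hb]
  have hi1 : (1 - cB V B) * (1 - cB V B) = 1 - cB V B := by
    rw [mul_sub, sub_mul, sub_mul, cB_idem]; simp
  have hi2 : Δ (1 - cB V B) * Δ (1 - cB V B) = Δ (1 - cB V B) := by
    rw [← Bialgebra.comul_mul, hi1]
  have hi3 : (cB V B ⊗ₜ cB V B) * (cB V B ⊗ₜ cB V B) = (cB V B ⊗ₜ[ℂ] cB V B) := by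
    simp [cB_idem]
  set z := Δ (1 - cB V B) * (cB V B ⊗ₜ cB V B) with hz
  have hzz : z * z = z := by
    rw [hz, mul_assoc, ← mul_assoc (cB V B ⊗ₜ cB V B), hcc, mul_assoc, hi3, ← mul_assoc, hi2]
  have ht : LinearMap.trace ℂ _ (LinearMap.mulLeft ℂ z) = 0 := by
    rw [hz, reg_tens]
    have h1 := congrArg (fun f : H ⇾ ℂ => f (1 - cB V B)) (fB_conv I V B hB)
    simp only [LinearMap.smul_apply, fB_cB, smul_zero] at h1
    exact h1
  have h2 := Wedd.trace_idem (LinearMap.mulLeft ℂ z) (by ext1; ext; simp [← mul_assoc, hzz])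
  rw [ht] at h2
  have h3 : Module.finrank ℂ (LinearMap.range (LinearMap.mulLeft ℂ z)) = 0 := by exact_mod_cast h2.symm
  rw [Submodule.finrank_eq_zero, LinearMap.range_eq_bot] at h3
  have := LinearMap.congr_fun h3 1
  simpa using this
lemma hopfIdeal [SI H] (hB : (frd I V SI.h2).IsFus B) : (JB V B).IsHopfIdeal ℂ := by
  refine { counit_eq_zero := ?_, map_mkQ_comul_eq_zero := ?_, antipode_mem := ?_ }
  · intro x hx
    have := (mem_JB' V B x).1 hx _ hB.o_mem 1
    rw [mul_one] at this
    rw [← χ_oo V]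
    exact this
  · intro x hx
    change Algebra.TensorProduct.map (Ideal.Quotient.mkₐ ℂ (JB V B)) (Ideal.Quotient.mkₐ ℂ (JB V B)) (Δ x) = 0
    have hx' : x ∈ JB V B := hx
    have hc : Ideal.Quotient.mkₐ ℂ (JB V B) (cB V B) = 1 := by
      have : Ideal.Quotient.mkₐ ℂ (JB V B) (1 - cB V B) = 0 := Ideal.Quotient.eq_zero_iff_mem.2 (cB_mem V B)
      rw [map_sub, map_one, sub_eq_zero] at this
      exact this.symm
    have h1 := congrArg (Algebra.TensorProduct.map (Ideal.Quotient.mkₐ ℂ (JB V B)) (Ideal.Quotient.mkₐ ℂ (JB V B))) (del_cB I V B hB)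
    rw [map_mul, Algebra.TensorProduct.map_tmul, hc, ← Algebra.TensorProduct.one_def, mul_one, map_zero] at h1
    rw [← mem_cB V B hx', Bialgebra.comul_mul, map_mul, h1, mul_zero]
  · intro x hx
    rw [mem_JB'] at hx ⊢
    intro i hi y
    change V.χ i (S x * y) = 0
    have h1 : S x * y = S (S y * x) := by rw [S_mul, SI.h2]
    have h3 := LinearMap.congr_fun (star_spec V SI.h2 i) (S y * x)
    rw [LinearMap.comp_apply] at h3
    rw [h1, h3, (V.χ_rc _).comm]
    exact hx _ (hB.st_mem i hi) _
lemma finrank_quo [SI H] : Module.finrank ℂ (H ⧸ JB V B) = (frd I V SI.h2).dim B := by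
  rw [(Ideal.quotientKerAlgEquivOfSurjective (piB_surj V B)).toLinearEquiv.finrank_eq, Module.finrank_pi_fintype]
  simp only [Module.finrank_matrix, Module.finrank_self, Fintype.card_fin, mul_one]
  rw [FR.dim, ← Finset.sum_coe_sort B]
  exact Finset.sum_congr rfl fun i _ => (pow_two _).symm
end quo
lemma exists_alg {H : Type*} [Ring H] [Algebra ℂ H] (V : Wedd.Wed H) (i : Fin V.n) (hi : V.d i = 1) :
    ∃ φ : H ⇝ ℂ, φ.toLinearMap = V.χ i := by
  refine ⟨AlgHom.ofLinearMap (V.χ i) ?_ ?_, rfl⟩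
  · rw [V.χ_one, hi]; simp
  · intro x y
    rw [V.χ_apply, V.χ_apply, V.χ_apply, map_mul, Pi.mul_apply]
    haveI : Unique (Fin (V.d i)) := by rw [hi]; infer_instance
    simp [Matrix.trace, Matrix.mul_apply]
theorem main_ind (p q : ℕ) (hp : p.Prime) (hq : q.Prime) (n : ℕ) :
    ∀ (r s : ℕ) (_ : n = p ^ r * q ^ s) (_ : 1 < n) (H : Type u) [Ring H] [HopfAlgebra ℂ H]
    [FiniteDimensional ℂ H] [IsSemisimpleRing H] (_ : Module.finrank ℂ H = n),
    ∃ φ : H ⇝ ℂ, φ ≠ Bialgebra.counitAlgHom ℂ H := by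
  induction n using Nat.strong_induction_on with
  | _ n ih =>
  intro r s hn h1 H _ _ _ _ hdim
  by_contra! hno
  obtain ⟨I⟩ := exists_integ (H := H)
  obtain ⟨V⟩ := Wedd.exists_wed H
  haveI : SI H := ⟨S2_one I V⟩
  refine no_simple I V ?_ ?_ (by rw [hdim]; exact h1) p q r s hp hq (hdim.trans hn)
  · intro B hB
    by_contra! hne
    obtain ⟨hne1, hne2⟩ := hne
    haveI := hopfIdeal I V B hB
    have hd := finrank_quo I V B
    haveI : IsSemisimpleRing (H ⧸ JB V B) :=
      RingHom.isSemisimpleRing_of_surjective (Ideal.Quotient.mk (JB V B)) Ideal.Quotient.mk_surjective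
    haveI : FiniteDimensional ℂ (H ⧸ JB V B) :=
      Module.Finite.of_surjective (Ideal.Quotient.mkₐ ℂ (JB V B)).toLinearMap Ideal.Quotient.mk_surjective
    have hdv := dim_dvd I V B hB
    rw [hdim, hn] at hdv
    obtain ⟨a, b, ha, hb, hab⟩ := Nat.dvd_mul.1 hdv
    obtain ⟨r', -, rfl⟩ := (Nat.dvd_prime_pow hp).1 ha
    obtain ⟨s', -, rfl⟩ := (Nat.dvd_prime_pow hq).1 hb
    have hlt : (frd I V SI.h2).dim B < n := by
      rw [← hdim, ← dim_frd I V]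
      obtain ⟨k, hk⟩ : ∃ k, k ∉ B := by
        by_contra! h
        exact hne2 (Finset.eq_univ_iff_forall.2 h)
      exact Finset.sum_lt_sum_of_subset (Finset.subset_univ B) (Finset.mem_univ k) hk (pow_pos (V.pos k) 2)
        (fun _ _ _ => Nat.zero_le _)
    have hgt : 1 < (frd I V SI.h2).dim B := by
      obtain ⟨k, hk, hko⟩ : ∃ k ∈ B, k ≠ oo V := by
        by_contra! h
        exact hne1 (Finset.eq_singleton_iff_unique_mem.2 ⟨hB.o_mem, h⟩)
      have h5 : ({oo V} : Finset (Fin V.n)) ⊆ B := Finset.singleton_subset_iff.2 hB.o_mem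
      have h6 : ∑ i ∈ ({oo V} : Finset (Fin V.n)), V.d i ^ 2 < ∑ i ∈ B, V.d i ^ 2 :=
        Finset.sum_lt_sum_of_subset h5 hk (by simpa using hko) (pow_pos (V.pos k) 2) (fun _ _ _ => Nat.zero_le _)
      rw [Finset.sum_singleton, d_oo, one_pow] at h6
      exact h6
    obtain ⟨φ, hφ⟩ := ih _ hlt r' s' hab.symm hgt (H ⧸ JB V B) hd
    apply hφ
    have h7 := hno (φ.comp (Ideal.Quotient.mkₐ ℂ (JB V B)))
    ext x
    obtain ⟨x, rfl⟩ := Ideal.Quotient.mk_surjective x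
    have h8 := congrArg (fun f : H ⇝ ℂ => f x) h7
    exact h8
  · intro i hi
    obtain ⟨φ, hφ⟩ := exists_alg V i hi
    apply χ_inj V
    rw [← hφ, hno φ, χ_oo]
    rfl
end HopfLR
end

/-- Every semisimple Hopf algebra over ℂ of dimension `p^r * q^s > 1` (with `p, q` prime)
has a nontrivial one-dimensional representation, i.e. a ℂ-algebra homomorphism to ℂ
different from the counit. -/
theorem semisimple_hopf_dim_prime_power_product_has_nontrivial_char
    (p q r s : ℕ) (hp : p.Prime) (hq : q.Prime) (hgt : 1 < p ^ r * q ^ s)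
    (H : Type*) [Ring H] [HopfAlgebra ℂ H]
    [FiniteDimensional ℂ H] [IsSemisimpleRing H]
    (hdim : Module.finrank ℂ H = p ^ r * q ^ s) :
    ∃ φ : H →ₐ[ℂ] ℂ, φ ≠ Bialgebra.counitAlgHom ℂ H := by
  exact HopfLR.main_ind p q hp hq _ r s rfl hgt H hdim
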